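/- For every Hurst parameter H ∈ (0,1) the constant c_H is a positive finite real number, and it has the following property: for every ρ ∈ ℝ, every t ∈ (0,∞), and every sequence (ε_n) of positive numbers with ε_n = O(n^{−η}) for some η > 0, one has lim_{n→∞} ε_n^{1/H} K_{0,t}(ε_n, B + ρ) = c_H · t almost surely. -/

import Mathlib

open MeasureTheory ProbabilityTheory Filter Set ENNReal Asymptotics
open scoped NNReal Classical Topology

noncomputable section

/-- The grid `εℤ` of levels. -/
def lvGrid (ε : ℝ) : Set ℝ := {x | ∃ k : ℤ, x = ε * k}

/-- The successive times at which the path `w` crosses to a new point of the grid `εℤ`,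
with values in `ℝ≥0∞` (`∞` meaning "never", corresponding to the convention `inf ∅ = +∞`). -/
def hitT (ε : ℝ) (w : ℝ → ℝ) : ℕ → ℝ≥0∞
  | 0 => 0
  | n + 1 =>
      ⨅ (r : ℝ) (_ : hitT ε w n < ENNReal.ofReal r ∧ w r ∈ lvGrid ε ∧
          w r ≠ w ((hitT ε w n).toReal)), ENNReal.ofReal r

/-- `K_{s,t}(ε,w)`: the number of `ε`-level crossings of `w` in the interval `[s,t]`,
namely `#{n ≥ 2 : T_n(ε, w_{s+·}) ≤ t-s} + 1_{w_s ∈ εℤ}·1_{T_1(ε, w_{s+·}) ≤ t-s}`,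
as an extended natural number. -/
def crossK (ε : ℝ) (w : ℝ → ℝ) (s t : ℝ) : ℕ∞ :=
  {n : ℕ | 2 ≤ n ∧ hitT ε (fun r => w (s + r)) n ≤ ENNReal.ofReal (t - s)}.encard
    + (if w s ∈ lvGrid ε ∧ hitT ε (fun r => w (s + r)) 1 ≤ ENNReal.ofReal (t - s)
        then 1 else 0)

/-- `K_{s,t}(ε,w)` as an extended nonnegative real. -/
def crossKe (ε : ℝ) (w : ℝ → ℝ) (s t : ℝ) : ℝ≥0∞ := (crossK ε w s t : ℝ≥0∞)

/-- `K_{s,t}(ε,w)` as a real number (junk value `0` if the count is infinite). -/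
def crossKR (ε : ℝ) (w : ℝ → ℝ) (s t : ℝ) : ℝ := (crossKe ε w s t).toReal

/-- The averaged crossing count `K̄_{s,t}(ε,w) = ε⁻¹ ∫_{-ε/2}^{ε/2} K_{s,t}(ε, w+ρ) dρ`. -/
def avgK (ε : ℝ) (w : ℝ → ℝ) (s t : ℝ) : ℝ≥0∞ :=
  ENNReal.ofReal ε⁻¹ * ∫⁻ ρ in Set.Ioo (-(ε / 2)) (ε / 2), crossKe ε (fun r => w r + ρ) s t

/-- `B` is a fractional Brownian motion with Hurst parameter `H` under `P`:
a centered Gaussian process with continuous paths, `B 0 = 0`, and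
`E[(B_t - B_s)^2] = a_H |t-s|^(2H)` for some constant `a_H > 0`. -/
def IsFBM {Ω : Type*} [MeasurableSpace Ω] (H : ℝ) (P : Measure Ω) (B : ℝ → Ω → ℝ) : Prop :=
  (∀ ω, Continuous fun t => B t ω) ∧ (∀ ω, B 0 ω = 0) ∧ (∀ t, Measurable (B t)) ∧
  (∀ (n : ℕ) (t : Fin n → ℝ) (c : Fin n → ℝ), ∃ v : ℝ≥0,
      Measure.map (fun ω => ∑ i, c i * B (t i) ω) P = gaussianReal 0 v) ∧
  (∃ aH : ℝ, 0 < aH ∧ ∀ s t : ℝ, ∫ ω, (B t ω - B s ω) ^ 2 ∂P = aH * |t - s| ^ (2 * H))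

/-- The constant `c_H = sup_{t>0} t⁻¹ E[K̄_{0,t}(1,B)] (= lim_{t→∞} t⁻¹ E[K̄_{0,t}(1,B)]`,
the limit existing by superadditivity and Fekete's lemma), as an extended nonnegative real. -/
def cHe {Ω : Type*} [MeasurableSpace Ω] (P : Measure Ω) (B : ℝ → Ω → ℝ) : ℝ≥0∞ :=
  ⨆ (t : ℝ) (_ : 0 < t), (ENNReal.ofReal t)⁻¹ * ∫⁻ ω, avgK 1 (fun r => B r ω) 0 t ∂P

/-- The constant `c_H` as a real number. -/
def cH {Ω : Type*} [MeasurableSpace Ω] (P : Measure Ω) (B : ℝ → Ω → ℝ) : ℝ :=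
  (cHe P B).toReal

noncomputable section

/-! ## Part A: hitting times -/

lemma hitT_zero (ε : ℝ) (w : ℝ → ℝ) : hitT ε w 0 = 0 := by simp [hitT]

lemma hitT_le {ε : ℝ} {w : ℝ → ℝ} {n : ℕ} {r : ℝ} (h1 : hitT ε w n < ENNReal.ofReal r)
    (h2 : w r ∈ lvGrid ε) (h3 : w r ≠ w ((hitT ε w n).toReal)) :
    hitT ε w (n + 1) ≤ ENNReal.ofReal r := by
  rw [hitT]
  exact iInf₂_le r ⟨h1, h2, h3⟩

lemma hitT_mono_succ (ε : ℝ) (w : ℝ → ℝ) (n : ℕ) : hitT ε w n ≤ hitT ε w (n + 1) := by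
  rw [hitT]
  exact le_iInf₂ fun r hr => hr.1.le

lemma hitT_mono (ε : ℝ) (w : ℝ → ℝ) : Monotone (hitT ε w) :=
  monotone_nat_of_le_succ (hitT_mono_succ ε w)

lemma isClosed_lvGrid_sub {ε : ℝ} (hε : 0 < ε) (S : Set ℝ) (hS : S ⊆ lvGrid ε) : IsClosed S := by
  have : S = (fun x : ℝ => x / ε) ⁻¹' ((fun k : ℤ => (k : ℝ)) '' {k : ℤ | ε * k ∈ S}) := by
    ext x
    simp only [Set.mem_preimage, Set.mem_image, Set.mem_ofPred_eq]
    constructor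
    · intro hx
      obtain ⟨k, hk⟩ := hS hx
      refine ⟨k, hk ▸ hx, ?_⟩
      rw [hk]; field_simp
    · rintro ⟨k, hk, hkx⟩
      have : x = ε * k := by rw [hkx]; field_simp
      rwa [this]
  rw [this]
  refine IsClosed.preimage (by fun_prop) ?_
  exact Int.isClosedEmbedding_coe_real.isClosedMap _ (isClosed_discrete _)

lemma hit_spec {ε : ℝ} (hε : 0 < ε) {w : ℝ → ℝ} (hw : Continuous w) {n : ℕ}
    (h : hitT ε w (n + 1) ≠ ⊤) :
    ∃ r : ℝ, hitT ε w (n + 1) = ENNReal.ofReal r ∧ 0 < r ∧ hitT ε w n < ENNReal.ofReal r ∧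
      w r ∈ lvGrid ε ∧ w r ≠ w ((hitT ε w n).toReal) := by
  set T := hitT ε w n with hT
  have hTt : T ≠ ⊤ := fun hh => h (top_unique (hh ▸ hitT_mono_succ ε w n))
  set A : Set ℝ := {r : ℝ | T.toReal ≤ r ∧ w r ∈ {y | y ∈ lvGrid ε ∧ y ≠ w T.toReal}} with hA
  have hAc : IsClosed A := by
    refine (isClosed_le continuous_const continuous_id).inter ?_
    exact (isClosed_lvGrid_sub hε {y | y ∈ lvGrid ε ∧ y ≠ w T.toReal} (fun y hy => hy.1)).preimage hw
  have hmem : ∀ r, (T < ENNReal.ofReal r ∧ w r ∈ lvGrid ε ∧ w r ≠ w T.toReal) ↔ r ∈ A := by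
    intro r
    constructor
    · rintro ⟨h1, h2, h3⟩
      exact ⟨(ENNReal.lt_ofReal_iff_toReal_lt hTt).1 h1 |>.le, h2, h3⟩
    · rintro ⟨h1, h2, h3⟩
      refine ⟨(ENNReal.lt_ofReal_iff_toReal_lt hTt).2 (lt_of_le_of_ne h1 ?_), h2, h3⟩
      rintro hh
      exact h3 (by rw [← hh])
  have hne : A.Nonempty := by
    by_contra hne
    apply h
    rw [hitT]
    refine iInf₂_eq_top.2 fun r hr => ?_
    exact (hne ⟨r, (hmem r).1 hr⟩).elim
  have hbdd : BddBelow A := ⟨T.toReal, fun r hr => hr.1⟩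
  have hin := hAc.csInf_mem hne hbdd
  have hin' := (hmem _).2 hin
  refine ⟨sInf A, ?_, ?_, hin'.1, hin'.2.1, hin'.2.2⟩
  · apply le_antisymm
    · exact hitT_le hin'.1 hin'.2.1 hin'.2.2
    · rw [hitT]
      refine le_iInf₂ fun r hr => ENNReal.ofReal_le_ofReal ?_
      exact csInf_le hbdd ((hmem r).1 hr)
  · have := (ENNReal.lt_ofReal_iff_toReal_lt hTt).1 hin'.1
    exact lt_of_le_of_lt ENNReal.toReal_nonneg this

lemma crossK_eq {ε : ℝ} (hε : 0 < ε) {w : ℝ → ℝ} (hw : Continuous w) (t : ℝ) :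
    crossK ε w 0 t = {n : ℕ | hitT ε w (n + 1) ≤ ENNReal.ofReal t ∧
      w ((hitT ε w n).toReal) ∈ lvGrid ε}.encard := by
  unfold crossK
  simp only [zero_add, sub_zero]
  set S := {n : ℕ | hitT ε w (n + 1) ≤ ENNReal.ofReal t ∧
      w ((hitT ε w n).toReal) ∈ lvGrid ε} with hS
  have h1 : {n | 2 ≤ n ∧ hitT ε w n ≤ ENNReal.ofReal t} = Nat.succ '' (S \ {0}) := by
    ext n
    simp only [Set.mem_ofPred_eq, Set.mem_image, Set.mem_sdiff, Set.mem_singleton_iff, hS]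
    constructor
    · rintro ⟨h2, h3⟩
      obtain ⟨j, rfl⟩ : ∃ j, n = j + 2 := ⟨n - 2, by omega⟩
      refine ⟨j + 1, ⟨⟨h3, ?_⟩, by omega⟩, rfl⟩
      have hj : hitT ε w (j + 1) ≠ ⊤ :=
        ne_top_of_le_ne_top ofReal_ne_top ((hitT_mono_succ ε w (j+1)).trans h3)
      obtain ⟨r, hr, hr0, -, hr2, -⟩ := hit_spec hε hw hj
      rw [hr, ENNReal.toReal_ofReal hr0.le]; exact hr2
    · rintro ⟨j, ⟨⟨h3, _⟩, h0⟩, rfl⟩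
      exact ⟨by omega, h3⟩
  rw [h1, Nat.succ_injective.encard_image]
  have h0 : (w 0 ∈ lvGrid ε ∧ hitT ε w 1 ≤ ENNReal.ofReal t) ↔ 0 ∈ S := by
    simp only [hS, Set.mem_ofPred_eq, hitT_zero, ENNReal.toReal_zero, zero_add]
    exact and_comm
  simp only [h0]
  by_cases h : 0 ∈ S
  · rw [if_pos h]; exact Set.encard_sdiff_singleton_add_one h
  · rw [if_neg h, Set.sdiff_singleton_eq_self h, add_zero]

/-- upcrossing lemma -/
lemma upcross {ε : ℝ} (hε : 0 < ε) {w : ℝ → ℝ} (hw : Continuous w) {t r s : ℝ} {k : ℤ}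
    (hr : 0 ≤ r) (hrs : r < s) (hst : s ≤ t) (h1 : w r ≤ ε * k) (h2 : ε * (k + 1) ≤ w s)
    (hex : ∃ n, ENNReal.ofReal t < hitT ε w n) :
    ∃ n : ℕ, ∃ x : ℝ, hitT ε w (n + 1) = ENNReal.ofReal x ∧ r < x ∧ x ≤ s ∧
      w ((hitT ε w n).toReal) = ε * k ∧ w x = ε * (k + 1) := by
  have hkk : ε * (k : ℝ) < ε * (k + 1) := by nlinarith
  -- u
  set U : Set ℝ := Icc r s ∩ w ⁻¹' (Iic (ε * k)) with hU
  have hUc : IsCompact U := isCompact_Icc.inter_right (isClosed_Iic.preimage hw)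
  have hUn : U.Nonempty := ⟨r, ⟨le_rfl, hrs.le⟩, h1⟩
  set u := sSup U
  have hu : u ∈ U := hUc.sSup_mem hUn
  have hu_max : ∀ x ∈ Icc r s, u < x → ε * k < w x := by
    intro x hx hux
    by_contra hh
    push Not at hh
    exact absurd (le_csSup hUc.bddAbove ⟨hx, hh⟩) (not_le.2 hux)
  have hus : u < s := by
    refine lt_of_le_of_ne hu.1.2 ?_
    intro hh
    have := hu.2
    simp only [Set.mem_preimage, Set.mem_Iic, hh] at this
    linarith
  have hwu : w u = ε * k := by
    refine le_antisymm hu.2 ?_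
    by_contra hh
    push Not at hh
    obtain ⟨y, hy, hy2⟩ := intermediate_value_Icc hus.le hw.continuousOn
      (show ε * (k:ℝ) ∈ Icc (w u) (w s) from ⟨hh.le, by linarith⟩)
    rcases eq_or_lt_of_le hy.1 with h | h
    · rw [← h] at hy2; linarith
    · have := hu_max y ⟨hu.1.1.trans hy.1, hy.2⟩ h
      linarith
  set V : Set ℝ := Icc u s ∩ w ⁻¹' (Ici (ε * (k + 1))) with hV
  have hVc : IsCompact V := isCompact_Icc.inter_right (isClosed_Ici.preimage hw)
  have hVn : V.Nonempty := ⟨s, ⟨hus.le, le_rfl⟩, h2⟩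
  set v := sInf V
  have hv : v ∈ V := hVc.sInf_mem hVn
  have hv_min : ∀ x ∈ Icc u s, x < v → w x < ε * (k + 1) := by
    intro x hx hxv
    by_contra hh
    push Not at hh
    exact absurd (csInf_le hVc.bddBelow ⟨hx, hh⟩) (not_le.2 hxv)
  have huv : u < v := by
    refine lt_of_le_of_ne hv.1.1 ?_
    intro hh
    have := hv.2
    simp only [Set.mem_preimage, Set.mem_Ici, ← hh, hwu] at this
    linarith
  have hwv : w v = ε * (k + 1) := by
    refine le_antisymm ?_ hv.2
    by_contra hh
    push Not at hh
    obtain ⟨y, hy, hy2⟩ := intermediate_value_Icc huv.le hw.continuousOn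
      (show ε * ((k:ℝ)+1) ∈ Icc (w u) (w v) from ⟨by linarith, hh.le⟩)
    rcases eq_or_lt_of_le hy.2 with h | h
    · rw [h] at hy2; linarith
    · have := hv_min y ⟨hy.1, hy.2.trans hv.1.2⟩ h
      linarith
  have hu0 : 0 ≤ u := hr.trans hu.1.1
  have hex' : ∃ n, ENNReal.ofReal u < hitT ε w n := by
    obtain ⟨n, hn⟩ := hex
    exact ⟨n, lt_of_le_of_lt (ENNReal.ofReal_le_ofReal (hus.le.trans hst)) hn⟩
  have hfind := Nat.find_spec hex'
  have hmin := fun m => Nat.find_min hex' (m := m)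
  obtain ⟨n, hn⟩ : ∃ n, Nat.find hex' = n + 1 := by
    refine Nat.exists_eq_succ_of_ne_zero ?_
    intro h0
    rw [h0, hitT_zero] at hfind
    exact absurd hfind (by simp)
  rw [hn] at hfind hmin
  have hTn : hitT ε w n ≤ ENNReal.ofReal u := not_lt.1 (hmin n (by omega))
  have hTnt : hitT ε w n ≠ ⊤ := ne_top_of_le_ne_top ofReal_ne_top hTn
  have hTnr : (hitT ε w n).toReal ≤ u := by
    have := ENNReal.toReal_mono ofReal_ne_top hTn
    rwa [ENNReal.toReal_ofReal hu0] at this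
  have hwT : w ((hitT ε w n).toReal) = ε * k := by
    by_contra hne
    have hlt : hitT ε w n < ENNReal.ofReal u := by
      rw [ENNReal.lt_ofReal_iff_toReal_lt hTnt]
      refine lt_of_le_of_ne hTnr ?_
      intro hh
      exact hne (by rw [hh, hwu])
    have := hitT_le hlt ⟨k, hwu⟩ (by rw [hwu]; exact fun h => hne h.symm)
    exact absurd this (not_le.2 hfind)
  have hTv : hitT ε w (n + 1) ≤ ENNReal.ofReal v := by
    refine hitT_le ?_ ⟨k + 1, by rw [hwv]; push_cast; ring⟩ ?_
    · exact lt_of_le_of_lt hTn ((ENNReal.ofReal_lt_ofReal_iff (by linarith)).2 huv)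
    · rw [hwT, hwv]; linarith
  obtain ⟨x, hx, hx0, hx1, ⟨k', hk'⟩, hx3⟩ := hit_spec hε hw (ne_top_of_le_ne_top ofReal_ne_top hTv)
  rw [hx] at hTv hfind
  have hxv : x ≤ v := (ENNReal.ofReal_le_ofReal_iff (by linarith)).1 hTv
  have hux : u < x := (ENNReal.ofReal_lt_ofReal_iff hx0).1 hfind
  have hxv' : x = v := by
    by_contra hne
    have hlt : x < v := lt_of_le_of_ne hxv hne
    have hvs := hv.1.2
    have a1 := hu_max x ⟨hu.1.1.trans hux.le, by linarith⟩ hux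
    have a2 := hv_min x ⟨hux.le, by linarith⟩ hlt
    rw [hk'] at a1 a2
    have b1 : (k : ℝ) < k' := lt_of_mul_lt_mul_left a1 hε.le
    have b2 : (k' : ℝ) < k + 1 := lt_of_mul_lt_mul_left a2 hε.le
    have c1 : k < k' := by exact_mod_cast b1
    have c2 : k' < k + 1 := by exact_mod_cast b2
    omega
  exact ⟨n, x, hx, lt_of_le_of_lt hu.1.1 hux, hxv.trans hv.1.2, hwT, hxv' ▸ hwv⟩

lemma lvGrid_neg {ε x : ℝ} : -x ∈ lvGrid ε ↔ x ∈ lvGrid ε := by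
  constructor
  · rintro ⟨k, hk⟩; exact ⟨-k, by push_cast; linarith⟩
  · rintro ⟨k, hk⟩; exact ⟨-k, by push_cast; linarith⟩

lemma hitT_neg (ε : ℝ) (w : ℝ → ℝ) (n : ℕ) : hitT ε (fun r => - w r) n = hitT ε w n := by
  induction n with
  | zero => simp [hitT_zero]
  | succ n ih => rw [hitT, hitT, ih]; simp only [lvGrid_neg, ne_eq, neg_inj]

/-- downcrossing lemma -/
lemma downcross {ε : ℝ} (hε : 0 < ε) {w : ℝ → ℝ} (hw : Continuous w) {t r s : ℝ} {k : ℤ}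
    (hr : 0 ≤ r) (hrs : r < s) (hst : s ≤ t) (h1 : ε * (k + 1) ≤ w r) (h2 : w s ≤ ε * k)
    (hex : ∃ n, ENNReal.ofReal t < hitT ε w n) :
    ∃ n : ℕ, ∃ x : ℝ, hitT ε w (n + 1) = ENNReal.ofReal x ∧ r < x ∧ x ≤ s ∧
      w ((hitT ε w n).toReal) = ε * (k + 1) ∧ w x = ε * k := by
  obtain ⟨n, x, a, b, c, d, e⟩ := upcross hε (w := fun r => - w r) (by fun_prop) (t := t) (k := -(k+1)) hr hrs hst
    (by push_cast; linarith) (by push_cast; linarith)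
    (by simpa only [hitT_neg] using hex)
  simp only [hitT_neg] at a d
  push_cast at d e
  exact ⟨n, x, a, b, c, by linarith, by linarith⟩

/-! ## packings -/

def crs (δ : ℝ) (k : ℤ) (x y : ℝ) : Prop :=
  (x ≤ k + δ ∧ k + 1 - δ ≤ y) ∨ (k + 1 - δ ≤ x ∧ y ≤ k + δ)

def scrs (k : ℤ) (x y : ℝ) : Prop :=
  (x < k ∧ k + 1 < y) ∨ (k + 1 < x ∧ y < k)

/-- mixed packing -/
def MP (S : Set ℝ) (w : ℝ → ℝ) (δ : ℝ) (m : ℕ) : Prop :=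
  ∃ F : Finset (ℝ × ℝ), F.card = m ∧
    (∀ p ∈ F, p.1 ∈ S ∧ p.2 ∈ S ∧ p.1 < p.2 ∧ ∃ k : ℤ, crs δ k (w p.1) (w p.2)) ∧
    ∀ p ∈ F, ∀ p' ∈ F, p ≠ p' → p.2 ≤ p'.1 ∨ p'.2 ≤ p.1

/-- labelled packing -/
def LP (S : Set ℝ) (w : ℝ → ℝ) (m : ℕ) : Prop :=
  ∃ F : Finset (ℝ × ℝ × ℤ), F.card = m ∧
    (∀ p ∈ F, p.1 ∈ S ∧ p.2.1 ∈ S ∧ p.1 < p.2.1 ∧ scrs p.2.2 (w p.1) (w p.2.1)) ∧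
    ∀ p ∈ F, ∀ p' ∈ F, p ≠ p' → p.2.2 ≠ p'.2.2 ∨ p.2.1 ≤ p'.1 ∨ p'.2.1 ≤ p.1

lemma le_encard_iff {α : Type*} (S : Set α) (m : ℕ) :
    (m : ℕ∞) ≤ S.encard ↔ ∃ F : Finset α, F.card = m ∧ (F : Set α) ⊆ S := by
  constructor
  · intro h
    obtain ⟨t, ht, htm⟩ := Set.exists_subset_encard_eq h
    have hfin : t.Finite := Set.finite_of_encard_eq_coe htm
    refine ⟨hfin.toFinset, ?_, by simpa using ht⟩
    rw [hfin.encard_eq_coe_toFinset_card] at htm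
    exact_mod_cast htm
  · rintro ⟨F, rfl, hF⟩
    calc ((F.card : ℕ) : ℕ∞) = (F : Set α).encard := (Set.encard_coe_eq_coe_finsetCard F).symm
      _ ≤ _ := Set.encard_le_encard hF

lemma labelled_le_crossK {ε : ℝ} (hε : 0 < ε) {w : ℝ → ℝ} (hw : Continuous w) {t : ℝ}
    (F : Finset (ℝ × ℝ × ℤ))
    (hF : ∀ p ∈ F, p.1 ∈ Icc 0 t ∧ p.2.1 ∈ Icc 0 t ∧ p.1 < p.2.1 ∧
      crs 0 p.2.2 (w p.1 / ε) (w p.2.1 / ε))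
    (hF2 : ∀ p ∈ F, ∀ p' ∈ F, p ≠ p' → p.2.2 ≠ p'.2.2 ∨ p.2.1 ≤ p'.1 ∨ p'.2.1 ≤ p.1) :
    (F.card : ℕ∞) ≤ crossK ε w 0 t := by
  rw [crossK_eq hε hw]
  set S := {n : ℕ | hitT ε w (n + 1) ≤ ENNReal.ofReal t ∧
      w ((hitT ε w n).toReal) ∈ lvGrid ε} with hS
  by_cases hex : ∃ n, ENNReal.ofReal t < hitT ε w n
  · have key : ∀ p : F, ∃ n : ℕ, ∃ x : ℝ, hitT ε w (n + 1) = ENNReal.ofReal x ∧ p.1.1 < x ∧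
        x ≤ p.1.2.1 ∧ ((w ((hitT ε w n).toReal) = ε * p.1.2.2 ∧ w x = ε * (p.1.2.2 + 1)) ∨
        (w ((hitT ε w n).toReal) = ε * (p.1.2.2 + 1) ∧ w x = ε * p.1.2.2)) := by
      rintro ⟨p, hp⟩
      obtain ⟨h1, h2, h3, h4⟩ := hF p hp
      rcases h4 with ⟨h5, h6⟩ | ⟨h5, h6⟩
      · rw [add_zero, div_le_iff₀ hε] at h5
        rw [sub_zero, le_div_iff₀ hε] at h6
        obtain ⟨n, x, a, b, c, d, e⟩ := upcross hε hw h1.1 h3 h2.2 (k := p.2.2)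
          (by linarith) (by linarith) hex
        exact ⟨n, x, a, b, c, Or.inl ⟨d, e⟩⟩
      · rw [add_zero, div_le_iff₀ hε] at h6
        rw [sub_zero, le_div_iff₀ hε] at h5
        obtain ⟨n, x, a, b, c, d, e⟩ := downcross hε hw h1.1 h3 h2.2 (k := p.2.2)
          (by linarith) (by linarith) hex
        exact ⟨n, x, a, b, c, Or.inr ⟨d, e⟩⟩
    choose n x hx1 hx2 hx3 hx4 using key
    have hinj : Function.Injective n := by
      rintro ⟨p, hp⟩ ⟨p', hp'⟩ hnn
      by_contra hne
      have hne' : p ≠ p' := fun h => hne (by simp [h])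
      have hx0 : 0 < x ⟨p, hp⟩ := lt_of_le_of_lt (hF p hp).1.1 (hx2 ⟨p, hp⟩)
      have hx0' : 0 < x ⟨p', hp'⟩ := lt_of_le_of_lt (hF p' hp').1.1 (hx2 ⟨p', hp'⟩)
      have hxx : x ⟨p, hp⟩ = x ⟨p', hp'⟩ := by
        have h1 := hx1 ⟨p, hp⟩
        have h2 := hx1 ⟨p', hp'⟩
        rw [hnn, h2] at h1
        exact ((ENNReal.ofReal_eq_ofReal_iff hx0'.le hx0.le).1 h1).symm
      have h2 := hx2 ⟨p, hp⟩
      have h2' := hx2 ⟨p', hp'⟩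
      have h3 := hx3 ⟨p, hp⟩
      have h3' := hx3 ⟨p', hp'⟩
      have h4 := hx4 ⟨p, hp⟩
      have h4' := hx4 ⟨p', hp'⟩
      rw [hxx] at h2 h3 h4
      rw [hnn] at h4
      dsimp only at h2 h2' h3 h3' h4 h4'
      have hk : p.2.2 = p'.2.2 := by
        have hc : ∀ a b : ℝ, ε * a = ε * b → a = b := fun a b h => mul_left_cancel₀ hε.ne' h
        rcases h4 with ⟨a, b⟩ | ⟨a, b⟩ <;> rcases h4' with ⟨a', b'⟩ | ⟨a', b'⟩
        · exact_mod_cast hc _ _ (a.symm.trans a')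
        · have e1 := hc _ _ (a.symm.trans a')
          have e2 := hc _ _ (b.symm.trans b')
          linarith
        · have e1 := hc _ _ (a.symm.trans a')
          have e2 := hc _ _ (b.symm.trans b')
          linarith
        · exact_mod_cast hc _ _ (b.symm.trans b')
      rcases hF2 p hp p' hp' hne' with h | h | h
      · exact h hk
      · linarith
      · linarith
    rw [le_encard_iff]
    refine ⟨Finset.univ.image n, ?_, ?_⟩
    · rw [Finset.card_image_of_injective _ hinj]; simp
    · intro j hj
      simp only [Finset.coe_image, Finset.coe_univ, Set.image_univ, Set.mem_range] at hj
      obtain ⟨p, rfl⟩ := hj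
      refine ⟨?_, ?_⟩
      · rw [hx1 p]
        exact ENNReal.ofReal_le_ofReal ((hx3 p).trans (hF p.1 p.2).2.1.2)
      · rcases hx4 p with ⟨a, b⟩ | ⟨a, b⟩
        · exact ⟨_, a⟩
        · exact ⟨p.1.2.2 + 1, by rw [a]; push_cast; ring⟩
  · push Not at hex
    have : S = Set.univ ∨ S.Infinite := by
      right
      refine Set.Infinite.mono (s := Set.range Nat.succ) ?_ (Set.infinite_range_of_injective Nat.succ_injective)
      rintro _ ⟨j, rfl⟩
      refine ⟨hex _, ?_⟩
      obtain ⟨r, hr, hr0, -, hr2, -⟩ := hit_spec hε hw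
        (ne_top_of_le_ne_top ofReal_ne_top (hex (j+1)))
      simp only [Nat.succ_eq_add_one]
      rw [hr, ENNReal.toReal_ofReal hr0.le]; exact hr2
    have hinf : S.Infinite := this.elim (fun h => h ▸ Set.infinite_univ) id
    rw [hinf.encard_eq]; exact le_top

lemma LP_le_crossK {ε : ℝ} (hε : 0 < ε) {w : ℝ → ℝ} (hw : Continuous w) {t : ℝ} {S : Set ℝ}
    (hS : S ⊆ Icc 0 t) {m : ℕ}
    (h : LP S (fun r => w r / ε) m) : (m : ℕ∞) ≤ crossK ε w 0 t := by
  obtain ⟨F, rfl, h1, h2⟩ := h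
  refine labelled_le_crossK hε hw F (fun p hp => ?_) h2
  obtain ⟨a, b, c, d⟩ := h1 p hp
  refine ⟨hS a, hS b, c, ?_⟩
  unfold crs
  rcases d with ⟨d, e⟩ | ⟨d, e⟩
  · left; constructor <;> linarith
  · right; constructor <;> linarith

lemma crossK_iff_MP {ε : ℝ} (hε : 0 < ε) {w : ℝ → ℝ} (hw : Continuous w) {t : ℝ} (m : ℕ) :
    (m : ℕ∞) ≤ crossK ε w 0 t ↔ MP (Icc 0 t) (fun r => w r / ε) 0 m := by
  constructor
  · intro h
    rw [crossK_eq hε hw, le_encard_iff] at h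
    obtain ⟨F, rfl, hF⟩ := h
    set T : ℕ → ℝ := fun n => (hitT ε w n).toReal with hT
    have spec : ∀ n ∈ F, 0 ≤ T n ∧ T n < T (n + 1) ∧ T (n + 1) ≤ t ∧
        ∃ k : ℤ, crs 0 k (w (T n) / ε) (w (T (n + 1)) / ε) := by
      intro n hn
      obtain ⟨h1, ⟨k1, hk1⟩⟩ := hF hn
      have hne := ne_top_of_le_ne_top ofReal_ne_top h1
      obtain ⟨r, hr, hr0, hr1, ⟨k2, hk2⟩, hr3⟩ := hit_spec hε hw hne
      have hTr : T (n + 1) = r := by simp only [hT]; rw [hr, ENNReal.toReal_ofReal hr0.le]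
      refine ⟨ENNReal.toReal_nonneg, ?_, ?_, ?_⟩
      · rw [hTr]; exact (ENNReal.lt_ofReal_iff_toReal_lt
          (ne_top_of_lt hr1)).1 hr1
      · rw [hTr]; rw [hr] at h1
        by_contra hh
        push Not at hh
        exact absurd ((ENNReal.ofReal_lt_ofReal_iff hr0).2 hh) (not_lt.2 h1)
      · rw [hTr, hk2]; simp only [hT]; rw [hk1]
        have hkk : k1 ≠ k2 := by
          rintro rfl
          exact hr3 (hk2.trans hk1.symm)
        rw [mul_div_cancel_left₀ _ hε.ne', mul_div_cancel_left₀ _ hε.ne']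
        rcases lt_or_gt_of_ne hkk with h | h
        · refine ⟨k1, Or.inl ⟨by simp, ?_⟩⟩
          have : (k1 : ℝ) + 1 ≤ k2 := by exact_mod_cast h
          linarith
        · refine ⟨k2, Or.inr ⟨?_, by simp⟩⟩
          have : (k2 : ℝ) + 1 ≤ k1 := by exact_mod_cast h
          linarith
    have hfin : ∀ n ∈ F, hitT ε w (n + 1) ≠ ⊤ := fun n hn =>
      ne_top_of_le_ne_top ofReal_ne_top (hF hn).1
    have hmono : ∀ n ∈ F, ∀ n' ∈ F, n < n' → T (n + 1) ≤ T n' := by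
      intro n hn n' hn' hlt
      refine ENNReal.toReal_mono ?_ (hitT_mono ε w hlt)
      exact ne_top_of_le_ne_top (hfin n' hn') (hitT_mono_succ ε w n')
    have hinj : Set.InjOn (fun n => (T n, T (n + 1))) F := by
      intro n hn n' hn' heq
      simp only [Prod.mk.injEq] at heq
      by_contra hne
      rcases lt_or_gt_of_ne hne with h | h
      · have := hmono n hn n' hn' h
        have := (spec n' hn').2.1
        linarith
      · have := hmono n' hn' n hn h
        have := (spec n hn).2.1
        linarith
    refine ⟨F.image (fun n => (T n, T (n + 1))), Finset.card_image_of_injOn hinj, ?_, ?_⟩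
    · intro p hp
      obtain ⟨n, hn, rfl⟩ := Finset.mem_image.1 hp
      obtain ⟨a, b, c, d⟩ := spec n hn
      exact ⟨⟨a, by dsimp only; linarith⟩, ⟨by dsimp only; linarith, c⟩, b, d⟩
    · intro p hp p' hp' hne
      obtain ⟨n, hn, rfl⟩ := Finset.mem_image.1 hp
      obtain ⟨n', hn', rfl⟩ := Finset.mem_image.1 hp'
      have hnn : n ≠ n' := by rintro rfl; exact hne rfl
      rcases lt_or_gt_of_ne hnn with h | h
      · left; exact hmono n hn n' hn' h
      · right; exact hmono n' hn' n hn h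
  · rintro ⟨F, rfl, h1, h2⟩
    choose! k hk using fun p hp => (h1 p hp).2.2.2
    have hinj : Function.Injective (fun p : ℝ × ℝ => (p.1, p.2, k p)) := by
      rintro ⟨a, b⟩ ⟨a', b'⟩ h
      simp only [Prod.mk.injEq] at h
      simp [h.1, h.2.1]
    rw [← Finset.card_image_of_injective F hinj]
    refine labelled_le_crossK hε hw _ ?_ ?_
    · intro p hp
      obtain ⟨q, hq, rfl⟩ := Finset.mem_image.1 hp
      obtain ⟨a, b, c, -⟩ := h1 q hq
      exact ⟨a, b, c, hk q hq⟩
    · intro p hp p' hp' hne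
      obtain ⟨q, hq, rfl⟩ := Finset.mem_image.1 hp
      obtain ⟨q', hq', rfl⟩ := Finset.mem_image.1 hp'
      right
      exact h2 q hq q' hq' (by rintro rfl; exact hne rfl)

end

noncomputable section

/-! ## Part A2: deterministic packings -/

def Dy (J : ℕ) : Set ℝ := {x | ∃ l : ℕ, l ≤ 2 ^ J ∧ x = (l : ℝ) / 2 ^ J}

lemma Dy_sub (J : ℕ) : Dy J ⊆ Icc 0 1 := by
  rintro x ⟨l, hl, rfl⟩
  have h2 : (0 : ℝ) < 2 ^ J := by positivity
  refine ⟨by positivity, ?_⟩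
  rw [div_le_one h2]; exact_mod_cast hl

lemma Dy_mono {J J' : ℕ} (h : J ≤ J') : Dy J ⊆ Dy J' := by
  rintro x ⟨l, hl, rfl⟩
  refine ⟨l * 2 ^ (J' - J), ?_, ?_⟩
  · calc l * 2 ^ (J' - J) ≤ 2 ^ J * 2 ^ (J' - J) := Nat.mul_le_mul_right _ hl
      _ = 2 ^ J' := by rw [← pow_add]; congr 1; omega
  · have : (2 : ℝ) ^ J' = 2 ^ J * 2 ^ (J' - J) := by rw [← pow_add]; congr 1; omega
    rw [this]; push_cast; field_simp

lemma MP_mono_set {S S' : Set ℝ} (h : S ⊆ S') {w : ℝ → ℝ} {δ : ℝ} {m : ℕ} (hm : MP S w δ m) :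
    MP S' w δ m := by
  obtain ⟨F, hF, h1, h2⟩ := hm
  exact ⟨F, hF, fun p hp => ⟨h (h1 p hp).1, h (h1 p hp).2.1, (h1 p hp).2.2⟩, h2⟩

lemma crs_mono {δ δ' : ℝ} (h : δ ≤ δ') {k : ℤ} {x y : ℝ} (hc : crs δ k x y) : crs δ' k x y := by
  unfold crs at *
  rcases hc with ⟨a, b⟩ | ⟨a, b⟩
  · left; constructor <;> linarith
  · right; constructor <;> linarith

lemma MP_mono_delta {S : Set ℝ} {w : ℝ → ℝ} {δ δ' : ℝ} (h : δ ≤ δ') {m : ℕ} (hm : MP S w δ m) :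
    MP S w δ' m := by
  obtain ⟨F, hF, h1, h2⟩ := hm
  refine ⟨F, hF, fun p hp => ?_, h2⟩
  obtain ⟨a, b, c, k, hk⟩ := h1 p hp
  exact ⟨a, b, c, k, crs_mono h hk⟩

lemma MP_mono_m {S : Set ℝ} {w : ℝ → ℝ} {δ : ℝ} {m m' : ℕ} (h : m' ≤ m) (hm : MP S w δ m) :
    MP S w δ m' := by
  obtain ⟨F, rfl, h1, h2⟩ := hm
  obtain ⟨G, hG, hGc⟩ := Finset.exists_subset_card_eq h
  exact ⟨G, hGc, fun p hp => h1 p (hG hp), fun p hp p' hp' => h2 p (hG hp) p' (hG hp')⟩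

lemma LP_mono_m {S : Set ℝ} {w : ℝ → ℝ} {m m' : ℕ} (h : m' ≤ m) (hm : LP S w m) :
    LP S w m' := by
  obtain ⟨F, rfl, h1, h2⟩ := hm
  obtain ⟨G, hG, hGc⟩ := Finset.exists_subset_card_eq h
  exact ⟨G, hGc, fun p hp => h1 p (hG hp), fun p hp p' hp' => h2 p (hG hp) p' (hG hp')⟩

lemma LP_mono_set {S S' : Set ℝ} (h : S ⊆ S') {w : ℝ → ℝ} {m : ℕ} (hm : LP S w m) :
    LP S' w m := by
  obtain ⟨F, hF, h1, h2⟩ := hm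
  exact ⟨F, hF, fun p hp => ⟨h (h1 p hp).1, h (h1 p hp).2.1, (h1 p hp).2.2⟩, h2⟩

lemma LP_zero (S : Set ℝ) (w : ℝ → ℝ) : LP S w 0 := ⟨∅, by simp⟩
lemma MP_zero (S : Set ℝ) (w : ℝ → ℝ) (δ : ℝ) : MP S w δ 0 := ⟨∅, by simp⟩

lemma LP_shift {S : Set ℝ} {w : ℝ → ℝ} {m : ℕ} (c : ℤ) (h : LP S w m) :
    LP S (fun r => w r + c) m := by
  obtain ⟨F, hF, h1, h2⟩ := h
  have hinj : Function.Injective (fun p : ℝ × ℝ × ℤ => (p.1, p.2.1, p.2.2 + c)) := by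
    rintro ⟨a, b, k⟩ ⟨a', b', k'⟩ h
    simp only [Prod.mk.injEq] at h ⊢
    exact ⟨h.1, h.2.1, by linarith [h.2.2]⟩
  refine ⟨F.image (fun p => (p.1, p.2.1, p.2.2 + c)), by
    rw [Finset.card_image_of_injective _ hinj, hF], ?_, ?_⟩
  · intro p hp
    obtain ⟨q, hq, rfl⟩ := Finset.mem_image.1 hp
    obtain ⟨a, b, d, e⟩ := h1 q hq
    refine ⟨a, b, d, ?_⟩
    unfold scrs at *
    push_cast
    rcases e with ⟨e, f⟩ | ⟨e, f⟩
    · left; constructor <;> linarith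
    · right; constructor <;> linarith
  · intro p hp p' hp' hne
    obtain ⟨q, hq, rfl⟩ := Finset.mem_image.1 hp
    obtain ⟨q', hq', rfl⟩ := Finset.mem_image.1 hp'
    have := h2 q hq q' hq' (by rintro rfl; exact hne rfl)
    simpa using this

lemma MP_shift {S : Set ℝ} {w : ℝ → ℝ} {δ : ℝ} {m : ℕ} (c : ℤ) (h : MP S w δ m) :
    MP S (fun r => w r + c) δ m := by
  obtain ⟨F, hF, h1, h2⟩ := h
  refine ⟨F, hF, fun p hp => ?_, h2⟩
  obtain ⟨a, b, d, k, e⟩ := h1 p hp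
  refine ⟨a, b, d, k + c, ?_⟩
  unfold crs at *
  push_cast
  rcases e with ⟨e, f⟩ | ⟨e, f⟩
  · left; constructor <;> linarith
  · right; constructor <;> linarith

lemma LP_append {w : ℝ → ℝ} {N m m' : ℕ} (h : LP (Icc 0 N) w m)
    (h' : LP (Icc 0 1) (fun r => w (N + r)) m') : LP (Icc 0 ((N + 1 : ℕ) : ℝ)) w (m + m') := by
  obtain ⟨F, rfl, h1, h2⟩ := h
  obtain ⟨G, rfl, g1, g2⟩ := h'
  set f : ℝ × ℝ × ℤ → ℝ × ℝ × ℤ := fun p => (N + p.1, N + p.2.1, p.2.2) with hf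
  have hinj : Function.Injective f := by
    rintro ⟨a, b, k⟩ ⟨a', b', k'⟩ h
    simpa [hf] using h
  have hdis : Disjoint F (G.image f) := by
    rw [Finset.disjoint_left]
    intro p hp hpG
    obtain ⟨q, hq, rfl⟩ := Finset.mem_image.1 hpG
    have a := h1 _ hp
    have b := g1 _ hq
    have a1 := a.2.1.2
    have a2 := a.2.2.1
    have b1 := b.1.1
    simp only [hf] at a1 a2
    linarith
  refine ⟨F ∪ G.image f, by rw [Finset.card_union_of_disjoint hdis,
    Finset.card_image_of_injective _ hinj], ?_, ?_⟩
  · intro p hp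
    rcases Finset.mem_union.1 hp with hp | hp
    · obtain ⟨a, b, c, d⟩ := h1 p hp
      push_cast
      exact ⟨⟨a.1, by linarith [a.2]⟩, ⟨b.1, by linarith [b.2]⟩, c, d⟩
    · obtain ⟨q, hq, rfl⟩ := Finset.mem_image.1 hp
      obtain ⟨a, b, c, d⟩ := g1 q hq
      push_cast
      have hN : (0 : ℝ) ≤ N := by positivity
      simp only [hf]
      exact ⟨⟨by linarith [a.1], by linarith [a.2]⟩, ⟨by linarith [b.1], by linarith [b.2]⟩,
        by linarith, d⟩
  · have cross : ∀ p ∈ F, ∀ q ∈ G, p.2.1 ≤ N + q.1 := by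
      intro p hp q hq
      have := (h1 p hp).2.1.2
      have := (g1 q hq).1.1
      linarith
    intro p hp p' hp' hne
    rcases Finset.mem_union.1 hp with hp | hp <;> rcases Finset.mem_union.1 hp' with hp' | hp'
    · exact h2 p hp p' hp' hne
    · obtain ⟨q, hq, rfl⟩ := Finset.mem_image.1 hp'
      right; left; exact cross p hp q hq
    · obtain ⟨q, hq, rfl⟩ := Finset.mem_image.1 hp
      right; right; exact cross p' hp' q hq
    · obtain ⟨q, hq, rfl⟩ := Finset.mem_image.1 hp
      obtain ⟨q', hq', rfl⟩ := Finset.mem_image.1 hp'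
      have := g2 q hq q' hq' (by rintro rfl; exact hne rfl)
      simpa [hf] using this

lemma LP_blocks {w : ℝ → ℝ} {N : ℕ} {m : ℕ → ℕ}
    (h : ∀ i < N, LP (Icc 0 1) (fun r => w (i + r)) (m i)) :
    LP (Icc 0 N) w (∑ i ∈ Finset.range N, m i) := by
  induction N with
  | zero => simpa using LP_zero _ _
  | succ N ih =>
    rw [Finset.sum_range_succ]
    exact LP_append (ih fun i hi => h i (by omega)) (h N (by omega))

/-- count of `m ∈ [1,M]` with a monotone property -/
def cnt (Q : ℕ → Prop) (M : ℕ) : ℕ := ((Finset.Icc 1 M).filter Q).card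

lemma cnt_spec {Q : ℕ → Prop} (h0 : Q 0) (hQ : ∀ m m', m' ≤ m → Q m → Q m') (M : ℕ) :
    Q (cnt Q M) := by
  by_contra hn
  set c := cnt Q M with hc
  have hsub : (Finset.Icc 1 M).filter Q ⊆ Finset.Icc 1 (c - 1) := by
    intro m hm
    simp only [Finset.mem_filter, Finset.mem_Icc] at hm ⊢
    refine ⟨hm.1.1, ?_⟩
    by_contra hh
    exact hn (hQ m c (by omega) hm.2)
  have := Finset.card_le_card hsub
  have hcpos : c ≠ 0 := by
    intro h; rw [h] at hn; exact hn h0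
  simp only [Nat.card_Icc] at this
  change c ≤ _ at this
  omega

lemma le_cnt {Q : ℕ → Prop} (hQ : ∀ m m', m' ≤ m → Q m → Q m') {M m : ℕ} (hm : m ≤ M) (h : Q m) :
    m ≤ cnt Q M := by
  have : Finset.Icc 1 m ⊆ (Finset.Icc 1 M).filter Q := by
    intro j hj
    simp only [Finset.mem_filter, Finset.mem_Icc] at hj ⊢
    exact ⟨⟨hj.1, by omega⟩, hQ m j hj.2 h⟩
  have := Finset.card_le_card this
  simpa [cnt] using this

lemma MP_Dy_le {J m : ℕ} {w : ℝ → ℝ} {δ : ℝ} (h : MP (Dy J) w δ m) : m ≤ 2 ^ J := by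
  obtain ⟨F, rfl, h1, h2⟩ := h
  choose! l hl hl2 using fun p hp => (h1 p hp).1
  have : Set.InjOn l F := by
    intro p hp p' hp' heq
    by_contra hne
    have e : p.1 = p'.1 := by rw [hl2 p hp, hl2 p' hp', heq]
    have := (h1 p hp).2.2.1
    have := (h1 p' hp').2.2.1
    rcases h2 p hp p' hp' hne with h | h <;> linarith
  rw [← Finset.card_image_of_injOn this]
  have hsub : F.image l ⊆ Finset.range (2 ^ J) := by
    intro j hj
    obtain ⟨p, hp, rfl⟩ := Finset.mem_image.1 hj
    rw [Finset.mem_range]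
    obtain ⟨l', hl', h'⟩ := (h1 p hp).2.1
    have hlt := (h1 p hp).2.2.1
    rw [hl2 p hp, h'] at hlt
    have h2 : (0 : ℝ) < 2 ^ J := by positivity
    rw [div_lt_div_iff_of_pos_right h2] at hlt
    have : l p < l' := by exact_mod_cast hlt
    omega
  simpa using Finset.card_le_card hsub

/-! ### A5 compactness -/

lemma MP_compact {w : ℝ → ℝ} (hw : Continuous w) {m : ℕ} {δ : ℕ → ℝ} (hδ : Tendsto δ atTop (𝓝 0))
    (hδ' : ∀ n, δ n < 1 / 2) (h : ∀ n, MP (Icc 0 1) w (δ n) m) : MP (Icc 0 1) w 0 m := by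
  obtain ⟨C, hC⟩ := (isCompact_Icc (a := (0:ℝ)) (b := 1)).exists_bound_of_continuousOn hw.continuousOn
  have key : ∀ n, ∃ f : Fin m → ℝ × ℝ, ∃ k : Fin m → ℤ, (∀ i, (f i).1 ∈ Icc (0:ℝ) 1 ∧ (f i).2 ∈ Icc (0:ℝ) 1 ∧
      (f i).1 < (f i).2 ∧ crs (δ n) (k i) (w (f i).1) (w (f i).2)) ∧
      ∀ i j, i ≠ j → (f i).2 ≤ (f j).1 ∨ (f j).2 ≤ (f i).1 := by
    intro n
    obtain ⟨F, hF, h1, h2⟩ := h n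
    choose! k hk using fun p hp => (h1 p hp).2.2.2
    let e := F.equivFinOfCardEq hF
    refine ⟨fun i => (e.symm i).1, fun i => k (e.symm i).1, ?_, ?_⟩
    · intro i
      have hm := (e.symm i).2
      obtain ⟨a, b, c, -⟩ := h1 _ hm
      exact ⟨a, b, c, hk _ hm⟩
    · intro i j hij
      refine h2 _ (e.symm i).2 _ (e.symm j).2 ?_
      intro hh
      exact hij (e.symm.injective (Subtype.ext hh))
  choose f k hf hf2 using key
  -- compactness
  have hcomp : IsCompact ((Set.univ.pi fun _ : Fin m => Icc (0:ℝ) 1 ×ˢ Icc (0:ℝ) 1) ×ˢ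
      (Set.univ.pi fun _ : Fin m => Icc (-⌈C⌉ - 2 : ℤ) (⌈C⌉ + 2))) :=
    (isCompact_univ_pi fun _ => isCompact_Icc.prod isCompact_Icc).prod
      (isCompact_univ_pi fun _ => isCompact_Icc)
  have hmem : ∀ n, ((f n, k n) : (Fin m → ℝ × ℝ) × (Fin m → ℤ)) ∈
      ((Set.univ.pi fun _ : Fin m => Icc (0:ℝ) 1 ×ˢ Icc (0:ℝ) 1) ×ˢ
      (Set.univ.pi fun _ : Fin m => Icc (-⌈C⌉ - 2 : ℤ) (⌈C⌉ + 2))) := by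
    intro n
    refine ⟨fun i _ => ⟨(hf n i).1, (hf n i).2.1⟩, fun i _ => ?_⟩
    obtain ⟨a, b, c, d⟩ := hf n i
    have ha := abs_le.1 (hC _ a)
    have hb := abs_le.1 (hC _ b)
    have hc := Int.le_ceil C
    have hd := hδ' n
    have : (-⌈C⌉ - 2 : ℝ) ≤ k n i ∧ (k n i : ℝ) ≤ ⌈C⌉ + 2 := by
      unfold crs at d
      rcases d with ⟨d, e⟩ | ⟨d, e⟩ <;> constructor <;> linarith
    exact ⟨by exact_mod_cast this.1, by exact_mod_cast this.2⟩
  obtain ⟨⟨g, l⟩, hgl, φ, hφ, hlim⟩ := hcomp.tendsto_subseq hmem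
  have hg : Tendsto (fun n => f (φ n)) atTop (𝓝 g) := by
    simpa [Function.comp_def] using (continuous_fst.tendsto _).comp hlim
  have hl : Tendsto (fun n => k (φ n)) atTop (𝓝 l) := by
    simpa [Function.comp_def] using (continuous_snd.tendsto _).comp hlim
  have hgi1 : ∀ i, Tendsto (fun n => (f (φ n) i).1) atTop (𝓝 (g i).1) := fun i =>
    (continuous_fst.tendsto _).comp (tendsto_pi_nhds.1 hg i)
  have hgi2 : ∀ i, Tendsto (fun n => (f (φ n) i).2) atTop (𝓝 (g i).2) := fun i =>
    (continuous_snd.tendsto _).comp (tendsto_pi_nhds.1 hg i)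
  have hli : ∀ i, ∀ᶠ n in atTop, k (φ n) i = l i := by
    intro i
    have := tendsto_pi_nhds.1 hl i
    rw [nhds_discrete, tendsto_pure] at this
    exact this
  have hδφ := hδ.comp hφ.tendsto_atTop
  have hcl : ∀ k : ℤ, IsClosed {z : ℝ × ℝ × ℝ | crs z.1 k z.2.1 z.2.2} := by
    intro k
    unfold crs
    simp only [Set.ofPred_or, Set.ofPred_and]
    refine IsClosed.union (IsClosed.inter ?_ ?_) (IsClosed.inter ?_ ?_) <;>
      exact isClosed_le (by fun_prop) (by fun_prop)
  have hcrs : ∀ i, crs 0 (l i) (w (g i).1) (w (g i).2) := by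
    intro i
    have ht : Tendsto (fun n => (δ (φ n), w (f (φ n) i).1, w (f (φ n) i).2)) atTop
        (𝓝 (0, w (g i).1, w (g i).2)) := Filter.Tendsto.prodMk_nhds hδφ
          (((hw.tendsto _).comp (hgi1 i)).prodMk_nhds ((hw.tendsto _).comp (hgi2 i)))
    have := (hcl (l i)).mem_of_tendsto ht ?_
    · exact this
    · filter_upwards [hli i] with n hn
      rw [← hn]
      exact (hf (φ n) i).2.2.2
  have hle : ∀ i, (g i).1 < (g i).2 := by
    intro i
    refine lt_of_le_of_ne (le_of_tendsto_of_tendsto' (hgi1 i) (hgi2 i) fun n => (hf (φ n) i).2.2.1.le) ?_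
    intro hh
    have := hcrs i
    rw [hh] at this
    unfold crs at this
    rcases this with ⟨a, b⟩ | ⟨a, b⟩ <;> linarith
  have hno : ∀ i j, i ≠ j → (g i).2 ≤ (g j).1 ∨ (g j).2 ≤ (g i).1 := by
    intro i j hij
    by_contra hh
    push Not at hh
    have h1 := (hgi1 j).eventually_lt (hgi2 i) hh.1
    have h2 := (hgi1 i).eventually_lt (hgi2 j) hh.2
    obtain ⟨n, h1, h2⟩ := (h1.and h2).exists
    rcases hf2 (φ n) i j hij with h | h <;> linarith
  have hinj : Function.Injective g := by
    intro i j hij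
    by_contra hne
    have := hle i
    have := hle j
    rcases hno i j hne with h | h <;> rw [hij] at * <;> linarith
  refine ⟨Finset.univ.image g, by rw [Finset.card_image_of_injective _ hinj]; simp, ?_, ?_⟩
  · intro p hp
    obtain ⟨i, -, rfl⟩ := Finset.mem_image.1 hp
    have := hgl.1 i (Set.mem_univ _)
    exact ⟨this.1, this.2, hle i, l i, hcrs i⟩
  · intro p hp p' hp' hne
    obtain ⟨i, -, rfl⟩ := Finset.mem_image.1 hp
    obtain ⟨j, -, rfl⟩ := Finset.mem_image.1 hp'
    exact hno i j (by rintro rfl; exact hne rfl)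

end

noncomputable section

/-! ### A4: perturbation to dyadic times -/

lemma exists_dyadic_near {u η : ℝ} (hu : u ∈ Icc (0:ℝ) 1) (hη : 0 < η) {U : Set ℝ}
    (hU : IsOpen U) (hne : ∃ x ∈ U, x ∈ Icc (0:ℝ) 1 ∧ |x - u| < η) :
    ∃ J, ∃ x ∈ Dy J, x ∈ U ∧ |x - u| < η := by
  obtain ⟨x, hxU, hx, hxu⟩ := hne
  have hO : IsOpen (U ∩ {y | |y - u| < η}) :=
    hU.inter (isOpen_lt (by fun_prop) (by fun_prop))
  obtain ⟨r, hr, hball⟩ := Metric.isOpen_iff.1 hO x ⟨hxU, hxu⟩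
  obtain ⟨J, hJ⟩ := exists_pow_lt_of_lt_one hr (show (1/2:ℝ) < 1 by norm_num)
  have h2 : (0 : ℝ) < 2 ^ J := by positivity
  have hfl : (⌊x * 2 ^ J⌋₊ : ℝ) ≤ x * 2 ^ J := Nat.floor_le (by have := hx.1; positivity)
  have hfl2 : x * 2 ^ J < ⌊x * 2 ^ J⌋₊ + 1 := Nat.lt_floor_add_one _
  have hdist : |(⌊x * 2 ^ J⌋₊ : ℝ) / 2 ^ J - x| < r := by
    have e : (⌊x * 2 ^ J⌋₊ : ℝ) / 2 ^ J - x = -((x * 2 ^ J - ⌊x * 2 ^ J⌋₊) / 2 ^ J) := by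
      field_simp; ring
    rw [e, abs_neg, abs_of_nonneg (div_nonneg (by linarith) h2.le)]
    refine lt_of_le_of_lt ?_ hJ
    rw [one_div, inv_pow, div_le_iff₀ h2, inv_mul_cancel₀ h2.ne']
    linarith
  have hm := hball (show (⌊x * 2 ^ J⌋₊ : ℝ) / 2 ^ J ∈ Metric.ball x r by
    rw [Metric.mem_ball, Real.dist_eq]; exact hdist)
  refine ⟨J, _, ⟨⌊x * 2 ^ J⌋₊, ?_, rfl⟩, hm.1, hm.2⟩
  have : (⌊x * 2 ^ J⌋₊ : ℝ) ≤ 2 ^ J := hfl.trans (by nlinarith [hx.2])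
  exact_mod_cast this

/-- exceptional values of a path -/
def excep (w : ℝ → ℝ) : Set ℝ :=
  {ℓ | ∃ ab : ℚ × ℚ, IsGreatest (w '' (Icc (ab.1:ℝ) ab.2 ∩ Icc 0 1)) ℓ} ∪
  {ℓ | ∃ ab : ℚ × ℚ, IsLeast (w '' (Icc (ab.1:ℝ) ab.2 ∩ Icc 0 1)) ℓ}

lemma excep_countable (w : ℝ → ℝ) : (excep w).Countable := by
  refine Set.Countable.union ?_ ?_
  · refine (Set.countable_range fun ab : ℚ × ℚ => sSup (w '' (Icc (ab.1:ℝ) ab.2 ∩ Icc 0 1))).mono ?_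
    rintro ℓ ⟨ab, h⟩
    exact ⟨ab, h.csSup_eq⟩
  · refine (Set.countable_range fun ab : ℚ × ℚ => sInf (w '' (Icc (ab.1:ℝ) ab.2 ∩ Icc 0 1))).mono ?_
    rintro ℓ ⟨ab, h⟩
    exact ⟨ab, h.csInf_eq⟩

lemma excep_shift (w : ℝ → ℝ) {v ℓ : ℝ} (h : ℓ ∈ excep (fun r => w r + v)) : ℓ - v ∈ excep w := by
  rcases h with ⟨ab, ⟨x, hx, hxl⟩, h2⟩ | ⟨ab, ⟨x, hx, hxl⟩, h2⟩
  · refine Or.inl ⟨ab, ⟨x, hx, by simp only at hxl; linarith⟩, ?_⟩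
    rintro _ ⟨y, hy, rfl⟩
    have := h2 ⟨y, hy, rfl⟩
    simp only at this; linarith
  · refine Or.inr ⟨ab, ⟨x, hx, by simp only at hxl; linarith⟩, ?_⟩
    rintro _ ⟨y, hy, rfl⟩
    have := h2 ⟨y, hy, rfl⟩
    simp only at this; linarith

lemma perturb_up {w : ℝ → ℝ} (hw : Continuous w) {ℓ : ℝ} (hl : ℓ ∉ excep w) {u η : ℝ}
    (hu : u ∈ Icc (0:ℝ) 1) (hη : 0 < η) (h : ℓ ≤ w u) :
    ∃ J, ∃ x ∈ Dy J, ℓ < w x ∧ |x - u| < η := by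
  refine exists_dyadic_near hu hη (U := {x | ℓ < w x}) (isOpen_lt continuous_const hw) ?_
  by_contra hh
  push Not at hh
  have hle : ∀ x ∈ Icc (0:ℝ) 1, |x - u| < η → w x ≤ ℓ := by
    intro x hx hxu
    by_contra hlt
    push Not at hlt
    exact absurd hxu (not_lt.2 (hh x hlt hx))
  obtain ⟨a, ha1, ha2⟩ := exists_rat_btwn (show u - η < u by linarith)
  obtain ⟨b, hb1, hb2⟩ := exists_rat_btwn (show u < u + η by linarith)
  refine hl (Or.inl ⟨(a, b), ?_⟩)
  refine ⟨⟨u, ⟨⟨ha2.le, hb1.le⟩, hu⟩, ?_⟩, ?_⟩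
  · exact le_antisymm (hle u hu (by simpa using hη)) h
  · rintro _ ⟨x, ⟨⟨h1, h2⟩, h3⟩, rfl⟩
    refine hle x h3 ?_
    simp only at h1 h2
    rw [abs_lt]; constructor <;> linarith

lemma perturb_down {w : ℝ → ℝ} (hw : Continuous w) {ℓ : ℝ} (hl : ℓ ∉ excep w) {u η : ℝ}
    (hu : u ∈ Icc (0:ℝ) 1) (hη : 0 < η) (h : w u ≤ ℓ) :
    ∃ J, ∃ x ∈ Dy J, w x < ℓ ∧ |x - u| < η := by
  refine exists_dyadic_near hu hη (U := {x | w x < ℓ}) (isOpen_lt hw continuous_const) ?_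
  by_contra hh
  push Not at hh
  have hle : ∀ x ∈ Icc (0:ℝ) 1, |x - u| < η → ℓ ≤ w x := by
    intro x hx hxu
    by_contra hlt
    push Not at hlt
    exact absurd hxu (not_lt.2 (hh x hlt hx))
  obtain ⟨a, ha1, ha2⟩ := exists_rat_btwn (show u - η < u by linarith)
  obtain ⟨b, hb1, hb2⟩ := exists_rat_btwn (show u < u + η by linarith)
  refine hl (Or.inr ⟨(a, b), ?_⟩)
  refine ⟨⟨u, ⟨⟨ha2.le, hb1.le⟩, hu⟩, ?_⟩, ?_⟩
  · exact le_antisymm h (hle u hu (by simpa using hη))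
  · rintro _ ⟨x, ⟨⟨h1, h2⟩, h3⟩, rfl⟩
    refine hle x h3 ?_
    simp only at h1 h2
    rw [abs_lt]; constructor <;> linarith

lemma finset_gap (A : Finset ℝ) : ∃ η > 0, ∀ a ∈ A, ∀ b ∈ A, a < b → a + 2 * η ≤ b := by
  set D := (A ×ˢ A).filter (fun p => p.1 < p.2) with hD
  by_cases hn : D.Nonempty
  · obtain ⟨p, hp, hmin⟩ := D.exists_min_image (fun p => p.2 - p.1) hn
    have hp' := (Finset.mem_filter.1 hp).2
    refine ⟨(p.2 - p.1) / 2, by linarith, fun a ha b hb hab => ?_⟩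
    have := hmin (a, b) (Finset.mem_filter.2 ⟨Finset.mem_product.2 ⟨ha, hb⟩, hab⟩)
    simp only at this
    linarith
  · refine ⟨1, one_pos, fun a ha b hb hab => ?_⟩
    exact (hn ⟨(a, b), Finset.mem_filter.2 ⟨Finset.mem_product.2 ⟨ha, hb⟩, hab⟩⟩).elim

lemma MP_to_LP {w : ℝ → ℝ} (hw : Continuous w) (hl : ∀ k : ℤ, (k : ℝ) ∉ excep w) {m : ℕ}
    (h : MP (Icc 0 1) w 0 m) : ∃ J, LP (Dy J) w m := by
  obtain ⟨F, rfl, h1, h2⟩ := h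
  obtain ⟨η, hη, hgap⟩ := finset_gap (F.image Prod.fst ∪ F.image Prod.snd)
  -- perturbations
  have kup : ∀ u : ℝ, ∀ k : ℤ, ∃ J, ∃ x : ℝ, (u ∈ Icc (0:ℝ) 1 → (k:ℝ) ≤ w u →
      x ∈ Dy J ∧ (k:ℝ) < w x ∧ |x - u| < η) := by
    intro u k
    by_cases hh : u ∈ Icc (0:ℝ) 1 ∧ (k:ℝ) ≤ w u
    · obtain ⟨J, x, a, b, c⟩ := perturb_up hw (hl k) hh.1 hη hh.2
      exact ⟨J, x, fun _ _ => ⟨a, b, c⟩⟩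
    · exact ⟨0, 0, fun a b => (hh ⟨a, b⟩).elim⟩
  have kdn : ∀ u : ℝ, ∀ k : ℤ, ∃ J, ∃ x : ℝ, (u ∈ Icc (0:ℝ) 1 → w u ≤ (k:ℝ) →
      x ∈ Dy J ∧ w x < (k:ℝ) ∧ |x - u| < η) := by
    intro u k
    by_cases hh : u ∈ Icc (0:ℝ) 1 ∧ w u ≤ (k:ℝ)
    · obtain ⟨J, x, a, b, c⟩ := perturb_down hw (hl k) hh.1 hη hh.2
      exact ⟨J, x, fun _ _ => ⟨a, b, c⟩⟩
    · exact ⟨0, 0, fun a b => (hh ⟨a, b⟩).elim⟩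
  choose JU xU hU using kup
  choose JD xD hDn using kdn
  choose! k hk using fun p hp => (h1 p hp).2.2.2
  -- new points : depends on u, k and on side
  set X : ℝ → ℤ → ℝ := fun u k => if w u ≤ k then xD u k else xU u (k + 1) with hX
  set JX : ℝ → ℤ → ℕ := fun u k => if w u ≤ k then JD u k else JU u (k + 1) with hJX
  have hXspec : ∀ p ∈ F, ∀ u, (u = p.1 ∨ u = p.2) → X u (k p) ∈ Dy (JX u (k p)) ∧
      |X u (k p) - u| < η ∧ (w u ≤ k p → w (X u (k p)) < k p) ∧
      ((k p : ℝ) + 1 ≤ w u → (k p : ℝ) + 1 < w (X u (k p))) := by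
    intro p hp u hu
    obtain ⟨a, b, c, -⟩ := h1 p hp
    have hc := hk p hp
    have hu01 : u ∈ Icc (0:ℝ) 1 := by rcases hu with rfl | rfl <;> assumption
    by_cases hle : w u ≤ k p
    · have := hDn u (k p) hu01 hle
      simp only [hX, hJX, if_pos hle]
      refine ⟨this.1, this.2.2, fun _ => this.2.1, fun h => by linarith⟩
    · have hge : (k p : ℝ) + 1 ≤ w u := by
        unfold crs at hc
        simp only [add_zero, sub_zero] at hc
        rcases hu with rfl | rfl <;> rcases hc with hc | hc
        · exact (hle hc.1).elim
        · exact hc.1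
        · exact hc.2
        · exact (hle hc.2).elim
      have := hU u (k p + 1) hu01 (by push_cast; exact hge)
      simp only [hX, hJX, if_neg hle]
      push_cast at this
      exact ⟨this.1, this.2.2, fun h => (hle h).elim, fun _ => this.2.1⟩
  have hord : ∀ p ∈ F, ∀ p' ∈ F, ∀ u v, (u = p.1 ∨ u = p.2) → (v = p'.1 ∨ v = p'.2) → u < v →
      X u (k p) < X v (k p') := by
    intro p hp p' hp' u v hu hv huv
    have g := hgap u (by rcases hu with rfl | rfl <;> simp only [Finset.mem_union, Finset.mem_image]
                         exacts [Or.inl ⟨p, hp, rfl⟩, Or.inr ⟨p, hp, rfl⟩]) v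
      (by rcases hv with rfl | rfl <;> simp only [Finset.mem_union, Finset.mem_image]
          exacts [Or.inl ⟨p', hp', rfl⟩, Or.inr ⟨p', hp', rfl⟩]) huv
    have a := (abs_lt.1 (hXspec p hp u hu).2.1)
    have b := (abs_lt.1 (hXspec p' hp' v hv).2.1)
    linarith
  set f : ℝ × ℝ → ℝ × ℝ × ℤ := fun p => (X p.1 (k p), X p.2 (k p), k p) with hf
  have hno : ∀ p ∈ F, ∀ p' ∈ F, p ≠ p' → k p = k p' →
      X p.2 (k p) ≤ X p'.1 (k p') ∨ X p'.2 (k p') ≤ X p.1 (k p) := by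
    intro p hp p' hp' hne hkk
    rcases h2 p hp p' hp' hne with h | h
    · left
      rcases eq_or_lt_of_le h with h | h
      · rw [h, hkk]
      · exact (hord p hp p' hp' _ _ (Or.inr rfl) (Or.inl rfl) h).le
    · right
      rcases eq_or_lt_of_le h with h | h
      · rw [h, hkk]
      · exact (hord p' hp' p hp _ _ (Or.inr rfl) (Or.inl rfl) h).le
  have hlt : ∀ p ∈ F, X p.1 (k p) < X p.2 (k p) := fun p hp =>
    hord p hp p hp _ _ (Or.inl rfl) (Or.inr rfl) (h1 p hp).2.2.1
  have hinj : Set.InjOn f F := by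
    intro p hp p' hp' heq
    by_contra hne
    simp only [hf, Prod.mk.injEq] at heq
    have a := hlt p hp
    have b := hlt p' hp'
    rcases hno p hp p' hp' hne heq.2.2 with h | h
    · rw [heq.1, heq.2.1] at *; linarith
    · rw [heq.1, heq.2.1] at *; linarith
  refine ⟨F.sup (fun p => max (JX p.1 (k p)) (JX p.2 (k p))), F.image f,
    Finset.card_image_of_injOn hinj, ?_, ?_⟩
  · intro q hq
    obtain ⟨p, hp, rfl⟩ := Finset.mem_image.1 hq
    have hJ : max (JX p.1 (k p)) (JX p.2 (k p)) ≤ F.sup (fun p => max (JX p.1 (k p)) (JX p.2 (k p))) :=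
      Finset.le_sup (f := fun p => max (JX p.1 (k p)) (JX p.2 (k p))) hp
    have s1 := hXspec p hp p.1 (Or.inl rfl)
    have s2 := hXspec p hp p.2 (Or.inr rfl)
    refine ⟨Dy_mono (le_trans (le_max_left _ _) hJ) s1.1, Dy_mono (le_trans (le_max_right _ _) hJ) s2.1,
      hlt p hp, ?_⟩
    have hc := hk p hp
    unfold crs at hc
    simp only [add_zero, sub_zero] at hc
    rcases hc with hc | hc
    · exact Or.inl ⟨s1.2.2.1 hc.1, s2.2.2.2 hc.2⟩
    · exact Or.inr ⟨s1.2.2.2 hc.1, s2.2.2.1 hc.2⟩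
  · intro q hq q' hq' hne
    obtain ⟨p, hp, rfl⟩ := Finset.mem_image.1 hq
    obtain ⟨p', hp', rfl⟩ := Finset.mem_image.1 hq'
    by_cases hkk : k p = k p'
    · right
      exact hno p hp p' hp' (by rintro rfl; exact hne rfl) hkk
    · left; exact hkk

end

noncomputable section

/-! ### A3: upper bound via sampling and chaining -/

/-- no bad dyadic interval inside `[r,s]` at levels `> J` -/
def noBad (w : ℝ → ℝ) (J : ℕ) (dl : ℕ → ℝ) (r s : ℝ) : Prop :=
  ∀ j, J < j → ∀ l : ℤ, r ≤ (l : ℝ) / 2 ^ j → ((l : ℝ) + 1) / 2 ^ j ≤ s →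
    |w (((l : ℝ) + 1) / 2 ^ j) - w ((l : ℝ) / 2 ^ j)| ≤ dl j

def rup (r : ℝ) (j : ℕ) : ℝ := (⌈r * 2 ^ j⌉ : ℝ) / 2 ^ j
def rdn (r : ℝ) (j : ℕ) : ℝ := (⌊r * 2 ^ j⌋ : ℝ) / 2 ^ j

lemma le_rup (r : ℝ) (j : ℕ) : r ≤ rup r j := by
  unfold rup
  rw [le_div_iff₀ (by positivity)]
  exact Int.le_ceil _

lemma rup_lt (r : ℝ) (j : ℕ) : rup r j < r + (1 / 2) ^ j := by
  unfold rup
  have h2 : (0:ℝ) < 2 ^ j := by positivity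
  rw [div_lt_iff₀ h2, add_mul, one_div, inv_pow, inv_mul_cancel₀ h2.ne']
  exact Int.ceil_lt_add_one _

lemma rdn_eq (r : ℝ) (j : ℕ) : rdn r j = - rup (-r) j := by
  unfold rup rdn
  rw [neg_mul, Int.ceil_neg]; push_cast; ring

lemma rup_tendsto (r : ℝ) : Tendsto (rup r) atTop (𝓝 r) := by
  refine tendsto_of_tendsto_of_tendsto_of_le_of_le (g := fun _ => r) (h := fun j => r + (1/2:ℝ) ^ j)
    tendsto_const_nhds ?_ (le_rup r) (fun j => (rup_lt r j).le)
  have := (tendsto_pow_atTop_nhds_zero_of_lt_one (show (0:ℝ) ≤ 1/2 by norm_num) (by norm_num)).const_add r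
  simpa using this

lemma rup_step (r : ℝ) (j : ℕ) : rup r (j + 1) = rup r j ∨
    ∃ l : ℤ, rup r (j + 1) = (l : ℝ) / 2 ^ (j + 1) ∧ rup r j = ((l : ℝ) + 1) / 2 ^ (j + 1) := by
  have h2 : (0:ℝ) < 2 ^ j := by positivity
  have e1 : rup r j = ((2 * ⌈r * 2 ^ j⌉ : ℤ) : ℝ) / 2 ^ (j + 1) := by
    unfold rup; push_cast; rw [pow_succ]; field_simp
  have e2 : rup r (j + 1) = (⌈r * 2 ^ (j + 1)⌉ : ℝ) / 2 ^ (j + 1) := rfl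
  set a := ⌈r * 2 ^ j⌉ with ha
  set b := ⌈r * 2 ^ (j + 1)⌉ with hb
  have hba : b ≤ 2 * a := by
    rw [hb, Int.ceil_le]; push_cast
    have := Int.le_ceil (r * 2 ^ j)
    rw [pow_succ]; linarith
  have hab : 2 * a < b + 2 := by
    have h3 := Int.le_ceil (r * 2 ^ (j + 1))
    have h4 := Int.ceil_lt_add_one (r * 2 ^ j)
    rw [pow_succ] at h3
    have : (2 * a : ℝ) < b + 2 := by
      rw [hb, ha, pow_succ]; linarith
    exact_mod_cast this
  have : b = 2 * a ∨ 2 * a = b + 1 := by omega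
  rcases this with h | h
  · left; rw [e1, e2, h]
  · right
    refine ⟨b, e2, ?_⟩
    rw [e1, h]; push_cast; rfl

lemma rup_anti (r : ℝ) (j n : ℕ) : rup r (j + n) ≤ rup r j := by
  induction n with
  | zero => simp
  | succ n ih =>
    refine le_trans ?_ ih
    rw [← add_assoc]
    rcases rup_step r (j + n) with h | ⟨l, h1, h2⟩
    · rw [h]
    · rw [h1, h2]; gcongr; linarith

lemma chain_up {w : ℝ → ℝ} (hw : Continuous w) {J : ℕ} {dl : ℕ → ℝ} {r s δ : ℝ} (hdl : ∀ j, 0 < dl j)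
    (hsum : ∀ a n, J ≤ a → ∑ i ∈ Finset.range n, dl (a + 1 + i) ≤ δ)
    (hb : noBad w J dl r s) {j : ℕ} (hj : J ≤ j) (hs : rup r j ≤ s) :
    |w (rup r j) - w r| ≤ δ := by
  have key : ∀ n, |w (rup r j) - w (rup r (j + n))| ≤ ∑ i ∈ Finset.range n, dl (j + 1 + i) := by
    intro n
    induction n with
    | zero => simp
    | succ n ih =>
      rw [Finset.sum_range_succ]
      have hstep : |w (rup r (j + n)) - w (rup r (j + (n + 1)))| ≤ dl (j + 1 + n) := by
        rw [← add_assoc]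
        rcases rup_step r (j + n) with h | ⟨l, h1, h2⟩
        · rw [h]; simpa using (hdl _).le
        · rw [h1, h2, show j + 1 + n = j + n + 1 by ring]
          refine hb (j + n + 1) (by omega) l ?_ ?_
          · rw [← h1]; exact le_rup _ _
          · rw [← h2]; exact (rup_anti r j n).trans hs
      calc _ ≤ _ := abs_sub_le _ (w (rup r (j + n))) _
        _ ≤ _ := add_le_add ih hstep
  have hlim : Tendsto (fun n => |w (rup r j) - w (rup r (j + n))|) atTop (𝓝 |w (rup r j) - w r|) := by
    refine (tendsto_const_nhds.sub ?_).abs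
    refine (hw.tendsto r).comp ((rup_tendsto r).comp ?_)
    simpa [add_comm] using tendsto_add_atTop_nat j
  exact le_of_tendsto' hlim fun n => (key n).trans (hsum j n hj)

lemma chain_dn {w : ℝ → ℝ} (hw : Continuous w) {J : ℕ} {dl : ℕ → ℝ} {r s δ : ℝ} (hdl : ∀ j, 0 < dl j)
    (hsum : ∀ a n, J ≤ a → ∑ i ∈ Finset.range n, dl (a + 1 + i) ≤ δ)
    (hb : noBad w J dl r s) {j : ℕ} (hj : J ≤ j) (hs : r ≤ rdn s j) :
    |w (rdn s j) - w s| ≤ δ := by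
  have hb' : noBad (fun x => w (-x)) J dl (-s) (-r) := by
    intro j hj l h1 h2
    have := hb j hj (-l - 1) (by push_cast; rw [show (-(l:ℝ) - 1) = -(l + 1) by ring, neg_div]; linarith)
      (by push_cast; rw [show (-(l:ℝ) - 1 + 1) = -l by ring, neg_div]; linarith)
    push_cast at this
    rw [show (-(l:ℝ) - 1 + 1) = -l by ring, show (-(l:ℝ) - 1) = -(l + 1) by ring] at this
    dsimp only
    rw [abs_sub_comm, ← neg_div, ← neg_div]
    exact this
  have := chain_up (w := fun x => w (-x)) (by fun_prop) hdl hsum hb' hj (by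
    rw [rdn_eq] at hs; linarith)
  simpa [rdn_eq] using this

lemma rdn_le (s : ℝ) (j : ℕ) : rdn s j ≤ s := by
  rw [rdn_eq]; linarith [le_rup (-s) j]

lemma rup_le_of_dyadic {r : ℝ} {j : ℕ} {a : ℤ} (h : r ≤ (a : ℝ) / 2 ^ j) : rup r j ≤ (a : ℝ) / 2 ^ j := by
  unfold rup
  have h2 : (0:ℝ) < 2 ^ j := by positivity
  rw [le_div_iff₀ h2] at h
  gcongr
  exact_mod_cast Int.ceil_le.2 h

lemma le_rdn_of_dyadic {r : ℝ} {j : ℕ} {a : ℤ} (h : (a : ℝ) / 2 ^ j ≤ r) : (a : ℝ) / 2 ^ j ≤ rdn r j := by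
  unfold rdn
  have h2 : (0:ℝ) < 2 ^ j := by positivity
  rw [div_le_iff₀ h2] at h
  gcongr
  exact_mod_cast Int.le_floor.2 h

/-- good pairs survive sampling -/
lemma sample_pair {w : ℝ → ℝ} (hw : Continuous w) {J : ℕ} {dl : ℕ → ℝ} {r s δ δ' : ℝ}
    (hdl : ∀ j, 0 < dl j)
    (hsum : ∀ a n, J ≤ a → ∑ i ∈ Finset.range n, dl (a + 1 + i) ≤ δ) (hδ : δ' + δ < 1 / 2)
    (hrs : r < s) {k : ℤ} (hc : crs δ' k (w r) (w s)) (hb : noBad w J dl r s) :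
    rup r J < rdn s J ∧ crs (δ' + δ) k (w (rup r J)) (w (rdn s J)) := by
  have hle : rup r J ≤ rdn s J := by
    by_contra hlt
    push Not at hlt
    have hex : ∃ n, rup r (J + n) ≤ rdn s (J + n) := by
      obtain ⟨n, hn⟩ := exists_pow_lt_of_lt_one (show 0 < (s - r) / 2 by linarith) (show (1/2:ℝ) < 1 by norm_num)
      refine ⟨n, ?_⟩
      have h1 := rup_lt r (J + n)
      have h2 := rup_lt (-s) (J + n)
      have h3 : (1/2:ℝ) ^ (J + n) ≤ (1/2) ^ n :=
        pow_le_pow_of_le_one (by norm_num) (by norm_num) (by omega)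
      rw [rdn_eq]; linarith
    have hsp := Nat.find_spec hex
    have hmin := fun m => Nat.find_min hex (m := m)
    obtain ⟨n, hn⟩ : ∃ n, Nat.find hex = n + 1 := by
      refine Nat.exists_eq_succ_of_ne_zero ?_
      intro h0
      rw [h0, add_zero] at hsp
      linarith
    rw [hn] at hsp hmin
    have hm := hmin n (by omega)
    have heq : rup r (J + (n + 1)) = rdn s (J + (n + 1)) := by
      by_contra hne
      have hlt' := lt_of_le_of_ne hsp hne
      apply hm
      have e : J + (n + 1) = (J + n) + 1 := by ring
      rw [e] at hlt' hsp
      set j := J + n with hj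
      set a := ⌈r * 2 ^ (j + 1)⌉ with ha
      set b := ⌊s * 2 ^ (j + 1)⌋ with hb
      have ea : rup r (j + 1) = (a:ℝ) / 2 ^ (j + 1) := rfl
      have eb : rdn s (j + 1) = (b:ℝ) / 2 ^ (j + 1) := rfl
      have h2 : (0:ℝ) < 2 ^ (j + 1) := by positivity
      have hab : a < b := by
        rw [ea, eb, div_lt_div_iff_of_pos_right h2] at hlt'
        exact_mod_cast hlt'
      have hev : ∃ c : ℤ, a ≤ 2 * c ∧ 2 * c ≤ b := by
        refine ⟨(a + 1) / 2, by omega, by omega⟩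
      obtain ⟨c, hc1, hc2⟩ := hev
      have ec : (c:ℝ) / 2 ^ j = ((2 * c : ℤ) : ℝ) / 2 ^ (j + 1) := by
        push_cast; rw [pow_succ]; field_simp
      have h3 : r ≤ (c:ℝ) / 2 ^ j := by
        rw [ec]
        refine (le_rup r (j + 1)).trans ?_
        rw [ea]; gcongr; 
      have h4 : (c:ℝ) / 2 ^ j ≤ s := by
        rw [ec]
        refine le_trans ?_ (rdn_le s (j + 1))
        rw [eb]; gcongr; 
      exact (rup_le_of_dyadic h3).trans (le_rdn_of_dyadic h4)
    have c1 := chain_up hw hdl hsum hb (j := J + (n + 1)) (by omega) (heq ▸ rdn_le s _)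
    have c2 := chain_dn hw hdl hsum hb (j := J + (n + 1)) (by omega) (heq ▸ le_rup r _)
    rw [← heq] at c2
    have c1 := abs_le.1 c1
    have c2 := abs_le.1 c2
    unfold crs at hc
    rcases hc with ⟨x, y⟩ | ⟨x, y⟩ <;> linarith
  have c1 := abs_le.1 (chain_up hw hdl hsum hb le_rfl (hle.trans (rdn_le s J)))
  have c2 := abs_le.1 (chain_dn hw hdl hsum hb le_rfl ((le_rup r J).trans hle))
  have hcc : crs (δ' + δ) k (w (rup r J)) (w (rdn s J)) := by
    unfold crs at *
    rcases hc with ⟨x, y⟩ | ⟨x, y⟩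
    · left; constructor <;> linarith
    · right; constructor <;> linarith
  refine ⟨lt_of_le_of_ne hle ?_, hcc⟩
  intro heq
  rw [heq] at hcc
  unfold crs at hcc
  rcases hcc with ⟨x, y⟩ | ⟨x, y⟩ <;> linarith

lemma rup_sub_nat (r : ℝ) (J i : ℕ) : rup (r - i) J = rup r J - i := by
  unfold rup
  have h2 : (0:ℝ) < 2 ^ J := by positivity
  have : (r - i) * 2 ^ J = r * 2 ^ J - ((i * 2 ^ J : ℕ) : ℝ) := by push_cast; ring
  rw [this, Int.ceil_sub_natCast]; push_cast; field_simp

lemma rup_mem_Dy {x : ℝ} (h : x ∈ Icc (0:ℝ) 1) (J : ℕ) : rup x J ∈ Dy J := by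
  unfold rup
  have h2 : (0:ℝ) < 2 ^ J := by positivity
  have h0 : 0 ≤ ⌈x * 2 ^ J⌉ := Int.ceil_nonneg (mul_nonneg h.1 h2.le)
  refine ⟨⌈x * 2 ^ J⌉.toNat, ?_, ?_⟩
  · have : ⌈x * 2 ^ J⌉ ≤ 2 ^ J := by
      rw [Int.ceil_le]; push_cast; nlinarith [h.2]
    zify
    rw [Int.toNat_of_nonneg h0]; exact_mod_cast this
  · congr 1
    have := Int.toNat_of_nonneg h0
    exact_mod_cast this.symm

lemma rdn_mem_Dy {x : ℝ} (h : x ∈ Icc (0:ℝ) 1) (J : ℕ) : rdn x J ∈ Dy J := by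
  unfold rdn
  have h2 : (0:ℝ) < 2 ^ J := by positivity
  have h0 : 0 ≤ ⌊x * 2 ^ J⌋ := Int.floor_nonneg.2 (mul_nonneg h.1 h2.le)
  refine ⟨⌊x * 2 ^ J⌋.toNat, ?_, ?_⟩
  · have : ⌊x * 2 ^ J⌋ ≤ 2 ^ J := by
      have : (⌊x * 2 ^ J⌋ : ℝ) ≤ 2 ^ J := (Int.floor_le _).trans (by nlinarith [h.2])
      exact_mod_cast this
    zify
    rw [Int.toNat_of_nonneg h0]; exact_mod_cast this
  · congr 1
    have := Int.toNat_of_nonneg h0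
    exact_mod_cast this.symm

lemma rdn_sub_nat (r : ℝ) (J i : ℕ) : rdn (r - i) J = rdn r J - i := by
  unfold rdn
  have h2 : (0:ℝ) < 2 ^ J := by positivity
  have : (r - i) * 2 ^ J = r * 2 ^ J - ((i * 2 ^ J : ℕ) : ℝ) := by push_cast; ring
  rw [this, Int.floor_sub_natCast]; push_cast; field_simp

theorem MP_upper {w : ℝ → ℝ} (hw : Continuous w) {N J m : ℕ} {dl : ℕ → ℝ} {δ δ' : ℝ}
    (hdl : ∀ j, 0 < dl j)
    (hsum : ∀ a n, J ≤ a → ∑ i ∈ Finset.range n, dl (a + 1 + i) ≤ δ) (hδ : δ' + δ < 1 / 2)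
    (q : ℕ) (h : MP (Icc 0 N) w δ' m) :
    (m : ℝ≥0∞) ≤ N + (∑ i ∈ Finset.range N,
        (cnt (MP (Dy J) (fun r => w (i + r)) (δ' + δ)) (2 ^ J) : ℝ≥0∞)) +
      ∑' j : ℕ, ∑ l ∈ Finset.range (N * 2 ^ (J + 1 + j)),
        ENNReal.ofReal ((|w (((l:ℝ) + 1) / 2 ^ (J + 1 + j)) - w ((l:ℝ) / 2 ^ (J + 1 + j))|
          / dl (J + 1 + j)) ^ q) := by
  obtain ⟨F, rfl, h1, h2⟩ := h
  set FA := F.filter (fun p : ℝ × ℝ => ∃ i : ℕ, p.1 < (i:ℝ) ∧ (i : ℝ) < p.2) with hFA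
  set F' := F.filter (fun p : ℝ × ℝ => ¬ ∃ i : ℕ, p.1 < (i:ℝ) ∧ (i : ℝ) < p.2) with hF'
  set FB := F'.filter (fun p => ¬ noBad w J dl p.1 p.2) with hFB
  set FC := F'.filter (fun p => noBad w J dl p.1 p.2) with hFC
  have hcard : F.card = FA.card + FC.card + FB.card := by
    rw [← Finset.card_filter_add_card_filter_not (s := F) (fun p : ℝ × ℝ => ∃ i : ℕ, p.1 < (i:ℝ) ∧ (i : ℝ) < p.2),
      ← Finset.card_filter_add_card_filter_not (s := F') (fun p => noBad w J dl p.1 p.2), add_assoc]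
  rw [hcard]
  push_cast
  have hFAF : ∀ p ∈ FA, p ∈ F := fun p hp => (Finset.mem_filter.1 hp).1
  have hF'F : ∀ p ∈ F', p ∈ F := fun p hp => (Finset.mem_filter.1 hp).1
  have hFBF : ∀ p ∈ FB, p ∈ F := fun p hp => hF'F p (Finset.mem_filter.1 hp).1
  have hFCF : ∀ p ∈ FC, p ∈ F := fun p hp => hF'F p (Finset.mem_filter.1 hp).1
  refine add_le_add (add_le_add ?_ ?_) ?_
  · -- straddling pairs
    have : FA.card ≤ N := by
      choose! i hi1 hi2 using fun (p : ℝ × ℝ) (hp : p ∈ FA) => (Finset.mem_filter.1 hp).2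
      have hinj : Set.InjOn i FA := by
        intro p hp p' hp' heq
        by_contra hne
        have a := hi1 p hp
        have b := hi2 p hp
        have c := hi1 p' hp'
        have d := hi2 p' hp'
        rw [heq] at a b
        rcases h2 p (hFAF p hp) p' (hFAF p' hp') hne with h | h <;> linarith
      rw [← Finset.card_image_of_injOn hinj]
      have hsub : FA.image i ⊆ Finset.range N := by
        intro j hj
        obtain ⟨p, hp, rfl⟩ := Finset.mem_image.1 hj
        rw [Finset.mem_range]
        have := (h1 p (hFAF p hp)).2.1.2
        have := hi2 p hp
        have : (i p : ℝ) < N := by linarith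
        exact_mod_cast this
      simpa using Finset.card_le_card hsub
    exact_mod_cast this
  · -- good pairs
    have hblock : ∀ p ∈ F', ∃ i : ℕ, i < N ∧ (i : ℝ) ≤ p.1 ∧ p.2 ≤ i + 1 := by
      intro p hp
      obtain ⟨hpF, hns⟩ := Finset.mem_filter.1 hp
      obtain ⟨a, b, c, -⟩ := h1 p hpF
      push Not at hns
      have e1 := Nat.floor_le a.1
      have e2 := Nat.lt_floor_add_one p.1
      refine ⟨⌊p.1⌋₊, ?_, e1, ?_⟩
      · have : (⌊p.1⌋₊ : ℝ) < N := by linarith [b.2]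
        exact_mod_cast this
      · have := hns (⌊p.1⌋₊ + 1) (by push_cast; exact e2)
        push_cast at this; exact this
    choose! i hiN hi1 hi2 using hblock
    have hmaps : ∀ p ∈ FC, i p ∈ Finset.range N := fun p hp =>
      Finset.mem_range.2 (hiN p (Finset.mem_filter.1 hp).1)
    rw [Finset.card_eq_sum_card_fiberwise hmaps]
    push_cast
    refine Finset.sum_le_sum fun b hb => ?_
    set G := FC.filter (fun p => i p = b) with hG
    have hGC : ∀ p ∈ G, p ∈ FC := fun p hp => (Finset.mem_filter.1 hp).1
    have hMP : MP (Dy J) (fun r => w (b + r)) (δ' + δ) G.card := by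
      set f : ℝ × ℝ → ℝ × ℝ := fun p => (rup p.1 J - b, rdn p.2 J - b) with hf
      have hsamp : ∀ p ∈ G, rup p.1 J < rdn p.2 J ∧ ∃ k : ℤ, crs (δ' + δ) k (w (rup p.1 J)) (w (rdn p.2 J)) := by
        intro p hp
        obtain ⟨-, -, c, k, hk⟩ := h1 p (hFCF p (hGC p hp))
        have := sample_pair hw hdl hsum hδ c hk (Finset.mem_filter.1 (hGC p hp)).2
        exact ⟨this.1, k, this.2⟩
      have hno : ∀ p ∈ G, ∀ p' ∈ G, p ≠ p' → rdn p.2 J ≤ rup p'.1 J ∨ rdn p'.2 J ≤ rup p.1 J := by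
        intro p hp p' hp' hne
        rcases h2 p (hFCF p (hGC p hp)) p' (hFCF p' (hGC p' hp')) hne with h | h
        · left; exact (rdn_le _ _).trans (h.trans (le_rup _ _))
        · right; exact (rdn_le _ _).trans (h.trans (le_rup _ _))
      have hinj : Set.InjOn f G := by
        intro p hp p' hp' heq
        by_contra hne
        simp only [hf, Prod.mk.injEq] at heq
        have a := (hsamp p hp).1
        have b := (hsamp p' hp').1
        rcases hno p hp p' hp' hne with h | h <;> linarith [heq.1, heq.2]
      refine ⟨G.image f, Finset.card_image_of_injOn hinj, ?_, ?_⟩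
      · intro x hx
        obtain ⟨p, hp, rfl⟩ := Finset.mem_image.1 hx
        have hpF' : p ∈ F' := (Finset.mem_filter.1 (hGC p hp)).1
        have hib : i p = b := (Finset.mem_filter.1 hp).2
        have e1 := hi1 p hpF'
        have e2 := hi2 p hpF'
        rw [hib] at e1 e2
        have e3 := (h1 p (hF'F p hpF')).2.2.1
        refine ⟨?_, ?_, ?_, ?_⟩
        · simp only [hf]; rw [← rup_sub_nat]
          exact rup_mem_Dy ⟨by linarith, by linarith⟩ J
        · simp only [hf]; rw [← rdn_sub_nat]
          exact rdn_mem_Dy ⟨by linarith, by linarith⟩ J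
        · simp only [hf]; linarith [(hsamp p hp).1]
        · simpa [hf] using (hsamp p hp).2
      · intro x hx x' hx' hne
        obtain ⟨p, hp, rfl⟩ := Finset.mem_image.1 hx
        obtain ⟨p', hp', rfl⟩ := Finset.mem_image.1 hx'
        have := hno p hp p' hp' (by rintro rfl; exact hne rfl)
        simpa [hf] using this
    have := le_cnt (M := 2 ^ J) (fun m m' hm h => MP_mono_m hm h) (MP_Dy_le hMP) hMP
    exact_mod_cast this
  · -- bad pairs
    have hbad : ∀ p ∈ FB, ∃ jl : ℕ × ℕ, jl.2 < N * 2 ^ (J + 1 + jl.1) ∧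
        p.1 ≤ (jl.2 : ℝ) / 2 ^ (J + 1 + jl.1) ∧ ((jl.2 : ℝ) + 1) / 2 ^ (J + 1 + jl.1) ≤ p.2 ∧
        dl (J + 1 + jl.1) < |w (((jl.2:ℝ) + 1) / 2 ^ (J + 1 + jl.1)) - w ((jl.2:ℝ) / 2 ^ (J + 1 + jl.1))| := by
      intro p hp
      have := (Finset.mem_filter.1 hp).2
      unfold noBad at this
      push Not at this
      obtain ⟨j, hj, l, hl1, hl2, hl3⟩ := this
      obtain ⟨a, b, c, -⟩ := h1 p (hFBF p hp)
      have h2 : (0:ℝ) < 2 ^ j := by positivity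
      have hl0 : 0 ≤ l := by
        have := a.1.trans hl1
        rw [le_div_iff₀ h2, zero_mul] at this
        exact_mod_cast this
      obtain ⟨l, rfl⟩ := Int.eq_ofNat_of_zero_le hl0
      obtain ⟨j', rfl⟩ : ∃ j', j = J + 1 + j' := ⟨j - J - 1, by omega⟩
      refine ⟨(j', l), ?_, by simpa using hl1, by simpa using hl2, by simpa using hl3⟩
      have := hl2.trans b.2
      rw [div_le_iff₀ h2] at this
      have : ((l + 1 : ℕ) : ℝ) ≤ ((N * 2 ^ (J + 1 + j') : ℕ) : ℝ) := by
        push_cast; simpa using this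
      have : l + 1 ≤ N * 2 ^ (J + 1 + j') := by exact_mod_cast this
      simp only; omega
    choose! f hf1 hf2 hf3 hf4 using hbad
    have hinj : Set.InjOn f FB := by
      intro p hp p' hp' heq
      by_contra hne
      have a := hf2 p hp
      have b := hf3 p hp
      have c := hf2 p' hp'
      have d := hf3 p' hp'
      rw [heq] at a b
      have h2' : (0:ℝ) < 2 ^ (J + 1 + (f p').1) := by positivity
      have e : ((f p').2 : ℝ) / 2 ^ (J + 1 + (f p').1) < (((f p').2 : ℝ) + 1) / 2 ^ (J + 1 + (f p').1) := by
        rw [div_lt_div_iff_of_pos_right h2']; linarith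
      rcases h2 p (hFBF p hp) p' (hFBF p' hp') hne with h | h <;> linarith
    set g : ℕ × ℕ → ℝ≥0∞ := fun jl => if jl.2 < N * 2 ^ (J + 1 + jl.1) then
      ENNReal.ofReal ((|w (((jl.2:ℝ) + 1) / 2 ^ (J + 1 + jl.1)) - w ((jl.2:ℝ) / 2 ^ (J + 1 + jl.1))|
          / dl (J + 1 + jl.1)) ^ q) else 0 with hg
    have hgt : ∑' j : ℕ, ∑ l ∈ Finset.range (N * 2 ^ (J + 1 + j)),
        ENNReal.ofReal ((|w (((l:ℝ) + 1) / 2 ^ (J + 1 + j)) - w ((l:ℝ) / 2 ^ (J + 1 + j))|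
          / dl (J + 1 + j)) ^ q) = ∑' x, g x := by
      rw [ENNReal.tsum_prod']
      refine tsum_congr fun j => ?_
      rw [tsum_eq_sum (s := Finset.range (N * 2 ^ (J + 1 + j)))]
      · refine Finset.sum_congr rfl fun l hl => ?_
        simp only [hg]
        rw [if_pos (Finset.mem_range.1 hl)]
      · intro l hl
        simp only [hg]
        rw [if_neg (by simpa using hl)]
    rw [hgt]
    calc (FB.card : ℝ≥0∞) = ((FB.image f).card : ℝ≥0∞) := by rw [Finset.card_image_of_injOn hinj]
      _ = ∑ x ∈ FB.image f, 1 := by simp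
      _ ≤ ∑ x ∈ FB.image f, g x := by
        refine Finset.sum_le_sum fun x hx => ?_
        obtain ⟨p, hp, rfl⟩ := Finset.mem_image.1 hx
        simp only [hg]
        rw [if_pos (hf1 p hp), ENNReal.one_le_ofReal]
        refine one_le_pow₀ ?_
        rw [one_le_div (hdl _)]
        exact (hf4 p hp).le
      _ ≤ ∑' x, g x := ENNReal.sum_le_tsum _

end

noncomputable section

lemma lint_pow_le {α : Type*} [MeasurableSpace α] (ν : Measure α) [IsProbabilityMeasure ν]
    {f : α → ℝ≥0∞} (hf : AEMeasurable f ν) (n : ℕ) :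
    (∫⁻ x, f x ∂ν) ^ n ≤ ∫⁻ x, f x ^ n ∂ν := by
  rcases Nat.eq_zero_or_pos n with rfl | hn
  · simp
  have h := eLpNorm'_le_eLpNorm'_of_exponent_le (p := 1) (q := n) one_pos
    (by exact_mod_cast hn) ν (f := f) hf.aestronglyMeasurable
  simp only [eLpNorm', enorm_eq_self, ENNReal.rpow_one, ne_eq, one_ne_zero, not_false_eq_true,
    div_self, ENNReal.rpow_natCast] at h
  have hn' : (n : ℝ) ≠ 0 := by exact_mod_cast hn.ne'
  calc (∫⁻ x, f x ∂ν) ^ n ≤ ((∫⁻ x, f x ^ n ∂ν) ^ (1 / (n : ℝ))) ^ n := by gcongr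
    _ = _ := by
      rw [← ENNReal.rpow_natCast, ← ENNReal.rpow_mul, one_div, inv_mul_cancel₀ hn', ENNReal.rpow_one]

/-- even moments of the standard Gaussian -/
def gm (p : ℕ) : ℝ≥0∞ := ∫⁻ x, ‖x‖ₑ ^ (2 * p) ∂(gaussianReal 0 1)

lemma lint_pow_gauss_lt_top (v : ℝ≥0) (p : ℕ) : ∫⁻ x, ‖x‖ₑ ^ p ∂(gaussianReal 0 v) < ⊤ := by
  rcases Nat.eq_zero_or_pos p with rfl | hn
  · simp
  have h := (memLp_id_gaussianReal (μ := 0) (v := v) (p : ℝ≥0))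
  have := lintegral_rpow_enorm_lt_top_of_eLpNorm_lt_top (by exact_mod_cast hn.ne') (by simp) h.2
  simpa using this

lemma gm_lt_top (p : ℕ) : gm p < ⊤ := lint_pow_gauss_lt_top 1 _

lemma gauss_moment (v : ℝ≥0) (p : ℕ) :
    ∫⁻ x, ‖x‖ₑ ^ (2 * p) ∂(gaussianReal 0 v) = (v : ℝ≥0∞) ^ p * gm p := by
  have h : gaussianReal 0 v = (gaussianReal 0 1).map (fun x => √v * x) := by
    rw [gaussianReal_map_const_mul]
    congr 1
    · simp
    · ext; simp
  rw [h, lintegral_map (by fun_prop) (by fun_prop), gm, ← lintegral_const_mul _ (by fun_prop)]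
  congr 1; ext x
  rw [enorm_mul, mul_pow, pow_mul ‖√(v:ℝ)‖ₑ]
  congr 2
  rw [Real.enorm_eq_ofReal (Real.sqrt_nonneg _), ← ENNReal.ofReal_pow (Real.sqrt_nonneg _),
    Real.sq_sqrt (NNReal.coe_nonneg v)]
  simp

section conc
variable {N : ℕ} (μ : Measure (Fin N → ℝ))

lemma isGaussian_of_lin (hlin : ∀ c : Fin N → ℝ, ∃ v : ℝ≥0,
    μ.map (fun x => ∑ i, c i * x i) = gaussianReal 0 v) :
    IsGaussian μ ∧ ∀ L : StrongDual ℝ (Fin N → ℝ), ∫ x, L x ∂μ = 0 := by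
  have key : ∀ L : StrongDual ℝ (Fin N → ℝ), ∃ v : ℝ≥0, μ.map L = gaussianReal 0 v := by
    intro L
    obtain ⟨v, hv⟩ := hlin (fun i => L (Pi.single i 1))
    refine ⟨v, ?_⟩
    rw [← hv]
    congr 1
    ext x
    conv_lhs => rw [pi_eq_sum_univ' x]
    rw [map_sum]
    refine Finset.sum_congr rfl fun i _ => ?_
    rw [map_smul, smul_eq_mul, mul_comm]
  have hm : ∀ L : StrongDual ℝ (Fin N → ℝ), ∫ x, L x ∂μ = 0 := by
    intro L
    obtain ⟨v, hv⟩ := key L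
    have : ∫ x, L x ∂μ = ∫ y, y ∂(μ.map L) := by
      rw [integral_map (by fun_prop) (by fun_prop)]
    rw [this, hv, integral_id_gaussianReal]
  refine ⟨⟨fun L => ?_⟩, hm⟩
  obtain ⟨v, hv⟩ := key L
  rw [hm, hv]
  congr 1
  have : Var[L; μ] = Var[fun y => y; μ.map L] := by
    rw [variance_map (by fun_prop) (by fun_prop)]
    rfl
  rw [this, hv, variance_fun_id_gaussianReal]; simp


lemma conc_rot (hlin : ∀ c : Fin N → ℝ, ∃ v : ℝ≥0,
    μ.map (fun x => ∑ i, c i * x i) = gaussianReal 0 v) [IsProbabilityMeasure μ]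
    (F : (Fin N → ℝ) → ℝ) (h : (Fin N → ℝ) → (Fin N → ℝ) → ℝ)
    (hF : Continuous F) (hFi : Integrable F μ) (hc : Continuous (Function.uncurry h))
    (hd : ∀ x y : Fin N → ℝ, ∀ θ : ℝ, HasDerivAt (fun θ : ℝ => F (Real.cos θ • x + Real.sin θ • y))
      (h (Real.cos θ • x + Real.sin θ • y) (-Real.sin θ • x + Real.cos θ • y)) θ) (p : ℕ) :
    ∫⁻ x, ‖F x - ∫ y, F y ∂μ‖ₑ ^ (2 * p) ∂μ ≤
      ENNReal.ofReal (Real.pi / 2) ^ (2 * p) * ∫⁻ u, ∫⁻ v, ‖h u v‖ₑ ^ (2 * p) ∂μ ∂μ := by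
  obtain ⟨hG, hm⟩ := isGaussian_of_lin μ hlin
  -- step 1: symmetrisation
  have h1 : ∀ x, ‖F x - ∫ y, F y ∂μ‖ₑ ^ (2 * p) ≤ ∫⁻ y, ‖F y - F x‖ₑ ^ (2 * p) ∂μ := by
    intro x
    have e : F x - ∫ y, F y ∂μ = ∫ y, (F x - F y) ∂μ := by
      rw [integral_sub (integrable_const _) hFi]; simp
    calc ‖F x - ∫ y, F y ∂μ‖ₑ ^ (2 * p) ≤ (∫⁻ y, ‖F x - F y‖ₑ ∂μ) ^ (2 * p) := by
          rw [e]; gcongr; exact enorm_integral_le_lintegral_enorm _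
      _ ≤ ∫⁻ y, ‖F x - F y‖ₑ ^ (2 * p) ∂μ := lint_pow_le _ (by fun_prop) _
      _ = _ := by
          congr 1; ext y; rw [← enorm_neg, neg_sub]
  -- step 2: along the path
  set I := Ioc (0:ℝ) (Real.pi / 2) with hI
  have hpi : (0:ℝ) < Real.pi / 2 := by positivity
  have h2 : ∀ x y, ‖F y - F x‖ₑ ^ (2 * p) ≤ ENNReal.ofReal (Real.pi / 2) ^ (2 * p) *
      ((ENNReal.ofReal (Real.pi / 2))⁻¹ * ∫⁻ θ in I, ‖Function.uncurry h (ContinuousLinearMap.rotation θ (x, y))‖ₑ ^ (2 * p)) := by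
    intro x y
    have hcont : Continuous fun θ : ℝ => h (Real.cos θ • x + Real.sin θ • y) (-Real.sin θ • x + Real.cos θ • y) :=
      hc.comp (f := fun θ : ℝ => (Real.cos θ • x + Real.sin θ • y, -Real.sin θ • x + Real.cos θ • y)) (by fun_prop)
    have e := intervalIntegral.integral_eq_sub_of_hasDerivAt (a := 0) (b := Real.pi / 2)
      (fun θ _ => hd x y θ) (hcont.intervalIntegrable _ _)
    simp only [Real.cos_pi_div_two, Real.sin_pi_div_two, Real.cos_zero, Real.sin_zero, zero_smul,
      one_smul, zero_add, add_zero] at e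
    rw [← e, intervalIntegral.integral_of_le hpi.le]
    have hne : ENNReal.ofReal (Real.pi / 2) ≠ 0 := by simpa using hpi
    set ν : Measure ℝ := (ENNReal.ofReal (Real.pi / 2))⁻¹ • volume.restrict I with hν
    have hνp : IsProbabilityMeasure ν := ⟨by
      simp only [hν, Measure.smul_apply, Measure.restrict_apply_univ, hI, Real.volume_Ioc, sub_zero, smul_eq_mul]
      exact ENNReal.inv_mul_cancel hne ENNReal.ofReal_ne_top⟩
    have hJ := lint_pow_le ν (f := fun θ => ‖h (Real.cos θ • x + Real.sin θ • y) (-Real.sin θ • x + Real.cos θ • y)‖ₑ)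
      (by fun_prop) (2 * p)
    simp only [hν, lintegral_smul_measure, smul_eq_mul] at hJ
    calc _ ≤ (∫⁻ θ in I, ‖h (Real.cos θ • x + Real.sin θ • y) (-Real.sin θ • x + Real.cos θ • y)‖ₑ) ^ (2 * p) := by
          gcongr; exact enorm_integral_le_lintegral_enorm _
      _ = ENNReal.ofReal (Real.pi / 2) ^ (2 * p) * ((ENNReal.ofReal (Real.pi / 2))⁻¹ * ∫⁻ θ in I, ‖h (Real.cos θ • x + Real.sin θ • y) (-Real.sin θ • x + Real.cos θ • y)‖ₑ) ^ (2 * p) := by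
          rw [← mul_pow, ← mul_assoc, ENNReal.mul_inv_cancel hne ENNReal.ofReal_ne_top, one_mul]
      _ ≤ _ := by
          simp only [ContinuousLinearMap.rotation_apply, Function.uncurry]
          gcongr
  have hrm : Measurable fun z : ℝ × ((Fin N → ℝ) × (Fin N → ℝ)) => ContinuousLinearMap.rotation z.1 z.2 := by
    simp only [ContinuousLinearMap.rotation_apply]
    fun_prop
  have hm3 : Measurable fun z : ℝ × ((Fin N → ℝ) × (Fin N → ℝ)) =>
      ‖Function.uncurry h (ContinuousLinearMap.rotation z.1 z.2)‖ₑ ^ (2 * p) :=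
    ((hc.measurable.comp hrm).enorm).pow_const _
  have hmu : Measurable fun z : (Fin N → ℝ) × (Fin N → ℝ) => ‖Function.uncurry h z‖ₑ ^ (2 * p) :=
    hc.measurable.enorm.pow_const _
  have hFm : Measurable fun z : (Fin N → ℝ) × (Fin N → ℝ) => ‖F z.2 - F z.1‖ₑ ^ (2 * p) := by
    have := hF.measurable
    fun_prop
  calc _ ≤ ∫⁻ x, ∫⁻ y, ‖F y - F x‖ₑ ^ (2 * p) ∂μ ∂μ := lintegral_mono h1
    _ = ∫⁻ z, ‖F z.2 - F z.1‖ₑ ^ (2 * p) ∂(μ.prod μ) := by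
        rw [lintegral_prod _ hFm.aemeasurable]
    _ ≤ ∫⁻ z, ENNReal.ofReal (Real.pi / 2) ^ (2 * p) *
      ((ENNReal.ofReal (Real.pi / 2))⁻¹ * ∫⁻ θ in I, ‖Function.uncurry h (ContinuousLinearMap.rotation θ z)‖ₑ ^ (2 * p)) ∂(μ.prod μ) :=
        lintegral_mono fun z => h2 z.1 z.2
    _ = ENNReal.ofReal (Real.pi / 2) ^ (2 * p) *
      ((ENNReal.ofReal (Real.pi / 2))⁻¹ * ∫⁻ θ in I, ∫⁻ z, ‖Function.uncurry h (ContinuousLinearMap.rotation θ z)‖ₑ ^ (2 * p) ∂(μ.prod μ)) := by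
        have hm4 : Measurable fun z : (Fin N → ℝ) × (Fin N → ℝ) => ∫⁻ θ in I, ‖Function.uncurry h (ContinuousLinearMap.rotation θ z)‖ₑ ^ (2 * p) :=
          hm3.lintegral_prod_left'
        rw [lintegral_const_mul _ (hm4.const_mul _), lintegral_const_mul _ hm4, lintegral_lintegral_swap]
        exact (hm3.comp measurable_swap).aemeasurable
    _ = ENNReal.ofReal (Real.pi / 2) ^ (2 * p) *
      ((ENNReal.ofReal (Real.pi / 2))⁻¹ * ∫⁻ θ in I, ∫⁻ z, ‖Function.uncurry h z‖ₑ ^ (2 * p) ∂(μ.prod μ)) := by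
        congr 3; ext θ
        conv_rhs => rw [← IsGaussian.map_rotation_eq_self_of_forall_strongDual_eq_zero hm θ]
        rw [lintegral_map hmu (by fun_prop)]
    _ = _ := by
        rw [lintegral_prod _ hmu.aemeasurable]
        simp only [Function.uncurry, lintegral_const, Measure.restrict_apply_univ, hI, Real.volume_Ioc, sub_zero]
        rw [mul_comm (∫⁻ x, _ ∂μ), ← mul_assoc (ENNReal.ofReal (Real.pi / 2))⁻¹, ENNReal.inv_mul_cancel (by simpa using hpi) ENNReal.ofReal_ne_top, one_mul]


lemma lin_var_le (hlin : ∀ c : Fin N → ℝ, ∃ v : ℝ≥0,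
    μ.map (fun x => ∑ i, c i * x i) = gaussianReal 0 v) [IsProbabilityMeasure μ] {cb : ℝ}
    (hcov : ∀ i, ∑ k, |∫ x, x i * x k ∂μ| ≤ cb) (c : Fin N → ℝ) :
    ∃ v : ℝ≥0, μ.map (fun x => ∑ i, c i * x i) = gaussianReal 0 v ∧ (v : ℝ) ≤ cb * ∑ i, c i ^ 2 := by
  obtain ⟨v, hv⟩ := hlin c
  refine ⟨v, hv, ?_⟩
  obtain ⟨hG, hm⟩ := isGaussian_of_lin μ hlin
  have hL2 : ∀ i : Fin N, MemLp (fun x : Fin N → ℝ => x i) 2 μ := fun i =>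
    IsGaussian.memLp_dual μ (ContinuousLinearMap.proj i) 2 (by simp)
  have hintg : ∀ i k : Fin N, Integrable (fun x : Fin N → ℝ => x i * x k) μ := fun i k =>
    (hL2 i).integrable_mul (hL2 k)
  have e1 : (v : ℝ) = ∫ x, (∑ i, c i * x i) ^ 2 ∂μ := by
    have : ∫ x, (∑ i, c i * x i) ^ 2 ∂μ = ∫ y, y ^ 2 ∂(μ.map (fun x => ∑ i, c i * x i)) := by
      rw [integral_map (Continuous.measurable (by fun_prop)).aemeasurable (by fun_prop)]
    rw [this, hv, ← variance_fun_id_gaussianReal (μ := 0) (v := v), variance_eq_integral (by fun_prop)]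
    simp [integral_id_gaussianReal]
  have e2 : ∫ x, (∑ i, c i * x i) ^ 2 ∂μ = ∑ i, ∑ k, c i * c k * ∫ x, x i * x k ∂μ := by
    have : ∀ x : Fin N → ℝ, (∑ i, c i * x i) ^ 2 = ∑ i, ∑ k, c i * c k * (x i * x k) := by
      intro x
      rw [sq, Finset.sum_mul_sum]
      refine Finset.sum_congr rfl fun i _ => Finset.sum_congr rfl fun k _ => by ring
    simp only [this]
    rw [integral_finsetSum _ fun i _ => integrable_finsetSum _ fun k _ => (hintg i k).const_mul _]
    refine Finset.sum_congr rfl fun i _ => ?_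
    rw [integral_finsetSum _ fun k _ => (hintg i k).const_mul _]
    refine Finset.sum_congr rfl fun k _ => ?_
    rw [integral_const_mul]
  rw [e1, e2]
  set C : Fin N → Fin N → ℝ := fun i k => ∫ x, x i * x k ∂μ with hC
  have hsym : ∀ i k, C i k = C k i := fun i k => by simp only [hC, mul_comm]
  have h1 : ∀ i k, c i * c k * C i k ≤ c i ^ 2 / 2 * |C i k| + c k ^ 2 / 2 * |C k i| := by
    intro i k
    rw [← hsym i k]
    calc c i * c k * C i k ≤ |c i * c k * C i k| := le_abs_self _
      _ = |c i| * |c k| * |C i k| := by rw [abs_mul, abs_mul]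
      _ ≤ (c i ^ 2 / 2 + c k ^ 2 / 2) * |C i k| := by
        gcongr
        nlinarith [sq_nonneg (|c i| - |c k|), sq_abs (c i), sq_abs (c k)]
      _ = _ := by ring
  calc ∑ i, ∑ k, c i * c k * C i k ≤ ∑ i, ∑ k, (c i ^ 2 / 2 * |C i k| + c k ^ 2 / 2 * |C k i|) :=
        Finset.sum_le_sum fun i _ => Finset.sum_le_sum fun k _ => h1 i k
    _ = ∑ i, c i ^ 2 * ∑ k, |C i k| := by
        simp only [Finset.sum_add_distrib]
        rw [Finset.sum_comm (f := fun i k => c k ^ 2 / 2 * |C k i|), ← Finset.sum_add_distrib]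
        refine Finset.sum_congr rfl fun i _ => ?_
        rw [← Finset.mul_sum]; ring
    _ ≤ ∑ i, c i ^ 2 * cb := Finset.sum_le_sum fun i _ => by
        gcongr; exact hcov i
    _ = _ := by rw [← Finset.sum_mul, mul_comm]

lemma conc_mu (hN : 0 < N) (hlin : ∀ c : Fin N → ℝ, ∃ v : ℝ≥0,
    μ.map (fun x => ∑ i, c i * x i) = gaussianReal 0 v) [IsProbabilityMeasure μ] {cb : ℝ}
    (hcov : ∀ i, ∑ k, |∫ x, x i * x k ∂μ| ≤ cb) (v : ℝ≥0)
    (hv : ∀ i, μ.map (fun x => x i) = gaussianReal 0 v) (g g' : ℝ → ℝ)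
    (hg : ∀ x, HasDerivAt g (g' x) x) (hg' : Continuous g') (hgi : Integrable g (gaussianReal 0 v))
    (p : ℕ) :
    ∫⁻ x, ‖(∑ i, g (x i)) / N - ∫ y, g y ∂(gaussianReal 0 v)‖ₑ ^ (2 * p) ∂μ ≤
      ENNReal.ofReal (Real.pi / 2) ^ (2 * p) * gm p * ENNReal.ofReal (cb / N) ^ p *
        ∫⁻ x, ‖g' x‖ₑ ^ (2 * p) ∂(gaussianReal 0 v) := by
  have hN' : (0:ℝ) < N := by exact_mod_cast hN
  have hcb : 0 ≤ cb := le_trans (Finset.sum_nonneg fun _ _ => abs_nonneg _) (hcov ⟨0, hN⟩)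
  have hgc : Continuous g := continuous_iff_continuousAt.2 fun x => (hg x).continuousAt
  set F : (Fin N → ℝ) → ℝ := fun x => (∑ i, g (x i)) / N with hF
  set h : (Fin N → ℝ) → (Fin N → ℝ) → ℝ := fun u w => ∑ i, (g' (u i) / N) * w i with hh
  have hgi' : ∀ i, Integrable (fun x : Fin N → ℝ => g (x i)) μ := fun i => by
    have := hgi
    rw [← hv i] at this
    exact this.comp_measurable (by fun_prop)
  have hFi : Integrable F μ := (integrable_finsetSum _ fun i _ => hgi' i).div_const _
  have hFc : Continuous F := by fun_prop
  have hg'm : Measurable g' := hg'.measurable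
  have hhc : Continuous (Function.uncurry h) := by
    simp only [hh, Function.uncurry_def]; fun_prop
  have hmean : ∫ y, F y ∂μ = ∫ y, g y ∂(gaussianReal 0 v) := by
    have e : ∀ i : Fin N, ∫ x, g (x i) ∂μ = ∫ y, g y ∂(gaussianReal 0 v) := fun i => by
      rw [← hv i, integral_map (measurable_pi_apply i).aemeasurable hgc.aestronglyMeasurable]
    simp only [hF]
    rw [integral_div, integral_finsetSum _ fun i _ => hgi' i]
    simp only [e, Finset.sum_const, Finset.card_univ, Fintype.card_fin, nsmul_eq_mul]
    field_simp
  have hd : ∀ x y : Fin N → ℝ, ∀ θ : ℝ, HasDerivAt (fun θ : ℝ => F (Real.cos θ • x + Real.sin θ • y))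
      (h (Real.cos θ • x + Real.sin θ • y) (-Real.sin θ • x + Real.cos θ • y)) θ := by
    intro x y θ
    simp only [hF, hh, Pi.add_apply, Pi.smul_apply, smul_eq_mul]
    have : ∀ i ∈ Finset.univ, HasDerivAt (fun θ => g (Real.cos θ * x i + Real.sin θ * y i))
        (g' (Real.cos θ * x i + Real.sin θ * y i) * (-Real.sin θ * x i + Real.cos θ * y i)) θ := fun i _ =>
      (hg _).comp θ (((Real.hasDerivAt_cos θ).mul_const _).add ((Real.hasDerivAt_sin θ).mul_const _))
    have := (HasDerivAt.fun_sum this).div_const (N : ℝ)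
    refine this.congr_deriv ?_
    rw [Finset.sum_div]
    refine Finset.sum_congr rfl fun i _ => by ring
  have h1 := conc_rot μ hlin F h hFc hFi hhc hd p
  rw [hmean] at h1
  refine h1.trans ?_
  have h2 : ∀ u, ∫⁻ w, ‖h u w‖ₑ ^ (2 * p) ∂μ ≤
      gm p * ENNReal.ofReal (cb / N) ^ p * ((N : ℝ≥0∞)⁻¹ * ∑ i, ‖g' (u i)‖ₑ ^ (2 * p)) := by
    intro u
    obtain ⟨s, hs, hs'⟩ := lin_var_le μ hlin hcov (fun i => g' (u i) / N)
    have e : ∫⁻ w, ‖h u w‖ₑ ^ (2 * p) ∂μ = ∫⁻ x, ‖x‖ₑ ^ (2 * p) ∂(gaussianReal 0 s) := by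
      rw [← hs, lintegral_map (by fun_prop) (by fun_prop)]
    rw [e, gauss_moment, mul_comm (gm p), mul_right_comm]
    gcongr
    have hs2 : (s : ℝ) ^ p ≤ (cb / N) ^ p * ((N : ℝ)⁻¹ * ∑ i, |g' (u i)| ^ (2 * p)) := by
      have hpm := Real.pow_arith_mean_le_arith_mean_pow Finset.univ (fun _ : Fin N => (N : ℝ)⁻¹)
        (fun i => g' (u i) ^ 2) (fun _ _ => by positivity) (by simp [hN'.ne']) (fun _ _ => sq_nonneg _) p
      calc (s : ℝ) ^ p ≤ ((cb / N) * ∑ i, (N : ℝ)⁻¹ * g' (u i) ^ 2) ^ p := by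
            gcongr
            refine hs'.trans_eq ?_
            rw [Finset.mul_sum, Finset.mul_sum]
            refine Finset.sum_congr rfl fun i _ => by field_simp
        _ = (cb / N) ^ p * (∑ i, (N : ℝ)⁻¹ * g' (u i) ^ 2) ^ p := mul_pow _ _ _
        _ ≤ (cb / N) ^ p * ∑ i, (N : ℝ)⁻¹ * (g' (u i) ^ 2) ^ p := by gcongr
        _ = _ := by
          rw [← Finset.mul_sum]
          congr 3; ext i; rw [pow_mul, sq_abs]
    have hs3 := ENNReal.ofReal_le_ofReal hs2
    rw [ENNReal.ofReal_pow (by positivity), ENNReal.ofReal_mul (by positivity), ENNReal.ofReal_pow (by positivity),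
      ENNReal.ofReal_mul (by positivity), ENNReal.ofReal_inv_of_pos hN', ENNReal.ofReal_natCast,
      ENNReal.ofReal_sum_of_nonneg (fun _ _ => by positivity)] at hs3
    simp only [ENNReal.ofReal_coe_nnreal, ENNReal.ofReal_pow (abs_nonneg _), ← Real.enorm_eq_ofReal_abs] at hs3
    exact hs3
  rw [mul_assoc, mul_assoc]
  gcongr
  calc ∫⁻ u, ∫⁻ w, ‖h u w‖ₑ ^ (2 * p) ∂μ ∂μ ≤
      ∫⁻ u, gm p * ENNReal.ofReal (cb / N) ^ p * ((N : ℝ≥0∞)⁻¹ * ∑ i, ‖g' (u i)‖ₑ ^ (2 * p)) ∂μ := lintegral_mono h2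
    _ = gm p * ENNReal.ofReal (cb / N) ^ p * ((N : ℝ≥0∞)⁻¹ * ∑ i, ∫⁻ u, ‖g' (u i)‖ₑ ^ (2 * p) ∂μ) := by
      rw [lintegral_const_mul _ (by fun_prop), lintegral_const_mul _ (by fun_prop), lintegral_finsetSum]
      intro i _; fun_prop
    _ = _ := by
      have e : ∀ i : Fin N, ∫⁻ u, ‖g' (u i)‖ₑ ^ (2 * p) ∂μ = ∫⁻ x, ‖g' x‖ₑ ^ (2 * p) ∂(gaussianReal 0 v) := fun i => by
        rw [← hv i, lintegral_map (by fun_prop) (by fun_prop)]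
      simp only [e, Finset.sum_const, Finset.card_univ, Fintype.card_fin, nsmul_eq_mul]
      rw [← mul_assoc (N : ℝ≥0∞)⁻¹, ENNReal.inv_mul_cancel (by simpa using hN.ne') (by simp), one_mul, mul_assoc]

end conc

lemma conc {Ω : Type*} [MeasurableSpace Ω] (P : Measure Ω) [IsProbabilityMeasure P] {N : ℕ} (hN : 0 < N)
    (Z : Fin N → Ω → ℝ) (hZ : ∀ i, Measurable (Z i)) (hlin : ∀ c : Fin N → ℝ, ∃ v : ℝ≥0,
      P.map (fun ω => ∑ i, c i * Z i ω) = gaussianReal 0 v) {cb : ℝ}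
    (hcov : ∀ i, ∑ k, |∫ ω, Z i ω * Z k ω ∂P| ≤ cb) (v : ℝ≥0)
    (hv : ∀ i, P.map (Z i) = gaussianReal 0 v) (g g' : ℝ → ℝ)
    (hg : ∀ x, HasDerivAt g (g' x) x) (hg' : Continuous g') (hgi : Integrable g (gaussianReal 0 v))
    (p : ℕ) :
    ∫⁻ ω, ‖(∑ i, g (Z i ω)) / N - ∫ y, g y ∂(gaussianReal 0 v)‖ₑ ^ (2 * p) ∂P ≤
      ENNReal.ofReal (Real.pi / 2) ^ (2 * p) * gm p * ENNReal.ofReal (cb / N) ^ p *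
        ∫⁻ x, ‖g' x‖ₑ ^ (2 * p) ∂(gaussianReal 0 v) := by
  have hm : Measurable (fun ω i => Z i ω) := measurable_pi_lambda _ hZ
  have hgc : Continuous g := continuous_iff_continuousAt.2 fun x => (hg x).continuousAt
  have : IsProbabilityMeasure (P.map (fun ω i => Z i ω)) := Measure.isProbabilityMeasure_map hm.aemeasurable
  have := conc_mu (P.map (fun ω i => Z i ω)) hN (fun c => by
      rw [Measure.map_map (by fun_prop) hm]; exact hlin c) (cb := cb) (fun i => by
      have : ∀ k, ∫ x, x i * x k ∂(P.map (fun ω i => Z i ω)) = ∫ ω, Z i ω * Z k ω ∂P := fun k => by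
        rw [integral_map hm.aemeasurable (by fun_prop)]
      simp only [this]; exact hcov i) v (fun i => by
      rw [Measure.map_map (by fun_prop) hm]; exact hv i) g g' hg hg' hgi p
  rwa [lintegral_map (by fun_prop) hm] at this
end

noncomputable section

/-- fractional Brownian motion with a given variance constant -/
structure FB {Ω : Type*} [MeasurableSpace Ω] (H a : ℝ) (P : Measure Ω) (X : ℝ → Ω → ℝ) : Prop where
  cont : ∀ ω, Continuous fun t => X t ω
  zero : ∀ ω, X 0 ω = 0
  meas : ∀ t, Measurable (X t)
  gauss : ∀ (n : ℕ) (t : Fin n → ℝ) (c : Fin n → ℝ), ∃ v : ℝ≥0,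
      Measure.map (fun ω => ∑ i, c i * X (t i) ω) P = gaussianReal 0 v
  pos : 0 < a
  var : ∀ s t : ℝ, ∫ ω, (X t ω - X s ω) ^ 2 ∂P = a * |t - s| ^ (2 * H)

/-- covariance function of window functionals with zero total mass -/
def Rf {ι : Type} [Fintype ι] (H a : ℝ) (θ s : ι → ℝ) (u : ℝ) : ℝ :=
  -(a / 2) * ∑ j, ∑ l, θ j * θ l * |u + s j - s l| ^ (2 * H)

section
variable {Ω : Type*} [MeasurableSpace Ω] {P : Measure Ω} {H a : ℝ} {X : ℝ → Ω → ℝ}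

lemma FB.gaussF (hX : FB H a P X) {ι : Type} [Fintype ι] (t c : ι → ℝ) : ∃ v : ℝ≥0,
      Measure.map (fun ω => ∑ i, c i * X (t i) ω) P = gaussianReal 0 v := by
  obtain ⟨v, hv⟩ := hX.gauss (Fintype.card ι) (fun i => t ((Fintype.equivFin ι).symm i))
    (fun i => c ((Fintype.equivFin ι).symm i))
  refine ⟨v, ?_⟩
  rw [← hv]
  congr 1
  ext ω
  exact (Equiv.sum_comp (Fintype.equivFin ι).symm (fun i => c i * X (t i) ω)).symm

lemma FB.memLp (hX : FB H a P X) (t : ℝ) : MemLp (X t) 2 P := by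
  obtain ⟨v, hv⟩ := hX.gaussF (ι := Unit) (fun _ => t) (fun _ => 1)
  simp only [Finset.univ_unique, Finset.sum_const, Finset.card_singleton, one_smul, one_mul] at hv
  have h := memLp_id_gaussianReal (μ := 0) (v := v) 2
  have hv' : Measure.map (X t) P = gaussianReal 0 v := hv
  rw [← hv', memLp_map_measure_iff (by fun_prop) (hX.meas t).aemeasurable] at h
  exact_mod_cast h

lemma FB.cov (hX : FB H a P X) (hH : 0 < H) (s t : ℝ) :
    ∫ ω, X s ω * X t ω ∂P = a / 2 * (|s| ^ (2 * H) + |t| ^ (2 * H) - |s - t| ^ (2 * H)) := by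
  have h1 : ∀ t, ∫ ω, X t ω ^ 2 ∂P = a * |t| ^ (2 * H) := fun t => by
    have := hX.var 0 t
    simpa [hX.zero] using this
  have e : ∀ ω, X s ω * X t ω = (X s ω ^ 2 + X t ω ^ 2 - (X s ω - X t ω) ^ 2) / 2 := fun ω => by ring
  simp only [e]
  rw [integral_div, integral_sub, integral_add, h1, h1, hX.var]
  · ring
  · exact (hX.memLp s).integrable_sq
  · exact (hX.memLp t).integrable_sq
  · exact (hX.memLp s).integrable_sq.add (hX.memLp t).integrable_sq
  · exact ((hX.memLp s).sub (hX.memLp t)).integrable_sq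

lemma FB.cov_lin (hX : FB H a P X) (hH : 0 < H) {ι : Type} [Fintype ι] (θ t t' : ι → ℝ)
    (hθ : ∑ j, θ j = 0) :
    ∫ ω, (∑ j, θ j * X (t j) ω) * (∑ l, θ l * X (t' l) ω) ∂P =
      -(a / 2) * ∑ j, ∑ l, θ j * θ l * |t j - t' l| ^ (2 * H) := by
  have e : ∀ ω, (∑ j, θ j * X (t j) ω) * (∑ l, θ l * X (t' l) ω) =
      ∑ j, ∑ l, θ j * θ l * (X (t j) ω * X (t' l) ω) := fun ω => by
    rw [Finset.sum_mul_sum]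
    exact Finset.sum_congr rfl fun i _ => Finset.sum_congr rfl fun k _ => by ring
  have hintg : ∀ i k : ι, Integrable (fun ω => X (t i) ω * X (t' k) ω) P := fun i k =>
    (hX.memLp (t i)).integrable_mul (hX.memLp (t' k))
  simp only [e]
  rw [integral_finsetSum _ fun i _ => integrable_finsetSum _ fun k _ => (hintg i k).const_mul _]
  have e2 : ∀ j, ∫ ω, ∑ l, θ j * θ l * (X (t j) ω * X (t' l) ω) ∂P =
      a / 2 * ((θ j * |t j| ^ (2 * H)) * ∑ l, θ l) + a / 2 * (θ j * ∑ l, θ l * |t' l| ^ (2 * H))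
       - a / 2 * ∑ l, θ j * θ l * |t j - t' l| ^ (2 * H) := by
    intro j
    rw [integral_finsetSum _ fun k _ => (hintg j k).const_mul _]
    simp only [integral_const_mul, hX.cov hH, Finset.mul_sum]
    rw [← Finset.sum_add_distrib, ← Finset.sum_sub_distrib]
    exact Finset.sum_congr rfl fun k _ => by ring
  simp only [e2, hθ, Finset.sum_sub_distrib, Finset.sum_add_distrib, ← Finset.mul_sum, ← Finset.sum_mul]
  ring

/-- the law of a zero-mass functional -/
lemma FB.law (hX : FB H a P X) (hH : 0 < H) {ι : Type} [Fintype ι] (θ s : ι → ℝ)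
    (hθ : ∑ j, θ j = 0) (i : ℝ) :
    P.map (fun ω => ∑ j, θ j * X (i + s j) ω) = gaussianReal 0 (Rf H a θ s 0).toNNReal := by
  obtain ⟨v, hv⟩ := hX.gaussF (fun j => i + s j) θ
  rw [hv]
  congr 1
  have e1 : (v : ℝ) = ∫ ω, (∑ j, θ j * X (i + s j) ω) ^ 2 ∂P := by
    have hm : Measurable (fun ω => ∑ j, θ j * X (i + s j) ω) :=
      Finset.measurable_sum _ fun j _ => (hX.meas _).const_mul _
    have : ∫ ω, (∑ j, θ j * X (i + s j) ω) ^ 2 ∂P = ∫ y, y ^ 2 ∂(P.map (fun ω => ∑ j, θ j * X (i + s j) ω)) := by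
      rw [integral_map hm.aemeasurable (by fun_prop)]
    rw [this, hv, ← variance_fun_id_gaussianReal (μ := 0) (v := v), variance_eq_integral (by fun_prop)]
    simp [integral_id_gaussianReal]
  have e2 : (v : ℝ) = Rf H a θ s 0 := by
    rw [e1]
    simp only [sq, hX.cov_lin hH θ _ _ hθ, Rf]
    congr 3; ext j; congr 1; ext l; congr 3; ring
  rw [← e2]; simp

lemma FB.Rf_nonneg [IsProbabilityMeasure P] (hX : FB H a P X) (hH : 0 < H) {ι : Type} [Fintype ι] (θ s : ι → ℝ)
    (hθ : ∑ j, θ j = 0) : 0 ≤ Rf H a θ s 0 := by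
  have := hX.cov_lin hH θ s s hθ
  have e : Rf H a θ s 0 = -(a / 2) * ∑ j, ∑ l, θ j * θ l * |s j - s l| ^ (2 * H) := by simp [Rf]
  rw [e, ← this]
  exact integral_nonneg fun ω => mul_self_nonneg _

end

/-- the second difference bound -/
lemma second_diff {H : ℝ} (hH : H ∈ Ioo (0:ℝ) 1) {S u : ℝ} (hS : 0 < S) (hu : 4 * S ≤ u) {α β : ℝ}
    (hα : |α| ≤ S) (hβ : |β| ≤ S) :
    |(|u + α + β| ^ (2 * H) - |u + α| ^ (2 * H) - |u + β| ^ (2 * H) + |u| ^ (2 * H))| ≤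
      8 * S ^ 2 * u ^ (2 * H - 2) := by
  obtain ⟨hH0, hH1⟩ := hH
  have hu0 : 0 < u := by linarith
  obtain ⟨hα1, hα2⟩ := abs_le.1 hα
  obtain ⟨hβ1, hβ2⟩ := abs_le.1 hβ
  rw [abs_of_pos (show 0 < u + α + β by linarith), abs_of_pos (show 0 < u + α by linarith),
    abs_of_pos (show 0 < u + β by linarith), abs_of_pos hu0]
  -- first derivative is Lipschitz
  have h1 : ∀ x ∈ Icc (u / 2) (2 * u), ∀ y ∈ Icc (u / 2) (2 * u),
      |2 * H * y ^ (2 * H - 1) - 2 * H * x ^ (2 * H - 1)| ≤ 8 * u ^ (2 * H - 2) * |y - x| := by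
    intro x hx y hy
    have := (convex_Icc (u / 2) (2 * u)).norm_image_sub_le_of_norm_hasDerivWithin_le
      (f := fun z => 2 * H * z ^ (2 * H - 1)) (f' := fun z => 2 * H * ((2 * H - 1) * z ^ (2 * H - 1 - 1)))
      (C := 8 * u ^ (2 * H - 2)) (x := x) (y := y) (fun z hz => by
        have hz0 : z ≠ 0 := by have := hz.1; intro h; linarith
        exact ((Real.hasDerivAt_rpow_const (Or.inl hz0)).const_mul _).hasDerivWithinAt) (fun z hz => by
        have hz0 : 0 < z := by have := hz.1; linarith
        rw [show 2 * H - 1 - 1 = 2 * H - 2 by ring, Real.norm_eq_abs, abs_mul (2 * H), abs_mul (2 * H - 1),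
          abs_of_nonneg (Real.rpow_nonneg hz0.le _), abs_of_pos (show 0 < 2 * H by linarith)]
        have a1 : |2 * H - 1| ≤ 1 := abs_le.2 ⟨by linarith, by linarith⟩
        have a2 : z ^ (2 * H - 2) ≤ 4 * u ^ (2 * H - 2) := by
          calc z ^ (2 * H - 2) ≤ (u / 2) ^ (2 * H - 2) :=
                Real.rpow_le_rpow_of_nonpos (by linarith) hz.1 (by linarith)
            _ = u ^ (2 * H - 2) * 2 ^ (2 - 2 * H) := by
                rw [Real.div_rpow hu0.le (by norm_num), div_eq_mul_inv, ← Real.rpow_neg (by norm_num)]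
                congr 2; ring
            _ ≤ u ^ (2 * H - 2) * 2 ^ (2 : ℝ) := by
                gcongr
                · norm_num
                · linarith
            _ = _ := by norm_num; ring
        have := Real.rpow_nonneg hz0.le (2 * H - 2)
        calc 2 * H * (|2 * H - 1| * z ^ (2 * H - 2)) ≤ 2 * (1 * (4 * u ^ (2 * H - 2))) := by
              gcongr; linarith
          _ = _ := by ring) hx hy
    simpa [Real.norm_eq_abs] using this
  -- the function difference
  have h2 := (convex_uIcc 0 β).norm_image_sub_le_of_norm_hasDerivWithin_le
      (f := fun z => (u + α + z) ^ (2 * H) - (u + z) ^ (2 * H))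
      (f' := fun z => 2 * H * (u + α + z) ^ (2 * H - 1) - 2 * H * (u + z) ^ (2 * H - 1))
      (C := 8 * u ^ (2 * H - 2) * S) (x := 0) (y := β) (fun z hz => by
        have hz2 : -S ≤ z := by
          have := (Set.mem_uIcc.1 hz); rcases this with h | h <;> linarith
        have d1 : HasDerivAt (fun z => (u + α + z) ^ (2 * H)) (2 * H * (u + α + z) ^ (2 * H - 1)) z := by
          have := (HasDerivAt.const_add (u + α) (hasDerivAt_id z)).rpow_const (p := 2 * H) (Or.inl (by simp; linarith))
          simpa using this
        have d2 : HasDerivAt (fun z => (u + z) ^ (2 * H)) (2 * H * (u + z) ^ (2 * H - 1)) z := by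
          have := (HasDerivAt.const_add u (hasDerivAt_id z)).rpow_const (p := 2 * H) (Or.inl (by simp; linarith))
          simpa using this
        exact (d1.sub d2).hasDerivWithinAt) (fun z hz => by
        have hz2 : -S ≤ z ∧ z ≤ S := by
          have := (Set.mem_uIcc.1 hz); rcases this with h | h <;> constructor <;> linarith
        have := h1 (u + z) ⟨by linarith, by linarith⟩ (u + α + z) ⟨by linarith, by linarith⟩
        refine this.trans ?_
        rw [show u + α + z - (u + z) = α by ring]
        have := Real.rpow_nonneg hu0.le (2 * H - 2)
        gcongr) left_mem_uIcc right_mem_uIcc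
  simp only [add_zero, sub_zero, Real.norm_eq_abs] at h2
  have := Real.rpow_nonneg hu0.le (2 * H - 2)
  calc _ = |(u + α + β) ^ (2 * H) - (u + β) ^ (2 * H) - ((u + α) ^ (2 * H) - u ^ (2 * H))| := by congr 1; ring
    _ ≤ _ := h2
    _ ≤ 8 * u ^ (2 * H - 2) * S * S := by gcongr
    _ = _ := by ring

/-- decay exponent -/
def kap (H : ℝ) : ℝ := min (2 - 2 * H) (1 / 2)

lemma kap_pos {H : ℝ} (hH : H ∈ Ioo (0:ℝ) 1) : 0 < kap H := lt_min (by linarith [hH.2]) (by norm_num)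
lemma kap_le {H : ℝ} : kap H ≤ 1 / 2 := min_le_right _ _
lemma kap_le' {H : ℝ} : kap H ≤ 2 - 2 * H := min_le_left _ _

lemma Rf_bound {H : ℝ} (hH : H ∈ Ioo (0:ℝ) 1) (a : ℝ) {ι : Type} [Fintype ι] (θ s : ι → ℝ)
    (hθ : ∑ j, θ j = 0) : ∃ C : ℝ, 0 < C ∧ ∀ k : ℕ, |Rf H a θ s k| ≤ C * ((1:ℝ) + k) ^ (-kap H) := by
  obtain ⟨S, hS, hsS⟩ : ∃ S : ℝ, 0 < S ∧ ∀ j, |s j| ≤ S := by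
    refine ⟨1 + ∑ j, |s j|, by positivity, fun j => ?_⟩
    have := Finset.single_le_sum (f := fun j => |s j|) (fun j _ => abs_nonneg _) (Finset.mem_univ j)
    linarith
  have hO : (fun k : ℕ => Rf H a θ s k) =O[atTop] fun k : ℕ => ((1:ℝ) + k) ^ (-kap H) := by
    refine IsBigO.of_bound (|a / 2| * (∑ j, ∑ l, |θ j * θ l| * (8 * S ^ 2) * 4)) ?_
    filter_upwards [eventually_ge_atTop (⌈4 * S⌉₊), eventually_ge_atTop 1] with k hk hk1
    have hk' : 4 * S ≤ k := Nat.ceil_le.1 hk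
    have hk1' : (1:ℝ) ≤ k := by exact_mod_cast hk1
    have e : ∑ j, ∑ l, θ j * θ l * |k + s j - s l| ^ (2 * H) =
        ∑ j, ∑ l, θ j * θ l * (|k + s j + - s l| ^ (2 * H) - |k + s j| ^ (2 * H) - |k + - s l| ^ (2 * H) + |(k:ℝ)| ^ (2 * H)) := by
      have e1 : ∑ j, ∑ l, θ j * θ l * |k + s j| ^ (2 * H) = 0 := by
        have : ∀ j, ∑ l, θ j * θ l * |k + s j| ^ (2 * H) = (θ j * |k + s j| ^ (2 * H)) * ∑ l, θ l := fun j => by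
          rw [Finset.mul_sum]; exact Finset.sum_congr rfl fun l _ => by ring
        simp [this, hθ]
      have e2 : ∑ j, ∑ l, θ j * θ l * |k + - s l| ^ (2 * H) = 0 := by
        have : ∀ j, ∑ l, θ j * θ l * |k + - s l| ^ (2 * H) = θ j * ∑ l, θ l * |k + - s l| ^ (2 * H) := fun j => by
          rw [Finset.mul_sum]; exact Finset.sum_congr rfl fun l _ => by ring
        simp only [this, ← Finset.sum_mul, hθ, zero_mul]
      have e3 : ∑ j, ∑ l, θ j * θ l * |(k:ℝ)| ^ (2 * H) = 0 := by
        simp only [← Finset.sum_mul, ← Finset.mul_sum, hθ, mul_zero, zero_mul, Finset.sum_const_zero]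
      simp only [mul_add, mul_sub, Finset.sum_add_distrib, Finset.sum_sub_distrib, e1, e2, e3, sub_zero, add_zero]
      simp only [sub_eq_add_neg]
    have hd : (k:ℝ) ^ (2 * H - 2) ≤ 4 * ((1:ℝ) + k) ^ (-kap H) := by
      calc (k:ℝ) ^ (2 * H - 2) ≤ (((1:ℝ) + k) / 2) ^ (2 * H - 2) :=
            Real.rpow_le_rpow_of_nonpos (by positivity) (by linarith) (by linarith [hH.2])
        _ = ((1:ℝ) + k) ^ (2 * H - 2) * 2 ^ (2 - 2 * H) := by
            rw [Real.div_rpow (by positivity) (by norm_num), div_eq_mul_inv, ← Real.rpow_neg (by norm_num)]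
            congr 2; ring
        _ ≤ ((1:ℝ) + k) ^ (-kap H) * 2 ^ (2 : ℝ) := by
            gcongr
            · linarith
            · have := @kap_le' H; linarith
            · norm_num
            · linarith [hH.1]
        _ = _ := by norm_num; ring
    rw [Rf, e, Real.norm_eq_abs, Real.norm_eq_abs, abs_of_nonneg (Real.rpow_nonneg (by positivity) _), abs_mul, abs_neg,
      mul_assoc |a / 2|]
    gcongr
    rw [Finset.sum_mul]
    refine (Finset.abs_sum_le_sum_abs _ _).trans (Finset.sum_le_sum fun j _ => ?_)
    rw [Finset.sum_mul]
    refine (Finset.abs_sum_le_sum_abs _ _).trans (Finset.sum_le_sum fun l _ => ?_)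
    rw [abs_mul, mul_assoc, mul_assoc]
    gcongr
    refine (second_diff hH hS hk' (hsS j) (by rw [abs_neg]; exact hsS l)).trans ?_
    gcongr
  obtain ⟨C, hC, h⟩ := bound_of_isBigO_nat_atTop hO
  refine ⟨C, hC, fun k => ?_⟩
  have hp : (0:ℝ) < ((1:ℝ) + k) ^ (-kap H) := Real.rpow_pos_of_pos (by positivity) _
  have := h (x := k) hp.ne'
  rwa [Real.norm_eq_abs, Real.norm_eq_abs, abs_of_pos hp] at this

lemma sum_dist_le (ψ : ℕ → ℝ) (hψ : ∀ m, 0 ≤ ψ m) {N i : ℕ} (hi : i < N) :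
    ∑ k ∈ Finset.range N, ψ ((i:ℤ) - k).natAbs ≤ 2 * ∑ m ∈ Finset.range N, ψ m := by
  have h1 : ∀ k ∈ Finset.range N, ψ ((i:ℤ) - k).natAbs =
      ∑ m ∈ Finset.range N, if m = ((i:ℤ) - k).natAbs then ψ m else 0 := by
    intro k hk
    rw [Finset.sum_ite_eq' (Finset.range N), if_pos]
    simp only [Finset.mem_range] at hk ⊢
    omega
  rw [Finset.sum_congr rfl h1, Finset.sum_comm, Finset.mul_sum]
  refine Finset.sum_le_sum fun m _ => ?_
  rw [← Finset.sum_filter, Finset.sum_const, nsmul_eq_mul]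
  gcongr
  · exact hψ m
  have : (Finset.range N).filter (fun k : ℕ => m = ((i:ℤ) - (k:ℤ)).natAbs) ⊆ {i + m, i - m} := by
    intro k hk
    simp only [Finset.mem_filter, Finset.mem_range, Finset.mem_insert, Finset.mem_singleton] at hk ⊢
    omega
  exact_mod_cast (Finset.card_le_card this).trans Finset.card_le_two

lemma sum_rpow_le {κ : ℝ} (h0 : 0 < κ) (h1 : κ ≤ 1 / 2) (N : ℕ) :
    ∑ m ∈ Finset.range N, ((1:ℝ) + m) ^ (-κ) ≤ 2 * (N:ℝ) ^ (1 - κ) := by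
  induction N with
  | zero => simp [Real.zero_rpow (show 1 - κ ≠ 0 by linarith)]
  | succ n ih =>
    rw [Finset.sum_range_succ]
    refine (add_le_add_left ih _).trans ?_
    have hp : (0:ℝ) < 1 + n := by positivity
    have hb := rpow_one_add_le_one_add_mul_self (s := -(1 / (1 + (n:ℝ)))) (p := 1 - κ)
      (by
        have : 1 / (1 + (n:ℝ)) ≤ 1 := by rw [div_le_one hp]; linarith [Nat.cast_nonneg (α := ℝ) n]
        linarith) (by linarith) (by linarith)
    have e1 : (1 + -(1 / (1 + (n:ℝ)))) = n / (1 + n) := by field_simp; ring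
    rw [e1, Real.div_rpow (by positivity) hp.le, div_le_iff₀ (Real.rpow_pos_of_pos hp _)] at hb
    have e2 : (1 + (n:ℝ)) ^ (1 - κ) = (1 + n) * (1 + (n:ℝ)) ^ (-κ) := by
      rw [show 1 - κ = 1 + -κ by ring, Real.rpow_add hp, Real.rpow_one]
    have e3 : (1 + (1 - κ) * -(1 / (1 + (n:ℝ)))) * (1 + (n:ℝ)) ^ (1 - κ) =
        (1 + (n:ℝ)) ^ (1 - κ) - (1 - κ) * (1 + (n:ℝ)) ^ (-κ) := by
      rw [e2]; field_simp; ring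
    rw [e3] at hb
    push_cast
    rw [add_comm (n:ℝ) 1]
    have := Real.rpow_nonneg hp.le (-κ)
    nlinarith

lemma Rf_neg {H a : ℝ} {ι : Type} [Fintype ι] (θ s : ι → ℝ) (u : ℝ) : Rf H a θ s (-u) = Rf H a θ s u := by
  unfold Rf
  congr 1
  rw [Finset.sum_comm]
  refine Finset.sum_congr rfl fun j _ => Finset.sum_congr rfl fun l _ => ?_
  rw [mul_comm (θ l), ← abs_neg]
  congr 3; ring

/-- concentration of empirical averages of window functionals of fractional Brownian motion -/
lemma FB.avg {H : ℝ} (hH : H ∈ Ioo (0:ℝ) 1) (a : ℝ) {ι : Type} [Fintype ι] (θ s : ι → ℝ)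
    (hθ : ∑ j, θ j = 0) (g g' : ℝ → ℝ)
    (hg : ∀ x, HasDerivAt g (g' x) x) (hg' : Continuous g')
    (hgi : ∀ v, Integrable g (gaussianReal 0 v))
    (hgi' : ∀ v p, ∫⁻ x, ‖g' x‖ₑ ^ (2 * p) ∂(gaussianReal 0 v) < ⊤) (p : ℕ) :
    ∃ C : ℝ, 0 ≤ C ∧ ∀ {Ω : Type*} [MeasurableSpace Ω] (P : Measure Ω) [IsProbabilityMeasure P]
      (X : ℝ → Ω → ℝ), FB H a P X → ∀ N : ℕ, 0 < N →
      ∫⁻ ω, ‖(∑ i ∈ Finset.range N, g (∑ j, θ j * X (i + s j) ω)) / N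
        - ∫ y, g y ∂(gaussianReal 0 (Rf H a θ s 0).toNNReal)‖ₑ ^ (2 * p) ∂P ≤
        ENNReal.ofReal (C * (N:ℝ) ^ (-(kap H * p))) := by
  obtain ⟨C0, hC0, hR⟩ := Rf_bound hH a θ s hθ
  set v := (Rf H a θ s 0).toNNReal with hv
  set D := ENNReal.ofReal (Real.pi / 2) ^ (2 * p) * gm p * ∫⁻ x, ‖g' x‖ₑ ^ (2 * p) ∂(gaussianReal 0 v) with hD
  have hDt : D ≠ ⊤ := ENNReal.mul_ne_top (ENNReal.mul_ne_top (by simp) (gm_lt_top p).ne) (hgi' v p).ne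
  refine ⟨D.toReal * (4 * C0) ^ p, by positivity, ?_⟩
  intro Ω _ P _ X hX N hN
  have hN' : (0:ℝ) < N := by exact_mod_cast hN
  have hcov : ∀ i k : ℕ, |∫ ω, (∑ j, θ j * X (i + s j) ω) * (∑ j, θ j * X (k + s j) ω) ∂P| ≤
      C0 * ((1:ℝ) + (((i:ℤ) - k).natAbs : ℕ)) ^ (-kap H) := by
    intro i k
    rw [hX.cov_lin hH.1 θ (fun j => i + s j) (fun j => k + s j) hθ]
    have e : -(a / 2) * ∑ j, ∑ l, θ j * θ l * |(i:ℝ) + s j - (k + s l)| ^ (2 * H) = Rf H a θ s ((i:ℝ) - k) := by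
      unfold Rf
      congr 1
      refine Finset.sum_congr rfl fun j _ => Finset.sum_congr rfl fun l _ => ?_
      congr 3; ring
    rw [e]
    have e2 : Rf H a θ s ((i:ℝ) - k) = Rf H a θ s (((i:ℤ) - k).natAbs : ℕ) := by
      have h3 : ((i:ℝ) - k) = (((i:ℤ) - k : ℤ) : ℝ) := by push_cast; ring
      rw [h3]
      rcases Int.natAbs_eq ((i:ℤ) - k) with h | h
      · conv_lhs => rw [h]
        simp
      · conv_lhs => rw [h]
        rw [Int.cast_neg, Rf_neg]; simp
    rw [e2]
    exact hR _
  have hrow : ∀ i : Fin N, ∑ k : Fin N, |∫ ω, (∑ j, θ j * X ((i:ℕ) + s j) ω) * (∑ j, θ j * X ((k:ℕ) + s j) ω) ∂P|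
      ≤ 4 * C0 * (N:ℝ) ^ (1 - kap H) := by
    intro i
    calc _ ≤ ∑ k : Fin N, C0 * ((1:ℝ) + ((((i:ℕ):ℤ) - (k:ℕ)).natAbs : ℕ)) ^ (-kap H) :=
          Finset.sum_le_sum fun k _ => hcov i k
      _ = ∑ k ∈ Finset.range N, C0 * ((1:ℝ) + ((((i:ℕ):ℤ) - k).natAbs : ℕ)) ^ (-kap H) := by
          rw [Finset.sum_range]
      _ ≤ 2 * ∑ m ∈ Finset.range N, C0 * ((1:ℝ) + m) ^ (-kap H) :=
          sum_dist_le (fun m => C0 * ((1:ℝ) + m) ^ (-kap H)) (fun m => by positivity) i.2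
      _ ≤ _ := by
          rw [← Finset.mul_sum]
          have := sum_rpow_le (kap_pos hH) kap_le N
          nlinarith
  have key := conc P hN (fun (i : Fin N) ω => ∑ j, θ j * X ((i:ℕ) + s j) ω)
    (fun i => Finset.measurable_sum _ fun j _ => (hX.meas _).const_mul _)
    (fun c => by
      obtain ⟨w, hw⟩ := hX.gaussF (ι := Fin N × ι) (fun q => (q.1:ℕ) + s q.2) (fun q => c q.1 * θ q.2)
      refine ⟨w, ?_⟩
      rw [← hw]
      congr 1; ext ω
      rw [Fintype.sum_prod_type]
      refine Finset.sum_congr rfl fun i _ => ?_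
      rw [Finset.mul_sum]
      exact Finset.sum_congr rfl fun j _ => by ring) hrow v
    (fun i => hX.law hH.1 θ s hθ _) g g' hg hg' (hgi v) p
  have e1 : ∀ ω, ∑ i ∈ Finset.range N, g (∑ j, θ j * X (i + s j) ω) =
     ∑ i : Fin N, g (∑ j, θ j * X ((i:ℕ) + s j) ω) := fun ω => by rw [Finset.sum_range]
  simp only [e1]
  refine key.trans ?_
  have e2 : 4 * C0 * (N:ℝ) ^ (1 - kap H) / N = 4 * C0 * (N:ℝ) ^ (-kap H) := by
    rw [show 1 - kap H = -kap H + 1 by ring, Real.rpow_add hN', Real.rpow_one]; field_simp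
  rw [e2, mul_right_comm, ← hD, ← ENNReal.ofReal_pow (by positivity)]
  nth_rewrite 1 [← ENNReal.ofReal_toReal hDt]
  rw [← ENNReal.ofReal_mul (by positivity), mul_pow, ← Real.rpow_mul_natCast hN'.le, neg_mul, mul_assoc]

end

noncomputable section

lemma as_tendsto {Ω β : Type*} [Countable β] [MeasurableSpace Ω] {P : Measure Ω} {S : β → Ω → ℝ}
    (hm : ∀ b, Measurable (S b)) (k : ℕ) (hk : k ≠ 0) (h : ∑' b, ∫⁻ ω, ‖S b ω‖ₑ ^ k ∂P ≠ ⊤) :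
    ∀ᵐ ω ∂P, Tendsto (fun b => S b ω) cofinite (𝓝 0) := by
  have hmm : ∀ b, Measurable fun ω => ‖S b ω‖ₑ ^ k := fun b => by
    have := hm b; fun_prop
  rw [← lintegral_tsum fun b => (hmm b).aemeasurable] at h
  filter_upwards [ae_lt_top (Measurable.ennreal_tsum hmm) h] with ω hω
  have h1 := ENNReal.tendsto_cofinite_zero_of_tsum_ne_top hω.ne
  rw [tendsto_zero_iff_enorm_tendsto_zero]
  have h2 := h1.ennrpow_const (1 / (k:ℝ))
  have hk' : (k:ℝ) ≠ 0 := by exact_mod_cast hk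
  rw [ENNReal.zero_rpow_of_pos (by positivity)] at h2
  refine h2.congr fun b => ?_
  rw [← ENNReal.rpow_natCast, ← ENNReal.rpow_mul, mul_one_div_cancel hk', ENNReal.rpow_one]

/-- a countable family of fractional Brownian motions with polynomially growing sample sizes -/
structure FBSeq {Ω β : Type*} [MeasurableSpace Ω] (H a : ℝ) (P : Measure Ω) (X : β → ℝ → Ω → ℝ) (N : β → ℕ) : Prop where
  fb : ∀ b, FB H a P (X b)
  pos : ∀ b, 0 < N b
  summ : ∃ r : ℝ, Summable fun b => (N b : ℝ) ^ (-r)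

section
variable {Ω β : Type*} [Countable β] [MeasurableSpace Ω] {P : Measure Ω} [IsProbabilityMeasure P] {H a : ℝ}
  {X : β → ℝ → Ω → ℝ} {N : β → ℕ}

lemma FBSeq.avg_as (hX : FBSeq H a P X N) (hH : H ∈ Ioo (0:ℝ) 1) {ι : Type} [Fintype ι] (θ s : ι → ℝ)
    (hθ : ∑ j, θ j = 0) (g g' : ℝ → ℝ)
    (hg : ∀ x, HasDerivAt g (g' x) x) (hg' : Continuous g')
    (hgi : ∀ v, Integrable g (gaussianReal 0 v))
    (hgi' : ∀ v p, ∫⁻ x, ‖g' x‖ₑ ^ (2 * p) ∂(gaussianReal 0 v) < ⊤) :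
    ∀ᵐ ω ∂P, Tendsto (fun b => (∑ i ∈ Finset.range (N b), g (∑ j, θ j * X b (i + s j) ω)) / N b) cofinite
      (𝓝 (∫ y, g y ∂(gaussianReal 0 (Rf H a θ s 0).toNNReal))) := by
  obtain ⟨r, hr⟩ := hX.summ
  obtain ⟨p, hp⟩ : ∃ p : ℕ, r ≤ kap H * p ∧ p ≠ 0 := by
    refine ⟨⌈r / kap H⌉₊ + 1, ?_, by omega⟩
    have h1 := Nat.le_ceil (r / kap H)
    rw [div_le_iff₀ (kap_pos hH)] at h1
    have := kap_pos hH
    push_cast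
    nlinarith
  obtain ⟨C, hC, hb⟩ := FB.avg hH a θ s hθ g g' hg hg' hgi hgi' p
  have hgc : Continuous g := continuous_iff_continuousAt.2 fun x => (hg x).continuousAt
  have key := as_tendsto (P := P) (S := fun b ω => (∑ i ∈ Finset.range (N b), g (∑ j, θ j * X b (i + s j) ω)) / N b
    - ∫ y, g y ∂(gaussianReal 0 (Rf H a θ s 0).toNNReal)) (fun b => by
      refine ((Finset.measurable_sum _ fun i _ => hgc.measurable.comp ?_).div_const _).sub_const _
      exact Finset.measurable_sum _ fun j _ => ((hX.fb b).meas _).const_mul _) (2 * p) (by have := hp.2; omega) (by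
      refine ne_top_of_le_ne_top ?_ (ENNReal.tsum_le_tsum fun b => hb P (X b) (hX.fb b) (N b) (hX.pos b))
      have hs : Summable fun b => C * (N b : ℝ) ^ (-(kap H * p)) := by
        refine Summable.mul_left _ (Summable.of_nonneg_of_le (fun b => by positivity) (fun b => ?_) hr)
        have : (1:ℝ) ≤ N b := by exact_mod_cast hX.pos b
        exact Real.rpow_le_rpow_of_exponent_le this (by linarith [hp.1])
      exact hs.tsum_ofReal_ne_top)
  filter_upwards [key] with ω hω
  have := hω.add_const (∫ y, g y ∂(gaussianReal 0 (Rf H a θ s 0).toNNReal))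
  simpa using this

lemma FBSeq.avg_pow (hX : FBSeq H a P X N) (hH : H ∈ Ioo (0:ℝ) 1) {ι : Type} [Fintype ι] (θ s : ι → ℝ)
    (hθ : ∑ j, θ j = 0) (q : ℕ) :
    ∀ᵐ ω ∂P, ∃ M : ℝ, ∀ b, (∑ i ∈ Finset.range (N b), (∑ j, θ j * X b (i + s j) ω) ^ q) / N b ≤ M := by
  have h1 : ∀ (v : ℝ≥0) (k : ℕ), Integrable (fun x : ℝ => x ^ k) (gaussianReal 0 v) := fun v k => by
    refine ⟨by fun_prop, ?_⟩
    have := lint_pow_gauss_lt_top v k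
    simpa [HasFiniteIntegral] using this
  have := hX.avg_as hH θ s hθ (fun x => x ^ q) (fun x => q * x ^ (q - 1)) (fun x => by simpa using hasDerivAt_pow q x)
    (by fun_prop) (fun v => h1 v q) (fun v p => by
      have : ∀ x : ℝ, ‖(q:ℝ) * x ^ (q - 1)‖ₑ ^ (2 * p) = ‖(q:ℝ)‖ₑ ^ (2 * p) * ‖x‖ₑ ^ ((q - 1) * (2 * p)) := fun x => by
        rw [enorm_mul, mul_pow, enorm_pow, pow_mul ‖x‖ₑ]
      simp only [this]
      rw [lintegral_const_mul _ (by fun_prop)]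
      exact ENNReal.mul_lt_top (by simp) (lint_pow_gauss_lt_top v _))
  filter_upwards [this] with ω hω
  have h2 := hω.eventually_lt_const (lt_add_one _)
  rw [Filter.eventually_cofinite] at h2
  set f := fun b => (∑ i ∈ Finset.range (N b), (∑ j, θ j * X b (i + s j) ω) ^ q) / (N b : ℝ) with hf
  obtain ⟨M, hM⟩ := (h2.image f).bddAbove
  refine ⟨max M (∫ y, y ^ q ∂(gaussianReal 0 (Rf H a θ s 0).toNNReal) + 1), fun b => ?_⟩
  by_cases hb : f b < ∫ y, y ^ q ∂(gaussianReal 0 (Rf H a θ s 0).toNNReal) + 1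
  · exact le_max_of_le_right hb.le
  · exact le_max_of_le_left (hM ⟨b, hb, rfl⟩)

lemma integral_cos_gauss (v : ℝ≥0) : ∫ y, Real.cos y ∂(gaussianReal 0 v) = Real.exp (-v / 2) := by
  have h := charFun_gaussianReal (μ := 0) (v := v) 1
  rw [charFun_apply_real] at h
  have hi : Integrable (fun x : ℝ => Complex.exp (((1:ℝ):ℂ) * x * Complex.I)) (gaussianReal 0 v) := by
    refine Integrable.of_bound (by fun_prop) 1 (ae_of_all _ fun x => ?_)
    rw [← Complex.ofReal_mul, Complex.norm_exp_ofReal_mul_I]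
  have h2 := congrArg Complex.re h
  have h3 : (∫ x : ℝ, Complex.exp (((1:ℝ):ℂ) * x * Complex.I) ∂(gaussianReal 0 v)).re = 
     ∫ x : ℝ, (Complex.exp (((1:ℝ):ℂ) * x * Complex.I)).re ∂(gaussianReal 0 v) := (integral_re hi).symm
  rw [h3] at h2
  have h4 : ∀ x : ℝ, (Complex.exp (((1:ℝ):ℂ) * x * Complex.I)).re = Real.cos x := fun x => by
    rw [Complex.ofReal_one, one_mul, Complex.exp_ofReal_mul_I_re]
  simp only [h4] at h2
  rw [h2, ← Complex.exp_ofReal_re]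
  congr 2
  push_cast; ring

lemma FBSeq.avg_cos (hX : FBSeq H a P X N) (hH : H ∈ Ioo (0:ℝ) 1) {ι : Type} [Fintype ι] (θ s : ι → ℝ)
    (hθ : ∑ j, θ j = 0) :
    ∀ᵐ ω ∂P, Tendsto (fun b => (∑ i ∈ Finset.range (N b), Real.cos (∑ j, θ j * X b (i + s j) ω)) / N b) cofinite
      (𝓝 (Real.exp (-(Rf H a θ s 0).toNNReal / 2))) := by
  rw [← integral_cos_gauss]
  refine hX.avg_as hH θ s hθ Real.cos (fun x => -Real.sin x) Real.hasDerivAt_cos (by fun_prop) (fun v => ?_) (fun v p => ?_)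
  · exact Integrable.of_bound (by fun_prop) 1 (ae_of_all _ fun x => Real.abs_cos_le_one x)
  · refine lt_of_le_of_lt (lintegral_mono (g := fun _ => 1) fun x => ?_) (by simp)
    refine pow_le_one₀ (by simp) ?_
    rw [Real.enorm_eq_ofReal_abs, abs_neg, ENNReal.ofReal_le_one]
    exact Real.abs_sin_le_one x

lemma FBSeq.avg_sin (hX : FBSeq H a P X N) (hH : H ∈ Ioo (0:ℝ) 1) {ι : Type} [Fintype ι] (θ s : ι → ℝ)
    (hθ : ∑ j, θ j = 0) :
    ∀ᵐ ω ∂P, Tendsto (fun b => (∑ i ∈ Finset.range (N b), Real.sin (∑ j, θ j * X b (i + s j) ω)) / N b) cofinite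
      (𝓝 (∫ y, Real.sin y ∂(gaussianReal 0 (Rf H a θ s 0).toNNReal))) := by
  refine hX.avg_as hH θ s hθ Real.sin (fun x => Real.cos x) Real.hasDerivAt_sin (by fun_prop) (fun v => ?_) (fun v p => ?_)
  · exact Integrable.of_bound (by fun_prop) 1 (ae_of_all _ fun x => Real.abs_sin_le_one x)
  · refine lt_of_le_of_lt (lintegral_mono (g := fun _ => 1) fun x => ?_) (by simp)
    refine pow_le_one₀ (by simp) ?_
    rw [Real.enorm_eq_ofReal_abs, ENNReal.ofReal_le_one]
    exact Real.abs_cos_le_one x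
end

lemma FB.scale {Ω : Type*} [MeasurableSpace Ω] {P : Measure Ω} {H a : ℝ} {X : ℝ → Ω → ℝ} (hX : FB H a P X)
    {l b : ℝ} (hl : 0 < l) (hb : b ≠ 0) {a' : ℝ} (ha' : a' = a * (b ^ 2 * l ^ (2 * H))) :
    FB H a' P (fun s ω => b * X (s * l) ω) where
  cont ω := by
    have := hX.cont ω
    exact continuous_const.mul (this.comp (by fun_prop))
  zero ω := by simp [hX.zero]
  meas t := (hX.meas _).const_mul _
  gauss n t c := by
    obtain ⟨v, hv⟩ := hX.gauss n (fun i => t i * l) (fun i => c i * b)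
    exact ⟨v, by simpa [mul_assoc] using hv⟩
  pos := by
    have := hX.pos
    rw [ha']; positivity
  var s t := by
    have e : ∀ ω, (b * X (t * l) ω - b * X (s * l) ω) ^ 2 = b ^ 2 * (X (t * l) ω - X (s * l) ω) ^ 2 := fun ω => by ring
    simp only [e]
    rw [integral_const_mul, hX.var, ha', ← sub_mul, abs_mul, abs_of_pos hl, Real.mul_rpow (abs_nonneg _) hl.le]
    ring
end

noncomputable section

/-- unit complex number with given phase -/
def ph (x : ℝ) : ℂ := Complex.exp (x * Complex.I)

lemma norm_ph (x : ℝ) : ‖ph x‖ = 1 := Complex.norm_exp_ofReal_mul_I x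
lemma ph_add (x y : ℝ) : ph (x + y) = ph x * ph y := by
  unfold ph; rw [← Complex.exp_add]; push_cast; ring_nf
lemma ph_re (x : ℝ) : (ph x).re = Real.cos x := Complex.exp_ofReal_mul_I_re x
lemma ph_im (x : ℝ) : (ph x).im = Real.sin x := Complex.exp_ofReal_mul_I_im x

lemma sq_norm_sum_ph {ι : Type*} (s : Finset ι) (z : ι → ℝ) :
    ‖∑ h ∈ s, ph (z h)‖ ^ 2 = ∑ h ∈ s, ∑ h' ∈ s, Real.cos (z h - z h') := by
  rw [Complex.sq_norm, Complex.normSq_apply, Complex.re_sum, Complex.im_sum]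
  simp only [ph_re, ph_im, Real.cos_sub, Finset.sum_mul_sum, Finset.sum_add_distrib]

lemma vdc (z : ℕ → ℝ) (N M : ℕ) (hN : 0 < N) (hM : 0 < M) :
    (‖∑ i ∈ Finset.range N, ph (z i)‖ / N) ^ 2 ≤
      2 * ((1 / (M:ℝ) ^ 2) * ∑ h ∈ Finset.range M, ∑ h' ∈ Finset.range M,
        (∑ i ∈ Finset.range N, Real.cos (z (i + h) - z (i + h'))) / N) + 2 * (2 * M / N) ^ 2 := by
  have hN' : (0:ℝ) < N := by exact_mod_cast hN
  have hM' : (0:ℝ) < M := by exact_mod_cast hM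
  set A := ∑ i ∈ Finset.range N, ph (z i) with hA
  set Q := ∑ i ∈ Finset.range N, ‖∑ h ∈ Finset.range M, ph (z (i + h))‖ with hQ
  have h1 : ∀ h : ℕ, ‖A - ∑ i ∈ Finset.range N, ph (z (i + h))‖ ≤ 2 * h := by
    intro h
    have e1 : ∑ i ∈ Finset.range (N + h), ph (z i) = A + ∑ i ∈ Finset.range h, ph (z (N + i)) :=
      Finset.sum_range_add _ _ _
    have e2 : ∑ i ∈ Finset.range (N + h), ph (z i) =
        ∑ i ∈ Finset.range h, ph (z i) + ∑ i ∈ Finset.range N, ph (z (i + h)) := by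
      rw [add_comm N h, Finset.sum_range_add]
      simp only [add_comm h]
    have e3 : A - ∑ i ∈ Finset.range N, ph (z (i + h)) =
        ∑ i ∈ Finset.range h, ph (z i) - ∑ i ∈ Finset.range h, ph (z (N + i)) := by
      linear_combination e2 - e1
    have b : ∀ f : ℕ → ℝ, ‖∑ i ∈ Finset.range h, ph (f i)‖ ≤ h := fun f => by
      refine (norm_sum_le _ _).trans ?_
      simp [norm_ph]
    rw [e3]
    refine (norm_sub_le _ _).trans ?_
    linarith [b z, b (fun i => z (N + i))]
  have h2 : M * ‖A‖ ≤ Q + 2 * M * M := by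
    have e : (M:ℂ) * A = ∑ i ∈ Finset.range N, ∑ h ∈ Finset.range M, ph (z (i + h)) +
        ∑ h ∈ Finset.range M, (A - ∑ i ∈ Finset.range N, ph (z (i + h))) := by
      rw [Finset.sum_sub_distrib, Finset.sum_comm (s := Finset.range N)]
      simp
    calc M * ‖A‖ = ‖(M:ℂ) * A‖ := by simp
      _ ≤ Q + ∑ h ∈ Finset.range M, (2 * (M:ℝ)) := by
        rw [e]
        refine (norm_add_le _ _).trans (add_le_add (norm_sum_le _ _) ((norm_sum_le _ _).trans ?_))
        refine Finset.sum_le_sum fun h hh => (h1 h).trans ?_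
        have : (h:ℝ) ≤ M := by exact_mod_cast (Finset.mem_range.1 hh).le
        linarith
      _ = _ := by simp; ring
  have h3 : Q ^ 2 ≤ N * ∑ i ∈ Finset.range N, ‖∑ h ∈ Finset.range M, ph (z (i + h))‖ ^ 2 := by
    have := sq_sum_le_card_mul_sum_sq (s := Finset.range N) (f := fun i => ‖∑ h ∈ Finset.range M, ph (z (i + h))‖)
    simpa using this
  have h4 : ∑ i ∈ Finset.range N, ‖∑ h ∈ Finset.range M, ph (z (i + h))‖ ^ 2 =
      N * ∑ h ∈ Finset.range M, ∑ h' ∈ Finset.range M,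
        (∑ i ∈ Finset.range N, Real.cos (z (i + h) - z (i + h'))) / N := by
    simp only [sq_norm_sum_ph]
    rw [Finset.sum_comm, Finset.mul_sum]
    refine Finset.sum_congr rfl fun h _ => ?_
    rw [Finset.sum_comm, Finset.mul_sum]
    refine Finset.sum_congr rfl fun h' _ => ?_
    field_simp
  rw [h4] at h3
  set R := ∑ h ∈ Finset.range M, ∑ h' ∈ Finset.range M,
        (∑ i ∈ Finset.range N, Real.cos (z (i + h) - z (i + h'))) / (N:ℝ) with hR
  have h5 : ‖A‖ / N ≤ Q / (M * N) + 2 * M / N := by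
    rw [div_add_div _ _ (by positivity) (by positivity), div_le_div_iff₀ (by positivity) (by positivity)]
    nlinarith [mul_le_mul_of_nonneg_left h2 (show (0:ℝ) ≤ N * N by positivity)]
  have h6 : (Q / (M * N)) ^ 2 ≤ 1 / (M:ℝ) ^ 2 * R := by
    rw [div_pow, div_le_iff₀ (by positivity)]
    calc Q ^ 2 ≤ N * (N * R) := h3
      _ = _ := by field_simp
  calc (‖A‖ / N) ^ 2 ≤ (Q / (M * N) + 2 * M / N) ^ 2 := by gcongr
    _ ≤ 2 * (Q / (M * N)) ^ 2 + 2 * (2 * M / N) ^ 2 := by nlinarith [sq_nonneg (Q / (M * N) - 2 * M / N)]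
    _ ≤ _ := by linarith

/-- double sum -/
def Tf {ι : Type} [Fintype ι] (H : ℝ) (θ s : ι → ℝ) (u : ℝ) : ℝ :=
  ∑ j, ∑ l, θ j * θ l * |u + s j - s l| ^ (2 * H)

lemma Tf_neg {H : ℝ} {ι : Type} [Fintype ι] (θ s : ι → ℝ) (u : ℝ) : Tf H θ s (-u) = Tf H θ s u := by
  unfold Tf
  rw [Finset.sum_comm]
  refine Finset.sum_congr rfl fun j _ => Finset.sum_congr rfl fun l _ => ?_
  rw [mul_comm (θ l), ← abs_neg]
  congr 3; ring

lemma Tf_tendsto {H : ℝ} (hH : 0 < H) {ι : Type} [Fintype ι] (θ s : ι → ℝ) (hθ : ∑ j, θ j ≠ 0) :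
    Tendsto (fun k : ℕ => Tf H θ s k) atTop atTop := by
  have h1 : Tendsto (fun k : ℕ => ∑ j, ∑ l, θ j * θ l * |1 + (s j - s l) / k| ^ (2 * H)) atTop
      (𝓝 (∑ j, ∑ l, θ j * θ l * |1 + 0| ^ (2 * H))) := by
    refine tendsto_finsetSum _ fun j _ => tendsto_finsetSum _ fun l _ => ?_
    refine Tendsto.const_mul _ (Tendsto.rpow_const (Tendsto.abs (Tendsto.const_add _ ?_)) (Or.inl (by norm_num)))
    exact tendsto_const_div_atTop_nhds_zero_nat _
  have h2 : ∑ j, ∑ l, θ j * θ l * |(1:ℝ) + 0| ^ (2 * H) = (∑ j, θ j) ^ 2 := by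
    simp [sq, Finset.sum_mul_sum]
  rw [h2] at h1
  have h3 : Tendsto (fun k : ℕ => (k:ℝ) ^ (2 * H)) atTop atTop :=
    (tendsto_rpow_atTop (by positivity)).comp tendsto_natCast_atTop_atTop
  refine (Tendsto.atTop_mul_pos (by positivity) h3 h1).congr' ?_
  filter_upwards [eventually_gt_atTop 0] with k hk
  have hk' : (0:ℝ) < k := by exact_mod_cast hk
  rw [Finset.mul_sum, Tf]
  refine Finset.sum_congr rfl fun j _ => ?_
  rw [Finset.mul_sum]
  refine Finset.sum_congr rfl fun l _ => ?_
  have : |(k:ℝ) + s j - s l| = k * |1 + (s j - s l) / k| := by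
    rw [← abs_of_pos hk', ← abs_mul, abs_of_pos hk']
    congr 1; field_simp; ring
  rw [this, Real.mul_rpow hk'.le (abs_nonneg _)]
  ring

lemma Rf_pair {H a : ℝ} {ι : Type} [Fintype ι] (θ s : ι → ℝ) (h h' : ℝ) :
    Rf H a (Sum.elim θ (fun j => -θ j)) (Sum.elim (fun j => s j + h) (fun j => s j + h')) 0 =
      a * (Tf H θ s (h - h') - Tf H θ s 0) := by
  have e1 : Tf H θ s (h - h') = ∑ j, ∑ l, θ j * θ l * |0 + (s j + h) - (s l + h')| ^ (2 * H) := by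
    unfold Tf
    refine Finset.sum_congr rfl fun j _ => Finset.sum_congr rfl fun l _ => ?_
    congr 3; ring
  have e2 : Tf H θ s (h - h') = ∑ j, ∑ l, θ j * θ l * |0 + (s j + h') - (s l + h)| ^ (2 * H) := by
    rw [← Tf_neg]
    unfold Tf
    refine Finset.sum_congr rfl fun j _ => Finset.sum_congr rfl fun l _ => ?_
    congr 3; ring
  have e3 : ∀ x, Tf H θ s 0 = ∑ j, ∑ l, θ j * θ l * |0 + (s j + x) - (s l + x)| ^ (2 * H) := by
    intro x
    unfold Tf
    refine Finset.sum_congr rfl fun j _ => Finset.sum_congr rfl fun l _ => ?_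
    congr 3; ring
  simp only [Rf, Fintype.sum_sum_type, Sum.elim_inl, Sum.elim_inr, mul_neg, neg_mul, neg_neg,
    Finset.sum_add_distrib, Finset.sum_neg_distrib]
  rw [← e3, ← e3, ← e1, ← e2]
  ring

lemma avg_pair_small (φ : ℕ → ℝ) (h0 : ∀ k, 0 ≤ φ k) (h : Tendsto φ atTop (𝓝 0)) {ε : ℝ} (hε : 0 < ε) :
    ∃ M : ℕ, 0 < M ∧ (1 / (M:ℝ) ^ 2) * ∑ h ∈ Finset.range M, ∑ h' ∈ Finset.range M, φ ((h:ℤ) - h').natAbs < ε := by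
  have h1 := h.cesaro
  have h2 := (h1.eventually_lt_const (show (0:ℝ) < ε / 2 by positivity)).and (eventually_gt_atTop 0)
  obtain ⟨M, hM, hM0⟩ := h2.exists
  refine ⟨M, hM0, ?_⟩
  have hM' : (0:ℝ) < M := by exact_mod_cast hM0
  calc (1 / (M:ℝ) ^ 2) * ∑ h ∈ Finset.range M, ∑ h' ∈ Finset.range M, φ ((h:ℤ) - h').natAbs
      ≤ (1 / (M:ℝ) ^ 2) * ∑ h ∈ Finset.range M, (2 * ∑ m ∈ Finset.range M, φ m) := by
        gcongr with h hh
        exact sum_dist_le φ h0 (Finset.mem_range.1 hh)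
    _ = 2 * ((M:ℝ)⁻¹ * ∑ m ∈ Finset.range M, φ m) := by
        simp only [Finset.sum_const, Finset.card_range, nsmul_eq_mul]; field_simp
    _ < ε := by linarith

section
variable {Ω β : Type*} [Countable β] [MeasurableSpace Ω] {P : Measure Ω} [IsProbabilityMeasure P] {H a : ℝ}
  {X : β → ℝ → Ω → ℝ} {N : β → ℕ}

lemma FBSeq.N_tendsto (hX : FBSeq H a P X N) : Tendsto (fun b => (N b : ℝ)) cofinite atTop := by
  obtain ⟨r, hr⟩ := hX.summ
  have h0 := hr.tendsto_cofinite_zero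
  rw [tendsto_atTop]
  intro K
  by_cases hr0 : r ≤ 0
  · have := h0.eventually_lt_const (show (0:ℝ) < 1 by norm_num)
    filter_upwards [this] with b hb
    have h1 : (1:ℝ) ≤ N b := by exact_mod_cast hX.pos b
    exact absurd (Real.one_le_rpow h1 (by linarith : 0 ≤ -r)) (by linarith)
  · push Not at hr0
    have hK : (0:ℝ) < (max K 1) ^ (-r) := Real.rpow_pos_of_pos (by positivity) _
    filter_upwards [h0.eventually_lt_const hK] with b hb
    by_contra hc
    push Not at hc
    have h1 : (0:ℝ) < N b := by exact_mod_cast hX.pos b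
    have := Real.rpow_le_rpow_of_nonpos h1 (hc.le.trans (le_max_left K 1)) (by linarith : -r ≤ 0)
    linarith

lemma FBSeq.avg_ph (hX : FBSeq H a P X N) (hH : H ∈ Ioo (0:ℝ) 1) {ι : Type} [Fintype ι] (θ s : ι → ℝ)
    (hθ : ∑ j, θ j ≠ 0) :
    ∀ᵐ ω ∂P, Tendsto (fun b => ‖∑ i ∈ Finset.range (N b), ph (∑ j, θ j * X b (i + s j) ω)‖ / N b) cofinite (𝓝 0) := by
  by_cases hβ : Nonempty β
  swap
  · refine ae_of_all _ fun ω => ?_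
    have : IsEmpty β := not_nonempty_iff.1 hβ
    have : (cofinite : Filter β) = ⊥ := Filter.filter_eq_bot_of_isEmpty _
    rw [this]; exact tendsto_bot
  obtain ⟨b0⟩ := hβ
  have ha := (hX.fb b0).pos
  set φ : ℕ → ℝ := fun k => Real.exp (-(a * (Tf H θ s k - Tf H θ s 0)).toNNReal / 2) with hφ
  have hφ0 : Tendsto φ atTop (𝓝 0) := by
    refine Real.tendsto_exp_atBot.comp ?_
    have h1 : Tendsto (fun k : ℕ => a * (Tf H θ s k - Tf H θ s 0)) atTop atTop :=
      Tendsto.const_mul_atTop ha (tendsto_atTop_add_const_right _ _ (Tf_tendsto hH.1 θ s hθ))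
    have h2 : Tendsto (fun k : ℕ => ((a * (Tf H θ s k - Tf H θ s 0)).toNNReal : ℝ)) atTop atTop :=
      tendsto_atTop_mono (fun k => Real.le_coe_toNNReal _) h1
    have h3 := Tendsto.atTop_div_const (show (0:ℝ) < 2 by norm_num) h2
    refine (tendsto_neg_atTop_atBot.comp h3).congr fun k => ?_
    simp only [Function.comp]; ring
  have hpair : ∀ᵐ ω ∂P, ∀ h h' : ℕ, Tendsto (fun b => (∑ i ∈ Finset.range (N b),
      Real.cos (∑ j, θ j * X b (((i + h : ℕ) : ℝ) + s j) ω - ∑ j, θ j * X b (((i + h' : ℕ) : ℝ) + s j) ω)) / N b) cofinite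
      (𝓝 (φ ((h:ℤ) - h').natAbs)) := by
    rw [ae_all_iff]; intro h
    rw [ae_all_iff]; intro h'
    have := hX.avg_cos hH (Sum.elim θ (fun j => -θ j)) (Sum.elim (fun j => s j + h) (fun j => s j + h')) (by simp)
    filter_upwards [this] with ω hω
    have e : Rf H a (Sum.elim θ (fun j => -θ j)) (Sum.elim (fun j => s j + h) (fun j => s j + h')) 0 =
       a * (Tf H θ s (((h:ℤ) - h').natAbs : ℕ) - Tf H θ s 0) := by
      rw [Rf_pair]
      congr 2
      have h3 : ((h:ℝ) - h') = (((h:ℤ) - h' : ℤ) : ℝ) := by push_cast; ring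
      rw [h3]
      rcases Int.natAbs_eq ((h:ℤ) - h') with h | h
      · conv_lhs => rw [h]
        simp
      · conv_lhs => rw [h]
        rw [Int.cast_neg, Tf_neg]; simp
    rw [e] at hω
    refine hω.congr fun b => ?_
    congr 1
    refine Finset.sum_congr rfl fun i _ => ?_
    rw [Fintype.sum_sum_type]
    congr 1
    simp only [Sum.elim_inl, Sum.elim_inr, neg_mul, Finset.sum_neg_distrib, Nat.cast_add, ← sub_eq_add_neg]
    congr 1 <;> refine Finset.sum_congr rfl fun j _ => ?_
    · rw [add_assoc, add_comm (h:ℝ)]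
    · rw [add_assoc, add_comm (h':ℝ)]
  filter_upwards [hpair] with ω hω
  rw [Metric.tendsto_nhds]
  intro ε hε
  obtain ⟨M, hM, hMε⟩ := avg_pair_small φ (fun k => (Real.exp_pos _).le) hφ0 (show 0 < ε ^ 2 / 8 by positivity)
  have hlim : Tendsto (fun b => 2 * ((1 / (M:ℝ) ^ 2) * ∑ h ∈ Finset.range M, ∑ h' ∈ Finset.range M,
        (∑ i ∈ Finset.range (N b), Real.cos (∑ j, θ j * X b (((i + h : ℕ) : ℝ) + s j) ω - ∑ j, θ j * X b (((i + h' : ℕ) : ℝ) + s j) ω)) / N b)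
         + 2 * (2 * M / N b) ^ 2) cofinite
      (𝓝 (2 * ((1 / (M:ℝ) ^ 2) * ∑ h ∈ Finset.range M, ∑ h' ∈ Finset.range M, φ ((h:ℤ) - h').natAbs) + 2 * 0 ^ 2)) := by
    refine Tendsto.add (Tendsto.const_mul _ (Tendsto.const_mul _ ?_)) (Tendsto.const_mul _ (Tendsto.pow ?_ 2))
    · exact tendsto_finsetSum _ fun h _ => tendsto_finsetSum _ fun h' _ => hω h h'
    · exact Tendsto.const_div_atTop hX.N_tendsto _
  have hlt := hlim.eventually_lt_const (u := ε ^ 2) (by nlinarith)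
  filter_upwards [hlt] with b hb
  have := vdc (fun i => ∑ j, θ j * X b ((i:ℝ) + s j) ω) (N b) M (hX.pos b) hM
  have h2 := this.trans_lt hb
  rw [Real.dist_eq, sub_zero, abs_of_nonneg (by positivity)]
  exact lt_of_pow_lt_pow_left₀ 2 hε.le h2
end
end

noncomputable section

instance ucProb : IsProbabilityMeasure (volume : Measure (AddCircle (1:ℝ))) := ⟨by simp⟩

lemma ph_cont : Continuous ph := by unfold ph; fun_prop
lemma ph_neg (x : ℝ) : ph (-x) = star (ph x) := by
  apply Complex.ext <;> simp [ph_re, ph_im]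
lemma ph_zero : ph 0 = 1 := by simp [ph]

open BoundedContinuousFunction in
/-- characters of circle times Euclidean space -/
def chr {ι : Type} [Fintype ι] (m : ℤ) (θ : ι → ℚ) : (AddCircle (1:ℝ) × (ι → ℝ)) →ᵇ ℂ :=
  BoundedContinuousFunction.ofNormedAddCommGroup
    (fun z => fourier m z.1 * ph (∑ j, (θ j : ℝ) * z.2 j))
    (by
      have := ph_cont
      fun_prop) 1 (fun z => by
      rw [norm_mul, norm_ph, mul_one, fourier_apply]
      exact (Circle.norm_coe _).le)

lemma chr_apply {ι : Type} [Fintype ι] (m : ℤ) (θ : ι → ℚ) (z : AddCircle (1:ℝ) × (ι → ℝ)) :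
    chr m θ z = fourier m z.1 * ph (∑ j, (θ j : ℝ) * z.2 j) := rfl

lemma sep_real {x y : ℝ} (h : x ≠ y) : ∃ r : ℚ, ph (r * x) ≠ ph (r * y) := by
  obtain ⟨n, hn⟩ := exists_nat_gt |x - y|
  have hn0 : (0:ℝ) < n := lt_of_le_of_lt (abs_nonneg _) hn
  refine ⟨1 / n, fun he => ?_⟩
  have h1 : ph ((1 / n : ℚ) * x - (1 / n : ℚ) * y) = 1 := by
    rw [sub_eq_add_neg, ph_add, he, ← ph_add]
    simp [ph]
  have h2 : Real.cos ((1 / n : ℚ) * x - (1 / n : ℚ) * y) = 1 := by rw [← ph_re, h1]; simp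
  have h3 : |((1 / n : ℚ) : ℝ) * x - (1 / n : ℚ) * y| < 1 := by
    push_cast
    rw [← mul_sub, abs_mul, abs_of_pos (by positivity), one_div, inv_mul_lt_iff₀ hn0]
    simpa using hn
  have h4 := (abs_lt.1 h3)
  have h5 := (Real.cos_eq_one_iff_of_lt_of_lt (by linarith [Real.pi_gt_three]) (by linarith [Real.pi_gt_three])).1 h2
  push_cast at h5
  rw [← mul_sub] at h5
  rcases mul_eq_zero.1 h5 with h6 | h6
  · simp at h6; simp [h6] at hn0
  · exact h (sub_eq_zero.1 h6)

open BoundedContinuousFunction in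
lemma tendsto_of_chr {ι : Type} [Fintype ι] {β : Type*} {F : Filter β}
    (μ : β → ProbabilityMeasure (AddCircle (1:ℝ) × (ι → ℝ))) (μ₀ : ProbabilityMeasure (AddCircle (1:ℝ) × (ι → ℝ)))
    (ht : IsTightMeasureSet {(μ n : Measure (AddCircle (1:ℝ) × (ι → ℝ))) | n})
    (h : ∀ m θ, Tendsto (fun n => ∫ z, chr m θ z ∂(μ n : Measure (AddCircle (1:ℝ) × (ι → ℝ)))) F
      (𝓝 (∫ z, chr m θ z ∂(μ₀ : Measure (AddCircle (1:ℝ) × (ι → ℝ)))))) :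
    Tendsto μ F (𝓝 μ₀) := by
  set S : Set ((AddCircle (1:ℝ) × (ι → ℝ)) →ᵇ ℂ) := {g | ∃ m θ, g = chr m θ} with hS
  refine ProbabilityMeasure.tendsto_of_tight_of_separatesPoints ℂ ht (A := StarAlgebra.adjoin ℂ S) ?_ ?_
  · intro z z' hz
    have : ∃ m θ, chr m θ z ≠ chr m θ z' := by
      by_cases h1 : z.1 = z'.1
      · have h2 : z.2 ≠ z'.2 := fun h2 => hz (Prod.ext h1 h2)
        obtain ⟨j, hj⟩ := Function.ne_iff.1 h2
        obtain ⟨r, hr⟩ := sep_real hj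
        refine ⟨0, Pi.single j r, ?_⟩
        simp only [chr_apply, fourier_zero, one_mul]
        have : ∀ y : ι → ℝ, ∑ i, ((Pi.single j r : ι → ℚ) i : ℝ) * y i = r * y j := fun y => by
          rw [Finset.sum_eq_single j]
          · simp
          · intro b _ hb; simp [Pi.single_eq_of_ne hb]
          · simp
        rw [this, this]
        exact hr
      · refine ⟨1, 0, ?_⟩
        simp only [chr_apply, fourier_one, Pi.zero_apply, Rat.cast_zero, zero_mul, Finset.sum_const_zero, ph_zero, mul_one]
        intro h2
        exact h1 (AddCircle.injective_toCircle one_ne_zero (Subtype.ext h2))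
    obtain ⟨m, θ, hm⟩ := this
    refine ⟨chr m θ, ⟨_, ⟨chr m θ, StarAlgebra.subset_adjoin ℂ S ⟨m, θ, rfl⟩, rfl⟩, rfl⟩, hm⟩
  · intro g hg
    have hg' : g ∈ Submodule.span ℂ (Submonoid.closure (S ∪ star S) : Set ((AddCircle (1:ℝ) × (ι → ℝ)) →ᵇ ℂ)) := by
      rw [← StarAlgebra.adjoin_eq_span]; exact hg
    have hcl : ∀ g ∈ Submonoid.closure (S ∪ star S), g ∈ S := by
      intro g hg
      induction hg using Submonoid.closure_induction with
      | mem x hx =>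
        rcases hx with hx | hx
        · exact hx
        · obtain ⟨m, θ, hm⟩ := hx
          refine ⟨-m, -θ, ?_⟩
          rw [← star_star x, hm]
          ext z
          simp only [BoundedContinuousFunction.star_apply, chr_apply, fourier_neg, Pi.neg_apply, Rat.cast_neg, neg_mul,
            Finset.sum_neg_distrib, ph_neg, star_mul']
          rfl
      | one => exact ⟨0, 0, by ext z; simp [chr_apply, ph_zero]⟩
      | mul x y hx hy h1 h2 =>
        obtain ⟨m, θ, rfl⟩ := h1
        obtain ⟨m', θ', rfl⟩ := h2
        refine ⟨m + m', θ + θ', ?_⟩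
        ext z
        simp only [BoundedContinuousFunction.mul_apply, chr_apply, fourier_add, Pi.add_apply, Rat.cast_add, add_mul,
            Finset.sum_add_distrib, ph_add]
        ring
    induction hg' using Submodule.span_induction with
    | mem x hx =>
      obtain ⟨m, θ, rfl⟩ := hcl x hx
      exact h m θ
    | zero => simp [tendsto_const_nhds]
    | add x y hx hy h1 h2 =>
      have h1 := h1 (by rw [← SetLike.mem_coe]; have := hx; rw [← StarAlgebra.adjoin_eq_span] at this; exact this)
      have h2 := h2 (by rw [← SetLike.mem_coe]; have := hy; rw [← StarAlgebra.adjoin_eq_span] at this; exact this)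
      have : ∀ ν : ProbabilityMeasure (AddCircle (1:ℝ) × (ι → ℝ)), ∫ z, (x + y) z ∂(ν : Measure (AddCircle (1:ℝ) × (ι → ℝ))) =
          ∫ z, x z ∂(ν : Measure (AddCircle (1:ℝ) × (ι → ℝ))) + ∫ z, y z ∂(ν : Measure (AddCircle (1:ℝ) × (ι → ℝ))) := fun ν => by
        rw [← integral_add (x.integrable _) (y.integrable _)]
        rfl
      simp only [this]
      exact h1.add h2
    | smul c x hx h1 =>
      have h1 := h1 (by rw [← SetLike.mem_coe]; have := hx; rw [← StarAlgebra.adjoin_eq_span] at this; exact this)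
      have : ∀ ν : ProbabilityMeasure (AddCircle (1:ℝ) × (ι → ℝ)), ∫ z, (c • x) z ∂(ν : Measure (AddCircle (1:ℝ) × (ι → ℝ))) =
          c * ∫ z, x z ∂(ν : Measure (AddCircle (1:ℝ) × (ι → ℝ))) := fun ν => by
        rw [← integral_const_mul]
        rfl
      simp only [this]
      exact h1.const_mul c

def emp {E : Type*} [MeasurableSpace E] (N : ℕ) (p : ℕ → E) : Measure E :=
  (N : ℝ≥0∞)⁻¹ • ∑ i ∈ Finset.range N, Measure.dirac (p i)

lemma emp_prob {E : Type*} [MeasurableSpace E] {N : ℕ} (hN : 0 < N) (p : ℕ → E) : IsProbabilityMeasure (emp N p) := ⟨by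
  simp only [emp, Measure.smul_apply, Measure.finsetSum_apply, measure_univ, smul_eq_mul]
  simp [ENNReal.inv_mul_cancel, hN.ne']⟩

def empP {E : Type*} [MeasurableSpace E] {N : ℕ} (hN : 0 < N) (p : ℕ → E) : ProbabilityMeasure E := ⟨emp N p, emp_prob hN p⟩

lemma emp_apply {E : Type*} [MeasurableSpace E] (N : ℕ) (p : ℕ → E) {s : Set E} (hs : MeasurableSet s) :
    emp N p s = (∑ i ∈ Finset.range N, if p i ∈ s then 1 else 0) / N := by
  simp only [emp, Measure.smul_apply, Measure.finsetSum_apply, smul_eq_mul, Measure.dirac_apply' _ hs, indicator]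
  rw [mul_comm]; rfl

lemma emp_integral {E : Type*} [MeasurableSpace E] [TopologicalSpace E] [BorelSpace E] (N : ℕ) (p : ℕ → E) {f : E → ℂ} (hf : Continuous f) :
    ∫ z, f z ∂(emp N p) = (∑ i ∈ Finset.range N, f (p i)) / N := by
  have hm : StronglyMeasurable f := hf.measurable.stronglyMeasurable
  rw [emp, integral_smul_measure, integral_finsetSum_measure]
  · simp only [integral_dirac' _ _ hm]
    simp [div_eq_inv_mul]
  · intro i _
    exact integrable_dirac' hm (by simp)

lemma int_fourier {m : ℤ} (hm : m ≠ 0) : ∫ x : AddCircle (1:ℝ), fourier m x = 0 := 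
  integral_eq_zero_of_add_right_eq_neg (μ := (volume : Measure (AddCircle (1:ℝ)))) (fourier_add_half_inv_index hm one_pos)

section
variable {Ω β : Type*} [Countable β] [MeasurableSpace Ω] {P : Measure Ω} [IsProbabilityMeasure P] {H a : ℝ}
  {X : β → ℝ → Ω → ℝ} {N : β → ℕ}

/-- sample points -/
def smp {ι : Type} (X : ℝ → Ω → ℝ) (s : ι → ℝ) (x : ℝ) (ω : Ω) (i : ℕ) : AddCircle (1:ℝ) × (ι → ℝ) :=
  (((X i ω + x : ℝ) : AddCircle (1:ℝ)), fun j => X (i + s j) ω - X i ω)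

/-- limit measure -/
def limM {ι : Type} [Fintype ι] (P : Measure Ω) (Y : ℝ → Ω → ℝ) (s : ι → ℝ) : Measure (AddCircle (1:ℝ) × (ι → ℝ)) :=
  (volume : Measure (AddCircle (1:ℝ))).prod (P.map (fun ω j => Y (s j) ω))

lemma FB.map_prob {Y : ℝ → Ω → ℝ} (hY : FB H a P Y) {ι : Type} [Fintype ι] (s : ι → ℝ) :
    IsProbabilityMeasure (P.map (fun ω j => Y (s j) ω)) :=
  Measure.isProbabilityMeasure_map (measurable_pi_lambda _ fun j => hY.meas _).aemeasurable

lemma FB.limM_prob {Y : ℝ → Ω → ℝ} (hY : FB H a P Y) {ι : Type} [Fintype ι] (s : ι → ℝ) :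
    IsProbabilityMeasure (limM P Y s) := by
  have := hY.map_prob s
  unfold limM; infer_instance

/-- limit law as a probability measure -/
def FB.limP {Y : ℝ → Ω → ℝ} (hY : FB H a P Y) {ι : Type} [Fintype ι] (s : ι → ℝ) :
    ProbabilityMeasure (AddCircle (1:ℝ) × (ι → ℝ)) := ⟨limM P Y s, hY.limM_prob s⟩

/-- extended coefficients -/
def oθ {ι : Type} [Fintype ι] (θ : ι → ℝ) (c : ℝ) : Option ι → ℝ := fun o => o.elim (c - ∑ j, θ j) θ
/-- extended times -/
def os {ι : Type} (s : ι → ℝ) : Option ι → ℝ := fun o => o.elim 0 s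

lemma oθ_sum {ι : Type} [Fintype ι] (θ : ι → ℝ) (c : ℝ) : ∑ o, oθ θ c o = c := by
  simp [Fintype.sum_option, oθ]

lemma oθ_comb {ι : Type} [Fintype ι] (θ : ι → ℝ) (c : ℝ) (s : ι → ℝ) (f : ℝ → ℝ) (i : ℝ) :
    ∑ o, oθ θ c o * f (i + os s o) = c * f i + ∑ j, θ j * (f (i + s j) - f i) := by
  simp only [Fintype.sum_option, oθ, os, Option.elim, add_zero, mul_sub, Finset.sum_sub_distrib, ← Finset.sum_mul]
  ring

lemma chr_smp {ι : Type} [Fintype ι] (m : ℤ) (θ : ι → ℚ) (X : ℝ → Ω → ℝ) (s : ι → ℝ) (x : ℝ) (ω : Ω) (i : ℕ) :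
    chr m θ (smp X s x ω i) = ph (2 * Real.pi * m * x) *
      ph (∑ o, oθ (fun j => (θ j : ℝ)) (2 * Real.pi * m) o * X (i + os s o) ω) := by
  rw [oθ_comb (fun j => (θ j : ℝ)) (2 * Real.pi * m) s (fun r => X r ω) i, ph_add, ← mul_assoc, ← ph_add, chr_apply]
  congr 1
  rw [smp, fourier_coe_apply, ph]
  congr 1
  push_cast
  ring

lemma FBSeq.chr_tendsto (hX : FBSeq H a P X N) (hH : H ∈ Ioo (0:ℝ) 1) {Y : ℝ → Ω → ℝ} (hY : FB H a P Y)
    {ι : Type} [Fintype ι] (s : ι → ℝ) (x : β → ℝ) (m : ℤ) (θ : ι → ℚ) :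
    ∀ᵐ ω ∂P, Tendsto (fun b => ∫ z, chr m θ z ∂(emp (N b) (smp (X b) s (x b) ω))) cofinite
      (𝓝 (∫ z, chr m θ z ∂(limM P Y s))) := by
  have := hY.map_prob s
  have e1 : ∀ b ω, ∫ z, chr m θ z ∂(emp (N b) (smp (X b) s (x b) ω)) = ph (2 * Real.pi * m * x b) *
     (∑ i ∈ Finset.range (N b), ph (∑ o, oθ (fun j => (θ j : ℝ)) (2 * Real.pi * m) o * X b (i + os s o) ω)) / N b := fun b ω => by
    rw [emp_integral _ _ (chr m θ).continuous, Finset.mul_sum]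
    simp only [chr_smp]
  have e2 : ∫ z, chr m θ z ∂(limM P Y s) = (∫ x : AddCircle (1:ℝ), fourier m x) *
      ∫ y, ph (∑ j, (θ j : ℝ) * y j) ∂(P.map (fun ω j => Y (s j) ω)) := by
    rw [limM, ← integral_prod_mul]
    rfl
  by_cases hm : m = 0
  · subst hm
    have hz : ∑ o, oθ (fun j => (θ j : ℝ)) (2 * Real.pi * (0:ℤ)) o = 0 := by rw [oθ_sum]; simp
    have hlaw := hY.law hH.1 (oθ (fun j => (θ j : ℝ)) (2 * Real.pi * (0:ℤ))) (os s) hz 0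
    filter_upwards [hX.avg_cos hH _ (os s) hz, hX.avg_sin hH _ (os s) hz] with ω h1 h2
    simp only [e1, e2]
    set v := (Rf H a (oθ (fun j => (θ j : ℝ)) (2 * Real.pi * (0:ℤ))) (os s) 0).toNNReal
    have e3 : ∫ y, ph (∑ j, (θ j : ℝ) * y j) ∂(P.map (fun ω j => Y (s j) ω)) = ∫ y, ph y ∂(gaussianReal 0 v) := by
      rw [← hlaw, integral_map, integral_map]
      · congr 1
        ext ω
        rw [oθ_comb (fun j => (θ j : ℝ)) _ s (fun r => Y r ω) 0]
        simp [hY.zero]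
      · exact (Finset.measurable_fun_sum _ fun j _ => (hY.meas _).const_mul _).aemeasurable
      · exact ph_cont.aestronglyMeasurable
      · exact (measurable_pi_lambda _ fun j => hY.meas _).aemeasurable
      · refine Continuous.aestronglyMeasurable (ph_cont.comp ?_)
        fun_prop
    have hi : Integrable ph (gaussianReal 0 v) := Integrable.of_bound ph_cont.aestronglyMeasurable 1 (ae_of_all _ fun x => (norm_ph x).le)
    have e4 : ∫ y, ph y ∂(gaussianReal 0 v) = ((Real.exp (-v / 2) : ℝ) : ℂ) + ((∫ y, Real.sin y ∂(gaussianReal 0 v) : ℝ) : ℂ) * Complex.I := by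
      have r1 : (∫ y, ph y ∂(gaussianReal 0 v)).re = ∫ y, (ph y).re ∂(gaussianReal 0 v) := (integral_re hi).symm
      have r2 : (∫ y, ph y ∂(gaussianReal 0 v)).im = ∫ y, (ph y).im ∂(gaussianReal 0 v) := (integral_im hi).symm
      rw [← Complex.re_add_im (∫ y, ph y ∂(gaussianReal 0 v)), r1, r2]
      simp only [ph_re, ph_im, integral_cos_gauss]
    rw [e3, e4]
    simp only [fourier_zero, integral_const, probReal_univ, one_smul, one_mul, Int.cast_zero, mul_zero, zero_mul, ph_zero]
    have h3 := ((Complex.continuous_ofReal.tendsto _).comp h1).add (((Complex.continuous_ofReal.tendsto _).comp h2).mul_const Complex.I)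
    refine h3.congr fun b => ?_
    simp only [Function.comp]
    push_cast
    rw [div_mul_eq_mul_div, ← add_div, Finset.sum_mul, ← Finset.sum_add_distrib]
    congr 1
    refine Finset.sum_congr rfl fun i _ => ?_
    simp only [Int.cast_zero, mul_zero]
    rw [ph, Complex.exp_mul_I]
    push_cast
    rfl
  · have hz : ∑ o, oθ (fun j => (θ j : ℝ)) (2 * Real.pi * m) o ≠ 0 := by
      rw [oθ_sum]; simp [hm, Real.pi_ne_zero]
    filter_upwards [hX.avg_ph hH _ (os s) hz] with ω h1
    rw [e2, int_fourier hm, zero_mul, tendsto_zero_iff_norm_tendsto_zero]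
    refine h1.congr fun b => ?_
    rw [e1, norm_div, norm_mul, norm_ph, one_mul]
    simp

lemma FBSeq.tight (hX : FBSeq H a P X N) (hH : H ∈ Ioo (0:ℝ) 1) 
    {ι : Type} [Fintype ι] (s : ι → ℝ) (x : β → ℝ) :
    ∀ᵐ ω ∂P, IsTightMeasureSet {ν | ∃ b, emp (N b) (smp (X b) s (x b) ω) = ν} := by
  have key : ∀ j : ι, ∀ᵐ ω ∂P, ∃ M : ℝ, ∀ b, (∑ i ∈ Finset.range (N b), (X b (i + s j) ω - X b i ω) ^ 2) / N b ≤ M := fun j => by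
    have := hX.avg_pow hH (ι := Bool) (fun o => if o then 1 else -1) (fun o => if o then s j else 0) (by simp) 2
    filter_upwards [this] with ω ⟨M, hM⟩
    refine ⟨M, fun b => le_trans (le_of_eq ?_) (hM b)⟩
    simp [sub_eq_add_neg]
  rw [← ae_all_iff] at key
  filter_upwards [key] with ω hω
  choose M hM using hω
  rw [isTightMeasureSet_iff_exists_isCompact_measure_compl_le]
  intro ε hε
  obtain ⟨R, hR0, hR⟩ : ∃ R : ℝ, 0 < R ∧ ENNReal.ofReal ((∑ j, |M j|) / R ^ 2) ≤ ε := by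
    have h1 : Tendsto (fun R : ℝ => ENNReal.ofReal ((∑ j, |M j|) / R ^ 2)) atTop (𝓝 0) := by
      rw [← ENNReal.ofReal_zero]
      exact ENNReal.tendsto_ofReal (tendsto_const_nhds.div_atTop (tendsto_pow_atTop two_ne_zero))
    obtain ⟨R, h2, h3⟩ := ((eventually_gt_atTop 0).and (h1.eventually (ge_mem_nhds hε))).exists
    exact ⟨R, h2, h3⟩
  have hK : IsCompact ((univ : Set (AddCircle (1:ℝ))) ×ˢ (pi univ fun _ : ι => Icc (-R) R)) :=
    isCompact_univ.prod (isCompact_univ_pi fun _ => isCompact_Icc)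
  refine ⟨_, hK, ?_⟩
  rintro _ ⟨b, rfl⟩
  refine le_trans ?_ hR
  rw [emp_apply _ _ hK.isClosed.isOpen_compl.measurableSet]
  have hN : (0:ℝ) < N b := by exact_mod_cast hX.pos b
  have h1 : ∀ i : ℕ, (if smp (X b) s (x b) ω i ∈ ((univ : Set (AddCircle (1:ℝ))) ×ˢ (pi univ fun _ : ι => Icc (-R) R))ᶜ then (1:ℝ≥0∞) else 0) ≤
      ENNReal.ofReal ((∑ j, (X b (i + s j) ω - X b i ω) ^ 2) / R ^ 2) := fun i => by
    split_ifs with h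
    · rw [ENNReal.one_le_ofReal, le_div_iff₀ (by positivity), one_mul]
      have : ∃ j, ¬ (X b (i + s j) ω - X b i ω ∈ Icc (-R) R) := by
        by_contra hc
        push Not at hc
        exact h ⟨mem_univ _, fun j _ => hc j⟩
      obtain ⟨j, hj⟩ := this
      refine le_trans ?_ (Finset.single_le_sum (f := fun j => (X b (i + s j) ω - X b i ω) ^ 2) (fun j _ => sq_nonneg _) (Finset.mem_univ j))
      rw [mem_Icc, ← abs_le, not_le] at hj
      rw [← sq_abs (X b (i + s j) ω - X b i ω)]
      exact pow_le_pow_left₀ hR0.le hj.le 2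
    · simp
  refine le_trans (ENNReal.div_le_div_right (Finset.sum_le_sum fun i _ => le_trans (le_of_eq (by congr)) (h1 i)) _) ?_
  rw [← ENNReal.ofReal_sum_of_nonneg (fun i _ => by positivity), ← ENNReal.ofReal_natCast, ← ENNReal.ofReal_div_of_pos hN]
  refine ENNReal.ofReal_le_ofReal ?_
  rw [← Finset.sum_div, div_right_comm, Finset.sum_comm, Finset.sum_div]
  refine div_le_div_of_nonneg_right (Finset.sum_le_sum fun j _ => (hM j b).trans (le_abs_self _)) (by positivity)

lemma FBSeq.weak (hX : FBSeq H a P X N) (hH : H ∈ Ioo (0:ℝ) 1) {Y : ℝ → Ω → ℝ} (hY : FB H a P Y)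
    {ι : Type} [Fintype ι] (s : ι → ℝ) (x : β → ℝ) :
    ∀ᵐ ω ∂P, Tendsto (fun b => empP (hX.pos b) (smp (X b) s (x b) ω)) cofinite
      (𝓝 (hY.limP s)) := by
  have h1 : ∀ᵐ ω ∂P, ∀ m θ, Tendsto (fun b => ∫ z, chr m θ z ∂(emp (N b) (smp (X b) s (x b) ω))) cofinite
      (𝓝 (∫ z, chr m θ z ∂(limM P Y s))) := by
    rw [ae_all_iff]; intro m; rw [ae_all_iff]; intro θ
    exact hX.chr_tendsto hH hY s x m θ
  filter_upwards [h1, hX.tight hH s x] with ω h2 h3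
  exact tendsto_of_chr _ _ h3 h2
end
end

noncomputable section

lemma LP_congr {S : Set ℝ} {w w' : ℝ → ℝ} (h : ∀ r ∈ S, w r = w' r) {m : ℕ} : LP S w m ↔ LP S w' m := by
  constructor
  · rintro ⟨F, hF, h1, h2⟩
    exact ⟨F, hF, fun p hp => by
      have := h1 p hp
      rw [← h _ this.1, ← h _ this.2.1]; exact this, h2⟩
  · rintro ⟨F, hF, h1, h2⟩
    exact ⟨F, hF, fun p hp => by
      have := h1 p hp
      rw [h _ this.1, h _ this.2.1]; exact this, h2⟩

lemma MP_congr {S : Set ℝ} {w w' : ℝ → ℝ} (h : ∀ r ∈ S, w r = w' r) {δ : ℝ} {m : ℕ} : MP S w δ m ↔ MP S w' δ m := by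
  constructor
  · rintro ⟨F, hF, h1, h2⟩
    exact ⟨F, hF, fun p hp => by
      have := h1 p hp
      rw [← h _ this.1, ← h _ this.2.1]; exact this, h2⟩
  · rintro ⟨F, hF, h1, h2⟩
    exact ⟨F, hF, fun p hp => by
      have := h1 p hp
      rw [h _ this.1, h _ this.2.1]; exact this, h2⟩

lemma LP_open {Z : Type*} [TopologicalSpace Z] {w : Z → ℝ → ℝ} (hw : ∀ r, Continuous fun z => w z r) (S : Set ℝ) (m : ℕ) :
    IsOpen {z | LP S (w z) m} := by
  rw [isOpen_iff_mem_nhds]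
  rintro z ⟨F, hF, h1, h2⟩
  have : ∀ p ∈ F, ∀ᶠ z' in 𝓝 z, scrs p.2.2 (w z' p.1) (w z' p.2.1) := by
    intro p hp
    have hp := (h1 p hp).2.2.2
    rcases hp with ⟨a, b⟩ | ⟨a, b⟩
    · filter_upwards [(hw p.1).continuousAt.eventually_lt_const a, (hw p.2.1).continuousAt.eventually_const_lt b] with z' h h'
      exact Or.inl ⟨h, h'⟩
    · filter_upwards [(hw p.1).continuousAt.eventually_const_lt a, (hw p.2.1).continuousAt.eventually_lt_const b] with z' h h'
      exact Or.inr ⟨h, h'⟩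
  have := (Filter.eventually_all_finset F).2 this
  filter_upwards [this] with z' hz'
  exact ⟨F, hF, fun p hp => ⟨(h1 p hp).1, (h1 p hp).2.1, (h1 p hp).2.2.1, hz' p hp⟩, h2⟩

lemma crs_closed (δ : ℝ) : IsClosed {z : ℝ × ℝ | ∃ k : ℤ, crs δ k z.1 z.2} := by
  have e : {z : ℝ × ℝ | ∃ k : ℤ, crs δ k z.1 z.2} = ⋃ k : ℤ, {z : ℝ × ℝ | crs δ k z.1 z.2} := by
    ext z; simp
  rw [e]
  apply LocallyFinite.isClosed_iUnion
  · intro z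
    refine ⟨Metric.ball z 1, Metric.ball_mem_nhds _ one_pos, ?_⟩
    refine (Set.finite_Icc (-⌈|z.1| + |z.2| + |δ| + 3⌉) ⌈|z.1| + |z.2| + |δ| + 3⌉).subset ?_
    rintro k ⟨y, hy, hyz⟩
    have h1 : |y.1 - z.1| < 1 ∧ |y.2 - z.2| < 1 := by
      rw [Metric.mem_ball, Prod.dist_eq, max_lt_iff, Real.dist_eq, Real.dist_eq] at hyz
      exact hyz
    have a1 := abs_lt.1 h1.1
    have a2 := abs_lt.1 h1.2
    have b1 := abs_le.1 (le_refl |z.1|)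
    have b2 := abs_le.1 (le_refl |z.2|)
    have b3 := abs_le.1 (le_refl |δ|)
    have c := Int.le_ceil (|z.1| + |z.2| + |δ| + 3)
    have d1 := abs_nonneg z.1
    have d2 := abs_nonneg z.2
    have hy : crs δ k y.1 y.2 := hy
    have : -(⌈|z.1| + |z.2| + |δ| + 3⌉ : ℝ) ≤ k ∧ (k:ℝ) ≤ ⌈|z.1| + |z.2| + |δ| + 3⌉ := by
      rcases hy with ⟨u, v⟩ | ⟨u, v⟩ <;> constructor <;> linarith
    exact ⟨by exact_mod_cast this.1, by exact_mod_cast this.2⟩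
  · intro k
    simp only [crs]
    refine IsClosed.union ?_ ?_
    · exact (isClosed_le continuous_fst continuous_const).inter (isClosed_le continuous_const continuous_snd)
    · exact (isClosed_le continuous_const continuous_fst).inter (isClosed_le continuous_snd continuous_const)

lemma MP_closed {Z : Type*} [TopologicalSpace Z] {w : Z → ℝ → ℝ} (hw : ∀ r, Continuous fun z => w z r) {S : Set ℝ}
    (hS : S.Finite) (δ : ℝ) (m : ℕ) : IsClosed {z | MP S (w z) δ m} := by
  set I : Set (Finset (ℝ × ℝ)) := {F | F.card = m ∧ (∀ p ∈ F, p.1 ∈ S ∧ p.2 ∈ S ∧ p.1 < p.2) ∧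
    ∀ p ∈ F, ∀ p' ∈ F, p ≠ p' → p.2 ≤ p'.1 ∨ p'.2 ≤ p.1} with hI
  have hIf : I.Finite := by
    refine (Finset.finite_toSet ((hS.prod hS).toFinset.powerset)).subset ?_
    rintro F ⟨-, h, -⟩
    simp only [Finset.mem_coe, Finset.mem_powerset]
    intro p hp
    simpa using ⟨(h p hp).1, (h p hp).2.1⟩
  have e : {z | MP S (w z) δ m} = ⋃ F ∈ I, ⋂ p ∈ F, {z | ∃ k : ℤ, crs δ k (w z p.1) (w z p.2)} := by
    ext z
    simp only [mem_iUnion, mem_iInter]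
    constructor
    · rintro ⟨F, h1, h2, h3⟩
      exact ⟨F, ⟨h1, fun p hp => ⟨(h2 p hp).1, (h2 p hp).2.1, (h2 p hp).2.2.1⟩, h3⟩, fun p hp => (h2 p hp).2.2.2⟩
    · rintro ⟨F, ⟨h1, h2, h3⟩, h4⟩
      exact ⟨F, h1, fun p hp => ⟨(h2 p hp).1, (h2 p hp).2.1, (h2 p hp).2.2, h4 p hp⟩, h3⟩
  rw [e]
  refine hIf.isClosed_biUnion fun F _ => isClosed_biInter fun p _ => ?_
  exact (crs_closed δ).preimage ((hw p.1).prodMk (hw p.2))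

lemma Dy_finite (J : ℕ) : (Dy J).Finite := by
  refine ((Set.finite_Iic (2 ^ J)).image (fun l : ℕ => (l:ℝ) / 2 ^ J)).subset ?_
  rintro x ⟨l, hl, rfl⟩
  exact ⟨l, hl, rfl⟩

/-- sampling times -/
def sJ (J : ℕ) (l : Fin (2 ^ J + 1)) : ℝ := (l : ℕ) / 2 ^ J
/-- index of a time -/
def ixJ (J : ℕ) (r : ℝ) : Fin (2 ^ J + 1) := ⟨min ⌊r * 2 ^ J⌋₊ (2 ^ J), by have := min_le_right ⌊r * 2 ^ J⌋₊ (2 ^ J); omega⟩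
/-- step path from samples -/
def pth (J : ℕ) (z : ℝ × (Fin (2 ^ J + 1) → ℝ)) (r : ℝ) : ℝ := z.1 + z.2 (ixJ J r)

lemma sJ_ix {J : ℕ} {r : ℝ} (hr : r ∈ Dy J) : sJ J (ixJ J r) = r := by
  obtain ⟨l, hl, rfl⟩ := hr
  simp only [sJ, ixJ]
  rw [div_mul_cancel₀ _ (by positivity), Nat.floor_natCast, min_eq_left hl]

lemma pth_cont (J : ℕ) (r : ℝ) : Continuous fun z => pth J z r := by
  unfold pth; fun_prop

/-- quotient map -/
def qm (J : ℕ) : ℝ × (Fin (2 ^ J + 1) → ℝ) → AddCircle (1:ℝ) × (Fin (2 ^ J + 1) → ℝ) := fun z => ((z.1 : AddCircle (1:ℝ)), z.2)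

lemma qm_open (J : ℕ) : IsOpenMap (qm J) := 
  (QuotientAddGroup.isOpenMap_coe).prodMap IsOpenMap.id

lemma qm_surj (J : ℕ) : Function.Surjective (qm J) := by
  rintro ⟨x, y⟩
  obtain ⟨v, rfl⟩ := QuotientAddGroup.mk_surjective x
  exact ⟨(v, y), rfl⟩

/-- lower sets -/
def UL (J m : ℕ) : Set (AddCircle (1:ℝ) × (Fin (2 ^ J + 1) → ℝ)) := qm J '' {z | LP (Dy J) (pth J z) m}
/-- upper sets -/
def UM (J : ℕ) (δ : ℝ) (m : ℕ) : Set (AddCircle (1:ℝ) × (Fin (2 ^ J + 1) → ℝ)) := qm J '' {z | MP (Dy J) (pth J z) δ m}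

lemma qm_eq {J : ℕ} {z z' : ℝ × (Fin (2 ^ J + 1) → ℝ)} (h : qm J z = qm J z') : ∃ k : ℤ, pth J z' = fun r => pth J z r + k := by
  have h1 : ((z.1 : ℝ) : AddCircle (1:ℝ)) = ((z'.1 : ℝ) : AddCircle (1:ℝ)) := (Prod.ext_iff.1 h).1
  have h2 : z.2 = z'.2 := (Prod.ext_iff.1 h).2
  obtain ⟨k, hk⟩ := AddSubgroup.mem_zmultiples_iff.1 ((QuotientAddGroup.eq).1 h1)
  refine ⟨k, ?_⟩
  ext r
  simp only [pth, h2]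
  have : (k:ℝ) = -z.1 + z'.1 := by rw [← hk]; simp
  rw [this]; ring

lemma mem_UL {J m : ℕ} {z} : qm J z ∈ UL J m ↔ LP (Dy J) (pth J z) m := by
  refine ⟨?_, fun h => ⟨z, h, rfl⟩⟩
  rintro ⟨z', h, h'⟩
  obtain ⟨k, hk⟩ := qm_eq h'
  rw [hk]
  exact LP_shift k h

lemma mem_UM {J m : ℕ} {δ : ℝ} {z} : qm J z ∈ UM J δ m ↔ MP (Dy J) (pth J z) δ m := by
  refine ⟨?_, fun h => ⟨z, h, rfl⟩⟩
  rintro ⟨z', h, h'⟩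
  obtain ⟨k, hk⟩ := qm_eq h'
  rw [hk]
  exact MP_shift k h

lemma UL_open (J m : ℕ) : IsOpen (UL J m) := qm_open J _ (LP_open (pth_cont J) _ _)

lemma UM_closed (J : ℕ) (δ : ℝ) (m : ℕ) : IsClosed (UM J δ m) := by
  have : (UM J δ m)ᶜ = qm J '' {z | MP (Dy J) (pth J z) δ m}ᶜ := by
    ext x
    obtain ⟨z, rfl⟩ := qm_surj J x
    rw [mem_compl_iff, mem_UM]
    constructor
    · intro h
      exact ⟨z, h, rfl⟩
    · rintro ⟨z', h, h'⟩ h2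
      rw [← mem_UM, ← h', mem_UM] at h2
      exact h h2
  rw [← isOpen_compl_iff, this]
  exact qm_open J _ (MP_closed (pth_cont J) (Dy_finite J) δ m).isOpen_compl

/-- lower functional -/
def fl (J : ℕ) (z : AddCircle (1:ℝ) × (Fin (2 ^ J + 1) → ℝ)) : ℝ≥0∞ := ∑ m ∈ Finset.Icc 1 J, (UL J m).indicator 1 z
/-- upper functional -/
def fu (J : ℕ) (δ : ℝ) (z : AddCircle (1:ℝ) × (Fin (2 ^ J + 1) → ℝ)) : ℝ≥0∞ := ∑ m ∈ Finset.Icc 1 (2 ^ J), (UM J δ m).indicator 1 z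

lemma fl_meas (J : ℕ) : Measurable (fl J) := 
  Finset.measurable_fun_sum _ fun m _ => measurable_one.indicator (UL_open J m).measurableSet
lemma fu_meas (J : ℕ) (δ : ℝ) : Measurable (fu J δ) := 
  Finset.measurable_fun_sum _ fun m _ => measurable_one.indicator (UM_closed J δ m).measurableSet

lemma sum_ind_cnt {E : Type*} (U : ℕ → Set E) (Q : ℕ → Prop) (z : E) (M : ℕ) (h : ∀ m, z ∈ U m ↔ Q m) :
    ∑ m ∈ Finset.Icc 1 M, (U m).indicator (1 : E → ℝ≥0∞) z = (cnt Q M : ℝ≥0∞) := by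
  simp only [indicator, h, Pi.one_apply, cnt]
  rw [Finset.sum_ite]
  simp

lemma fl_eq {J : ℕ} {v : ℝ} {y : Fin (2 ^ J + 1) → ℝ} {w : ℝ → ℝ} (h : ∀ l, w (sJ J l) = v + y l) :
    fl J ((v : AddCircle (1:ℝ)), y) = (cnt (LP (Dy J) w) J : ℝ≥0∞) := by
  refine sum_ind_cnt _ _ _ _ fun m => ?_
  rw [show (((v : AddCircle (1:ℝ)), y) : AddCircle (1:ℝ) × (Fin (2 ^ J + 1) → ℝ)) = qm J (v, y) from rfl, mem_UL]
  refine LP_congr fun r hr => ?_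
  rw [← sJ_ix hr, h, pth, sJ_ix hr]

lemma fu_eq {J : ℕ} {δ : ℝ} {v : ℝ} {y : Fin (2 ^ J + 1) → ℝ} {w : ℝ → ℝ} (h : ∀ l, w (sJ J l) = v + y l) :
    fu J δ ((v : AddCircle (1:ℝ)), y) = (cnt (MP (Dy J) w δ) (2 ^ J) : ℝ≥0∞) := by
  refine sum_ind_cnt _ _ _ _ fun m => ?_
  rw [show (((v : AddCircle (1:ℝ)), y) : AddCircle (1:ℝ) × (Fin (2 ^ J + 1) → ℝ)) = qm J (v, y) from rfl, mem_UM]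
  refine MP_congr fun r hr => ?_
  rw [← sJ_ix hr, h, pth, sJ_ix hr]
end

noncomputable section

lemma emp_sum {E : Type*} [MeasurableSpace E] (N : ℕ) (p : ℕ → E) {U : ℕ → Set E} (hU : ∀ m, MeasurableSet (U m)) (s : Finset ℕ) :
    ∑ m ∈ s, emp N p (U m) = (∑ i ∈ Finset.range N, ∑ m ∈ s, (U m).indicator (1 : E → ℝ≥0∞) (p i)) / N := by
  simp only [emp_apply N p (hU _), div_eq_mul_inv]
  rw [← Finset.sum_mul, Finset.sum_comm]
  rfl

lemma lint_sum_ind {E : Type*} [MeasurableSpace E] (μ : Measure E) {U : ℕ → Set E} (hU : ∀ m, MeasurableSet (U m)) (s : Finset ℕ) :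
    ∫⁻ z, ∑ m ∈ s, (U m).indicator (1 : E → ℝ≥0∞) z ∂μ = ∑ m ∈ s, μ (U m) := by
  rw [lintegral_finsetSum _ fun m _ => measurable_one.indicator (hU m)]
  simp only [lintegral_indicator_one (hU _)]

lemma eps_div (ε : ℝ≥0∞) (hε : 0 < ε) (s : Finset ℕ) : ∃ ε' : ℝ≥0∞, 0 < ε' ∧ ε' ≠ ⊤ ∧ ∑ _m ∈ s, ε' ≤ ε := by
  refine ⟨min ε 1 / (s.card + 1), ?_, ?_, ?_⟩
  · refine ENNReal.div_pos (by simp [hε.ne']) (by finiteness)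
  · exact ENNReal.div_ne_top (ne_top_of_le_ne_top one_ne_top (min_le_right _ _)) (by simp)
  · rw [Finset.sum_const, nsmul_eq_mul]
    calc (s.card : ℝ≥0∞) * (min ε 1 / (s.card + 1)) ≤ (s.card + 1) * (min ε 1 / (s.card + 1)) := by
          gcongr; exact le_self_add
      _ ≤ min ε 1 := ENNReal.mul_div_le
      _ ≤ ε := min_le_left _ _

section
variable {Ω β : Type*} [Countable β] [MeasurableSpace Ω] {P : Measure Ω} [IsProbabilityMeasure P] {H a : ℝ}
  {X : β → ℝ → Ω → ℝ} {N : β → ℕ}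

lemma FBSeq.fl_avg (hX : FBSeq H a P X N) (hH : H ∈ Ioo (0:ℝ) 1) {Y : ℝ → Ω → ℝ} (hY : FB H a P Y) (J : ℕ) (x : β → ℝ) :
    ∀ᵐ ω ∂P, ∀ ε : ℝ≥0∞, 0 < ε → ∀ᶠ b in cofinite, ∫⁻ z, fl J z ∂(limM P Y (sJ J)) ≤
      (∑ i ∈ Finset.range (N b), fl J (smp (X b) (sJ J) (x b) ω i)) / N b + ε := by
  filter_upwards [hX.weak hH hY (sJ J) x] with ω hω ε hε
  obtain ⟨ε', h1, h2, h3⟩ := eps_div ε hε (Finset.Icc 1 J)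
  have key : ∀ m ∈ Finset.Icc 1 J, ∀ᶠ b in cofinite, limM P Y (sJ J) (UL J m) ≤ emp (N b) (smp (X b) (sJ J) (x b) ω) (UL J m) + ε' := by
    intro m _
    have h := ProbabilityMeasure.le_liminf_measure_open_of_tendsto hω (UL_open J m)
    have hp := hY.limM_prob (sJ J)
    by_cases h0 : limM P Y (sJ J) (UL J m) = 0
    · simp [h0]
    · have h4 : limM P Y (sJ J) (UL J m) - ε' < cofinite.liminf fun b => emp (N b) (smp (X b) (sJ J) (x b) ω) (UL J m) := by
        refine lt_of_lt_of_le ?_ h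
        exact ENNReal.sub_lt_self (measure_ne_top _ _) h0 h1.ne'
      filter_upwards [Filter.eventually_lt_of_lt_liminf h4] with b hb
      exact tsub_le_iff_right.1 hb.le
  filter_upwards [(Filter.eventually_all_finset _).2 key] with b hb
  simp only [fl]
  rw [lint_sum_ind _ (fun m => (UL_open J m).measurableSet), ← emp_sum _ _ (fun m => (UL_open J m).measurableSet)]
  calc _ ≤ ∑ m ∈ Finset.Icc 1 J, (emp (N b) (smp (X b) (sJ J) (x b) ω) (UL J m) + ε') := Finset.sum_le_sum hb
    _ ≤ _ := by rw [Finset.sum_add_distrib]; gcongr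

lemma FBSeq.fu_avg (hX : FBSeq H a P X N) (hH : H ∈ Ioo (0:ℝ) 1) {Y : ℝ → Ω → ℝ} (hY : FB H a P Y) (J : ℕ) (δ : ℝ) (x : β → ℝ) :
    ∀ᵐ ω ∂P, ∀ ε : ℝ≥0∞, 0 < ε → ∀ᶠ b in cofinite, 
      (∑ i ∈ Finset.range (N b), fu J δ (smp (X b) (sJ J) (x b) ω i)) / N b ≤ ∫⁻ z, fu J δ z ∂(limM P Y (sJ J)) + ε := by
  filter_upwards [hX.weak hH hY (sJ J) x] with ω hω ε hε
  obtain ⟨ε', h1, h2, h3⟩ := eps_div ε hε (Finset.Icc 1 (2 ^ J))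
  have key : ∀ m ∈ Finset.Icc 1 (2 ^ J), ∀ᶠ b in cofinite, emp (N b) (smp (X b) (sJ J) (x b) ω) (UM J δ m) ≤ limM P Y (sJ J) (UM J δ m) + ε' := by
    intro m _
    have h := ProbabilityMeasure.limsup_measure_closed_le_of_tendsto hω (UM_closed J δ m)
    have hp := hY.limM_prob (sJ J)
    have h4 : (cofinite.limsup fun b => emp (N b) (smp (X b) (sJ J) (x b) ω) (UM J δ m)) < limM P Y (sJ J) (UM J δ m) + ε' := by
      refine lt_of_le_of_lt h ?_
      exact ENNReal.lt_add_right (measure_ne_top _ _) h1.ne'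
    filter_upwards [Filter.eventually_lt_of_limsup_lt h4] with b hb
    exact hb.le
  filter_upwards [(Filter.eventually_all_finset _).2 key] with b hb
  simp only [fu]
  rw [lint_sum_ind _ (fun m => (UM_closed J δ m).measurableSet), ← emp_sum _ _ (fun m => (UM_closed J δ m).measurableSet)]
  calc _ ≤ ∑ m ∈ Finset.Icc 1 (2 ^ J), (limM P Y (sJ J) (UM J δ m) + ε') := Finset.sum_le_sum hb
    _ ≤ _ := by rw [Finset.sum_add_distrib]; gcongr

lemma FB.lint_limM {Y : ℝ → Ω → ℝ} (hY : FB H a P Y) {ι : Type} [Fintype ι] (s : ι → ℝ) {f : AddCircle (1:ℝ) × (ι → ℝ) → ℝ≥0∞} (hf : Measurable f) :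
    ∫⁻ z, f z ∂(limM P Y s) = ∫⁻ ω, (∫⁻ v in Ioc (-(1/2):ℝ) (1/2), f ((v : AddCircle (1:ℝ)), fun j => Y (s j) ω)) ∂P := by
  have := hY.map_prob s
  rw [limM, lintegral_prod_symm _ hf.aemeasurable, lintegral_map hf.lintegral_prod_left' (measurable_pi_lambda _ fun j => hY.meas _)]
  refine lintegral_congr fun ω => ?_
  rw [← UnitAddCircle.lintegral_preimage (-(1/2))]
  norm_num

set_option linter.unusedSectionVars false
/-- the reference mean count over a unit interval -/
def kp (P : Measure Ω) (Y : ℝ → Ω → ℝ) : ℝ≥0∞ := ∫⁻ ω, (∫⁻ v in Ioc (-(1/2):ℝ) (1/2), crossKe 1 (fun r => Y r ω + v) 0 1) ∂P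

lemma le_crossKe_iff {w : ℝ → ℝ} (hw : Continuous w) {t : ℝ} (m : ℕ) : (m : ℝ≥0∞) ≤ crossKe 1 w 0 t ↔ MP (Icc 0 t) w 0 m := by
  have := crossK_iff_MP one_pos hw (t := t) m
  simp only [div_one] at this
  rw [← this, crossKe]
  constructor
  · intro h; exact_mod_cast h
  · intro h; exact_mod_cast h

lemma LP_le_crossKe {w : ℝ → ℝ} (hw : Continuous w) {t : ℝ} {S : Set ℝ} (hS : S ⊆ Icc 0 t) {m : ℕ} (h : LP S w m) : (m : ℝ≥0∞) ≤ crossKe 1 w 0 t := by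
  have := LP_le_crossK one_pos hw hS (m := m) (by simpa using h)
  rw [crossKe]
  exact_mod_cast this

lemma crossKe_le_of {w : ℝ → ℝ} {t : ℝ} {c : ℝ≥0∞} (h : ∀ m : ℕ, (m : ℝ≥0∞) ≤ crossKe 1 w 0 t → (m : ℝ≥0∞) ≤ c) : crossKe 1 w 0 t ≤ c := by
  unfold crossKe at *
  revert h
  generalize crossK 1 w 0 t = K
  intro h
  induction K using ENat.recTopCoe with
  | top =>
    have : c = ⊤ := by
      refine ENNReal.eq_top_of_forall_nnreal_le fun r => ?_
      obtain ⟨n, hn⟩ := exists_nat_ge r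
      refine le_trans ?_ (h n (by simp))
      exact_mod_cast hn
    simp [this]
  | coe n => 
    have := h n (by simp)
    simpa using this

/-- lower functional on paths -/
def gl (Y : ℝ → Ω → ℝ) (J : ℕ) (ω : Ω) (v : ℝ) : ℝ≥0∞ := fl J ((v : AddCircle (1:ℝ)), fun j => Y (sJ J j) ω)
/-- upper functional on paths -/
def gu (Y : ℝ → Ω → ℝ) (J : ℕ) (δ : ℝ) (ω : Ω) (v : ℝ) : ℝ≥0∞ := fu J δ ((v : AddCircle (1:ℝ)), fun j => Y (sJ J j) ω)

lemma gl_eq (Y : ℝ → Ω → ℝ) (J : ℕ) (ω : Ω) (v : ℝ) : gl Y J ω v = (cnt (LP (Dy J) (fun r => Y r ω + v)) J : ℝ≥0∞) :=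
  fl_eq fun _ => add_comm _ _
lemma gu_eq (Y : ℝ → Ω → ℝ) (J : ℕ) (δ : ℝ) (ω : Ω) (v : ℝ) : gu Y J δ ω v = (cnt (MP (Dy J) (fun r => Y r ω + v) δ) (2 ^ J) : ℝ≥0∞) :=
  fu_eq fun _ => add_comm _ _

lemma smp_meas {Y : ℝ → Ω → ℝ} (hY : FB H a P Y) {ι : Type} [Fintype ι] (s : ι → ℝ) :
   Measurable (fun z : Ω × ℝ => ((z.2 : AddCircle (1:ℝ)), fun j => Y (s j) z.1)) := by
  refine Measurable.prodMk ?_ (measurable_pi_lambda _ fun j => (hY.meas _).comp measurable_fst)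
  exact (AddCircle.continuous_mk' 1).measurable.comp measurable_snd

lemma cnt_mono {Q Q' : ℕ → Prop} {M M' : ℕ} (h : ∀ m ∈ Finset.Icc 1 M, Q m → Q' m ∧ m ≤ M') : cnt Q M ≤ cnt Q' M' := by
  refine Finset.card_le_card fun m hm => ?_
  simp only [Finset.mem_filter, Finset.mem_Icc] at hm ⊢
  have := h m (by simpa using hm.1) hm.2
  exact ⟨⟨hm.1.1, this.2⟩, this.1⟩

lemma gl_mono (Y : ℝ → Ω → ℝ) (ω : Ω) (v : ℝ) : Monotone fun J => gl Y J ω v := by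
  intro J J' h
  simp only [gl_eq]
  exact_mod_cast cnt_mono fun m hm h' => ⟨LP_mono_set (Dy_mono h) h', (Finset.mem_Icc.1 hm).2.trans h⟩

lemma gu_mono (Y : ℝ → Ω → ℝ) (ω : Ω) (v δ : ℝ) : Monotone fun J => gu Y J δ ω v := by
  intro J J' h
  simp only [gu_eq]
  exact_mod_cast cnt_mono fun m hm h' => ⟨MP_mono_set (Dy_mono h) h', (Finset.mem_Icc.1 hm).2.trans (Nat.pow_le_pow_right two_pos h)⟩

lemma FB.kp_le {Y : ℝ → Ω → ℝ} (hY : FB H a P Y) : kp P Y ≤ ⨆ J, ∫⁻ z, fl J z ∂(limM P Y (sJ J)) := by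
  have hm : ∀ J, Measurable (fun z : Ω × ℝ => gl Y J z.1 z.2) := fun J => (fl_meas J).comp (smp_meas hY (sJ J))
  have e : ∀ J, ∫⁻ z, fl J z ∂(limM P Y (sJ J)) = ∫⁻ ω, (∫⁻ v in Ioc (-(1/2):ℝ) (1/2), gl Y J ω v) ∂P := fun J => hY.lint_limM (sJ J) (fl_meas J)
  simp only [e]
  rw [← lintegral_iSup (fun J => (hm J).lintegral_prod_right') (fun J J' h ω => lintegral_mono fun v => gl_mono Y ω v h)]
  refine lintegral_mono fun ω => ?_
  have e2 := lintegral_iSup (μ := volume.restrict (Ioc (-(1/2):ℝ) (1/2))) (f := fun J v => gl Y J ω v) (fun J => (hm J).comp measurable_prodMk_left) (fun J J' h v => gl_mono Y ω v h)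
  refine le_trans ?_ e2.le
  refine lintegral_mono_ae (ae_restrict_of_ae ?_)
  have hc : (⋃ k : ℤ, (fun u => (k:ℝ) - u) '' (excep fun r => Y r ω)).Countable :=
    countable_iUnion fun k => (excep_countable _).image _
  filter_upwards [hc.ae_notMem volume] with v hv
  refine crossKe_le_of fun m hm => ?_
  have hcw : Continuous (fun r => Y r ω + v) := (hY.cont ω).add continuous_const
  rw [le_crossKe_iff hcw] at hm
  have hex : ∀ k : ℤ, (k:ℝ) ∉ excep (fun r => Y r ω + v) := fun k hk =>
    hv (mem_iUnion.2 ⟨k, _, excep_shift _ hk, by ring⟩)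
  obtain ⟨J, hJ⟩ := MP_to_LP hcw hex hm
  · refine le_iSup_of_le (max J m) ?_
    rw [gl_eq]
    have := le_cnt (Q := LP (Dy (max J m)) (fun r => Y r ω + v)) (M := max J m) (m := m) (fun _ _ h h' => LP_mono_m h h') (le_max_right _ _) (LP_mono_set (Dy_mono (le_max_left _ _)) hJ)
    exact_mod_cast this

end
end

noncomputable section
section
variable {Ω : Type*} [MeasurableSpace Ω] {P : Measure Ω} [IsProbabilityMeasure P] {H a : ℝ}
  {X : ℕ → ℝ → Ω → ℝ} {N : ℕ → ℕ}

lemma fl_smp (X : ℝ → Ω → ℝ) (J : ℕ) (x : ℝ) (ω : Ω) (i : ℕ) :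
    fl J (smp X (sJ J) x ω i) = (cnt (LP (Dy J) (fun r => X (i + r) ω + x)) J : ℝ≥0∞) :=
  fl_eq fun l => by ring

lemma fu_smp (X : ℝ → Ω → ℝ) (J : ℕ) (δ x : ℝ) (ω : Ω) (i : ℕ) :
    fu J δ (smp X (sJ J) x ω i) = (cnt (MP (Dy J) (fun r => X (i + r) ω + x) δ) (2 ^ J) : ℝ≥0∞) :=
  fu_eq fun l => by ring

lemma FBSeq.lower (hX : FBSeq H a P X N) (hH : H ∈ Ioo (0:ℝ) 1) {Y : ℝ → Ω → ℝ} (hY : FB H a P Y) (x : ℕ → ℝ) :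
    ∀ᵐ ω ∂P, ∀ c : ℝ≥0∞, c < kp P Y → ∀ᶠ n in atTop, c < crossKe 1 (fun r => X n r ω + x n) 0 (N n) / N n := by
  have h1 : ∀ᵐ ω ∂P, ∀ J : ℕ, ∀ ε : ℝ≥0∞, 0 < ε → ∀ᶠ b in cofinite, ∫⁻ z, fl J z ∂(limM P Y (sJ J)) ≤
      (∑ i ∈ Finset.range (N b), fl J (smp (X b) (sJ J) (x b) ω i)) / N b + ε :=
    ae_all_iff.2 fun J => hX.fl_avg hH hY J x
  filter_upwards [h1] with ω hω c hc
  obtain ⟨J, hJ⟩ := lt_iSup_iff.1 (hc.trans_le hY.kp_le)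
  obtain ⟨c', h2, h3⟩ := exists_between hJ
  have h4 : 0 < c' - c := tsub_pos_of_lt h2
  have hω' := hω J (c' - c) h4
  rw [Nat.cofinite_eq_atTop] at hω'
  filter_upwards [hω'] with n hn
  have h5 : (∑ i ∈ Finset.range (N n), fl J (smp (X n) (sJ J) (x n) ω i)) ≤ crossKe 1 (fun r => X n r ω + x n) 0 (N n) := by
    simp only [fl_smp]
    have hcw : Continuous (fun r => X n r ω + x n) := ((hX.fb n).cont ω).add continuous_const
    have := LP_blocks (w := fun r => X n r ω + x n) (N := N n) (m := fun i => cnt (LP (Dy J) (fun r => X n (i + r) ω + x n)) J)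
      fun i _ => LP_mono_set (Dy_sub J) (cnt_spec (Q := LP (Dy J) (fun r => X n (i + r) ω + x n)) (LP_zero _ _) (fun _ _ h h' => LP_mono_m h h') J)
    have := LP_le_crossKe hcw subset_rfl this
    exact_mod_cast this
  by_contra! h6
  have : c' < c + (c' - c) := h3.trans_le (hn.trans (by
    gcongr
    exact le_trans (ENNReal.div_le_div_right h5 _) h6))
  rw [add_tsub_cancel_of_le h2.le] at this
  exact this.false

end
end

noncomputable section

/-- chaining base -/
def xb (H : ℝ) : ℝ := (2:ℝ) ^ (-(H/2))
/-- chaining widths -/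
def dlf (H δ : ℝ) (j : ℕ) : ℝ := δ * (1 - xb H) * xb H ^ j
/-- scale factors -/
def sc (H : ℝ) (j : ℕ) : ℝ := ((2:ℝ) ^ H) ^ j

lemma xb_pos (H : ℝ) : 0 < xb H := Real.rpow_pos_of_pos two_pos _
lemma xb_lt {H : ℝ} (hH : 0 < H) : xb H < 1 := Real.rpow_lt_one_of_one_lt_of_neg one_lt_two (by linarith)
lemma sc_pos (H : ℝ) (j : ℕ) : 0 < sc H j := pow_pos (Real.rpow_pos_of_pos two_pos _) _
lemma dlf_pos {H δ : ℝ} (hH : 0 < H) (hδ : 0 < δ) (j : ℕ) : 0 < dlf H δ j :=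
  mul_pos (mul_pos hδ (by linarith [xb_lt hH])) (pow_pos (xb_pos H) _)

lemma dlf_sum {H δ : ℝ} (hH : 0 < H) (hδ : 0 < δ) (a n : ℕ) : ∑ i ∈ Finset.range n, dlf H δ (a + 1 + i) ≤ δ := by
  have h1 := xb_pos H
  have h2 := xb_lt hH
  have e : ∑ i ∈ Finset.range n, dlf H δ (a + 1 + i) = δ * xb H ^ (a+1) * (1 - xb H ^ n) := by
    simp only [dlf, pow_add _ (a+1)]
    rw [← mul_neg_geom_sum, Finset.mul_sum, Finset.mul_sum]
    refine Finset.sum_congr rfl fun i _ => by ring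
  rw [e]
  have h3 : xb H ^ (a+1) ≤ 1 := pow_le_one₀ h1.le h2.le
  have h4 : 0 ≤ xb H ^ n := by positivity
  have h5 : xb H ^ n ≤ 1 := pow_le_one₀ h1.le h2.le
  have : xb H ^ (a+1) * (1 - xb H ^ n) ≤ 1 * 1 := mul_le_mul h3 (by linarith) (by linarith) one_pos.le
  nlinarith

/-- level weights -/
def cj (H δ : ℝ) (q j : ℕ) : ℝ := ((sc H j * dlf H δ j) ^ q)⁻¹
lemma cj_nonneg {H δ : ℝ} (hH : 0 < H) (hδ : 0 < δ) (q j : ℕ) : 0 ≤ cj H δ q j :=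
  inv_nonneg.2 (pow_nonneg (mul_pos (sc_pos H j) (dlf_pos hH hδ j)).le _)

lemma term_eq {H δ : ℝ} (hH : 0 < H) (hδ : 0 < δ) {q : ℕ} (hq : Even q) (j : ℕ) (D : ℝ) :
    (|D| / dlf H δ j) ^ q = (sc H j * D) ^ q * cj H δ q j := by
  have h1 := sc_pos H j
  have h2 := dlf_pos hH hδ j
  rw [cj, div_pow, hq.pow_abs, mul_pow, mul_pow]
  field_simp

lemma cj_le {H δ : ℝ} (hH : 0 < H) (hδ : 0 < δ) {q : ℕ} (hqH : 4 ≤ q * H) (j : ℕ) :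
    2 ^ j * cj H δ q j ≤ ((δ * (1 - xb H)) ^ q)⁻¹ * (1/2) ^ j := by
  have h1 := xb_pos H
  have h2 := xb_lt hH
  have hd : 0 < δ * (1 - xb H) := mul_pos hδ (by linarith)
  have e1 : sc H j * dlf H δ j = δ * (1 - xb H) * ((2:ℝ) ^ (H/2)) ^ j := by
    rw [sc, dlf, show (2:ℝ) ^ (H/2) = 2 ^ H * xb H by rw [xb, ← Real.rpow_add two_pos]; congr 1; ring, mul_pow]
    ring
  have e2 : (4:ℝ) ≤ ((2:ℝ) ^ (H/2)) ^ q := by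
    rw [← Real.rpow_natCast, ← Real.rpow_mul two_pos.le]
    calc (4:ℝ) = 2 ^ (2:ℝ) := by norm_num
      _ ≤ _ := Real.rpow_le_rpow_of_exponent_le one_le_two (by linarith)
  rw [cj, e1, mul_pow, mul_inv, ← pow_mul, mul_comm j q, pow_mul]
  have h3 : 2 ^ j * ((((2:ℝ) ^ (H/2)) ^ q) ^ j)⁻¹ ≤ (1/2) ^ j := by
    rw [← inv_pow, ← mul_pow]
    refine pow_le_pow_left₀ (by positivity) ?_ j
    calc 2 * (((2:ℝ) ^ (H/2)) ^ q)⁻¹ ≤ 2 * (4)⁻¹ := by gcongr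
      _ = 1/2 := by norm_num
  calc _ = ((δ * (1 - xb H)) ^ q)⁻¹ * (2 ^ j * ((((2:ℝ) ^ (H/2)) ^ q) ^ j)⁻¹) := by ring
    _ ≤ _ := by gcongr

lemma geo_tail (J : ℕ) (C : ℝ≥0∞) : ∑' j : ℕ, C * ENNReal.ofReal ((1/2) ^ (J + 1 + j)) = C * ENNReal.ofReal ((1/2)^J) := by
  rw [ENNReal.tsum_mul_left]
  congr 1
  rw [← ENNReal.ofReal_tsum_of_nonneg (fun j => by positivity)]
  · congr 1
    simp only [pow_add _ (J+1)]
    rw [tsum_mul_left, tsum_geometric_two]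
    ring
  · simp only [pow_add _ (J+1)]
    exact summable_geometric_two.mul_left _

lemma tail_le {H δ : ℝ} (hH : 0 < H) (hδ : 0 < δ) {q : ℕ} (hq : Even q) (hqH : 4 ≤ q * H) {N : ℕ} (hN : 0 < N) (J : ℕ) {w : ℝ → ℝ}
    {M : ℝ} (hM : 0 ≤ M) (h : ∀ j : ℕ, (∑ l ∈ Finset.range (N * 2 ^ j), (sc H j * (w (((l:ℝ) + 1) / 2 ^ j) - w ((l:ℝ) / 2 ^ j))) ^ q) / ((N * 2 ^ j : ℕ):ℝ) ≤ M) :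
    ∑' j : ℕ, ∑ l ∈ Finset.range (N * 2 ^ (J + 1 + j)),
        ENNReal.ofReal ((|w (((l:ℝ) + 1) / 2 ^ (J + 1 + j)) - w ((l:ℝ) / 2 ^ (J + 1 + j))|
          / dlf H δ (J + 1 + j)) ^ q) ≤ N * (ENNReal.ofReal (M * ((δ * (1 - xb H)) ^ q)⁻¹) * ENNReal.ofReal ((1/2)^J)) := by
  rw [← mul_assoc, ← geo_tail]
  refine ENNReal.tsum_le_tsum fun j => ?_
  set k := J + 1 + j
  have hN' : (0:ℝ) < ((N * 2 ^ k : ℕ):ℝ) := by positivity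
  have h1 := (div_le_iff₀ hN').1 (h k)
  have h2 := cj_nonneg hH hδ q k
  rw [← ENNReal.ofReal_sum_of_nonneg fun l _ => pow_nonneg (div_nonneg (abs_nonneg _) (dlf_pos hH hδ _).le) _,
    ← ENNReal.ofReal_natCast N, ← ENNReal.ofReal_mul (by positivity), ← ENNReal.ofReal_mul (by
      have := xb_lt hH
      have : 0 ≤ 1 - xb H := by linarith
      positivity)]
  refine ENNReal.ofReal_le_ofReal ?_
  simp only [term_eq hH hδ hq]
  rw [← Finset.sum_mul]
  calc _ ≤ M * ((N * 2 ^ k : ℕ):ℝ) * cj H δ q k := by gcongr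
    _ = M * N * (2 ^ k * cj H δ q k) := by push_cast; ring
    _ ≤ M * N * (((δ * (1 - xb H)) ^ q)⁻¹ * (1/2) ^ k) :=
      mul_le_mul_of_nonneg_left (cj_le hH hδ hqH k) (by positivity)
    _ = _ := by ring

section
variable {Ω : Type*} [MeasurableSpace Ω] {P : Measure Ω} {H a : ℝ}

lemma FB.dyad {X : ℝ → Ω → ℝ} (hX : FB H a P X) (j : ℕ) : FB H a P (fun s ω => sc H j * X (s * (1/2^j)) ω) := by
  refine hX.scale (by positivity) (sc_pos H j).ne' ?_
  rw [sc, ← Real.rpow_natCast ((2:ℝ) ^ H) j, ← Real.rpow_mul two_pos.le, ← Real.rpow_natCast _ 2, ← Real.rpow_mul two_pos.le,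
    one_div, ← Real.rpow_natCast 2 j, ← Real.rpow_neg two_pos.le, ← Real.rpow_mul two_pos.le, ← Real.rpow_add two_pos]
  ring_nf
  simp

lemma FBSeq.dyad {X : ℕ → ℝ → Ω → ℝ} {N : ℕ → ℕ} (hX : FBSeq H a P X N) :
    FBSeq H a P (fun b : ℕ × ℕ => fun s ω => sc H b.2 * X b.1 (s * (1/2^b.2)) ω) (fun b => N b.1 * 2 ^ b.2) where
  fb b := (hX.fb b.1).dyad b.2
  pos b := Nat.mul_pos (hX.pos _) (by positivity)
  summ := by
    obtain ⟨r, hr⟩ := hX.summ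
    refine ⟨max r 1, ?_⟩
    have h1 : Summable fun n => (N n : ℝ) ^ (-(max r 1)) := by
      refine Summable.of_nonneg_of_le (fun n => by positivity) (fun n => ?_) hr
      refine Real.rpow_le_rpow_of_exponent_le ?_ (by simp)
      exact_mod_cast hX.pos n
    have h2 : Summable fun j : ℕ => ((2:ℝ) ^ j) ^ (-(max r 1)) := by
      refine Summable.of_nonneg_of_le (fun n => by positivity) (fun j => ?_) summable_geometric_two
      have : (1/2:ℝ)^j = ((2:ℝ)^j) ^ (-1:ℝ) := by rw [Real.rpow_neg_one, one_div, inv_pow]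
      rw [this]
      refine Real.rpow_le_rpow_of_exponent_le (one_le_pow₀ one_le_two) (by simp)
    refine (h1.mul_of_nonneg h2 (fun n => by positivity) (fun n => by positivity)).congr fun b => ?_
    push_cast
    rw [Real.mul_rpow (by positivity) (by positivity)]

end
end

noncomputable section
set_option linter.unusedSectionVars false

lemma exists_q {H : ℝ} (hH : 0 < H) : ∃ q : ℕ, Even q ∧ 4 ≤ q * H := by
  obtain ⟨n, hn⟩ := exists_nat_ge (4 / H)
  refine ⟨2 * n, even_two_mul n, ?_⟩
  rw [div_le_iff₀ hH] at hn
  push_cast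
  nlinarith

section
variable {Ω : Type*} [MeasurableSpace Ω] {P : Measure Ω} [IsProbabilityMeasure P] {H a : ℝ}

lemma FBSeq.incr_bound {X : ℕ → ℝ → Ω → ℝ} {N : ℕ → ℕ} (hX : FBSeq H a P X N) (hH : H ∈ Ioo (0:ℝ) 1) (q : ℕ) :
    ∀ᵐ ω ∂P, ∃ M : ℝ, 0 ≤ M ∧ ∀ n j : ℕ, (∑ l ∈ Finset.range (N n * 2 ^ j), (sc H j * (X n (((l:ℝ) + 1) / 2 ^ j) ω - X n ((l:ℝ) / 2 ^ j) ω)) ^ q) / ((N n * 2 ^ j : ℕ):ℝ) ≤ M := by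
  filter_upwards [hX.dyad.avg_pow hH (ι := Fin 2) ![1, -1] ![1, 0] (by simp) q] with ω hω
  obtain ⟨M, hM⟩ := hω
  refine ⟨max M 0, le_max_right _ _, fun n j => le_max_of_le_left ?_⟩
  refine le_trans (le_of_eq ?_) (hM (n, j))
  congr 1
  refine Finset.sum_congr rfl fun l _ => ?_
  simp [Fin.sum_univ_two, div_eq_mul_inv]
  ring

/-- mean of the upper functional -/
def ku (P : Measure Ω) (Y : ℝ → Ω → ℝ) (δ : ℝ) : ℝ≥0∞ := ∫⁻ z, (⨆ J, gu Y J δ z.1 z.2) ∂(P.prod (volume.restrict (Ioc (-(1/2):ℝ) (1/2))))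

lemma FB.gu_meas {Y : ℝ → Ω → ℝ} (hY : FB H a P Y) (J : ℕ) (δ : ℝ) : Measurable (fun z : Ω × ℝ => gu Y J δ z.1 z.2) :=
  (fu_meas J δ).comp (smp_meas hY (sJ J))

lemma FB.fu_le_ku {Y : ℝ → Ω → ℝ} (hY : FB H a P Y) (J : ℕ) (δ : ℝ) : ∫⁻ z, fu J δ z ∂(limM P Y (sJ J)) ≤ ku P Y δ := by
  rw [hY.lint_limM (sJ J) (fu_meas J δ), ku, lintegral_prod _ (Measurable.iSup fun J => hY.gu_meas J δ).aemeasurable]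
  refine lintegral_mono fun ω => lintegral_mono fun v => ?_
  exact le_iSup (fun J => gu Y J δ ω v) J

lemma FBSeq.upper1 {X : ℕ → ℝ → Ω → ℝ} {N : ℕ → ℕ} (hX : FBSeq H a P X N) (hH : H ∈ Ioo (0:ℝ) 1) {Y : ℝ → Ω → ℝ} (hY : FB H a P Y) (x : ℕ → ℝ)
    {δ : ℝ} (hδ : 0 < δ) (hδ' : δ < 1/2) :
    ∀ᵐ ω ∂P, ∀ ε : ℝ≥0∞, 0 < ε → ∀ᶠ n in atTop, crossKe 1 (fun r => X n r ω + x n) 0 (N n) / N n ≤ 1 + ku P Y δ + ε := by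
  obtain ⟨q, hq, hqH⟩ := exists_q hH.1
  have h1 : ∀ᵐ ω ∂P, ∀ J : ℕ, ∀ ε : ℝ≥0∞, 0 < ε → ∀ᶠ b in cofinite, 
      (∑ i ∈ Finset.range (N b), fu J δ (smp (X b) (sJ J) (x b) ω i)) / N b ≤ ∫⁻ z, fu J δ z ∂(limM P Y (sJ J)) + ε :=
    ae_all_iff.2 fun J => hX.fu_avg hH hY J δ x
  filter_upwards [h1, hX.incr_bound hH q] with ω hω ⟨M, hM0, hM⟩ ε hε
  set C := ENNReal.ofReal (M * ((δ * (1 - xb H)) ^ q)⁻¹)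
  have hT : Tendsto (fun J : ℕ => C * ENNReal.ofReal ((1/2)^J)) atTop (𝓝 0) := by
    have h := ENNReal.tendsto_ofReal (tendsto_pow_atTop_nhds_zero_of_lt_one (r := (1/2:ℝ)) (by norm_num) (by norm_num))
    simpa using ENNReal.Tendsto.const_mul h (Or.inr (by finiteness : C ≠ ⊤))
  have hε2 : 0 < ε / 2 := ENNReal.half_pos hε.ne'
  obtain ⟨J, hJ⟩ := (hT.eventually_lt_const hε2).exists
  have h2 := hω J (ε/2) hε2
  rw [Nat.cofinite_eq_atTop] at h2
  filter_upwards [h2] with n hn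
  have hcw : Continuous (fun r => X n r ω + x n) := ((hX.fb n).cont ω).add continuous_const
  have hN := hX.pos n
  have hN0 : (N n : ℝ≥0∞) ≠ 0 := by exact_mod_cast hN.ne'
  have h3 : crossKe 1 (fun r => X n r ω + x n) 0 (N n) ≤ N n + (∑ i ∈ Finset.range (N n), fu J δ (smp (X n) (sJ J) (x n) ω i)) + N n * (C * ENNReal.ofReal ((1/2)^J)) := by
    refine crossKe_le_of fun m hm => ?_
    rw [le_crossKe_iff hcw] at hm
    have h4 := MP_upper (w := fun r => X n r ω + x n) (N := N n) (J := J) (m := m) (dl := dlf H δ) (δ := δ) (δ' := 0)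
      hcw (dlf_pos hH.1 hδ) (fun a n _ => dlf_sum hH.1 hδ a n) (by linarith) q hm
    have h5 := tail_le hH.1 hδ hq hqH hN J (w := fun r => X n r ω + x n) hM0 (fun j => by simpa using hM n j)
    have h6 := h4.trans (add_le_add le_rfl h5)
    simp only [fu_smp]
    rw [zero_add] at h6
    exact h6
  calc _ ≤ (N n + (∑ i ∈ Finset.range (N n), fu J δ (smp (X n) (sJ J) (x n) ω i)) + N n * (C * ENNReal.ofReal ((1/2)^J))) / N n := ENNReal.div_le_div_right h3 _
    _ = 1 + (∑ i ∈ Finset.range (N n), fu J δ (smp (X n) (sJ J) (x n) ω i)) / N n + C * ENNReal.ofReal ((1/2)^J) := by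
      rw [ENNReal.add_div, ENNReal.add_div, ENNReal.div_self hN0 (by finiteness), mul_comm (N n : ℝ≥0∞), ENNReal.mul_div_cancel_right hN0 (by finiteness)]
    _ ≤ 1 + (ku P Y δ + ε/2) + ε/2 := by
      gcongr
      exact hn.trans (by gcongr; exact hY.fu_le_ku J δ)
    _ = _ := by rw [← add_assoc, add_assoc, ENNReal.add_halves]

end
end

noncomputable section
set_option linter.unusedSectionVars false

/-- a sequence of widths -/
def dk (k : ℕ) : ℝ := 1 / ((k:ℝ) + 5)
lemma dk_pos (k : ℕ) : 0 < dk k := by unfold dk; positivity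
lemma dk_lt (k : ℕ) : dk k < 1/2 := by
  unfold dk
  rw [div_lt_div_iff₀ (by positivity) (by norm_num)]
  have : (0:ℝ) ≤ k := by positivity
  linarith
lemma dk_anti : Antitone dk := fun k k' h => by
  unfold dk
  gcongr
lemma dk_tendsto : Tendsto dk atTop (𝓝 0) := by
  have h : Tendsto (fun k : ℕ => (k:ℝ) + 5) atTop atTop := tendsto_atTop_add_const_right _ _ tendsto_natCast_atTop_atTop
  refine h.inv_tendsto_atTop.congr fun k => ?_
  simp [dk]

section
variable {Ω : Type*} [MeasurableSpace Ω] {P : Measure Ω} [IsProbabilityMeasure P] {H a : ℝ}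

lemma gu_spec (Y : ℝ → Ω → ℝ) (J : ℕ) (δ : ℝ) (ω : Ω) (v : ℝ) : ∃ m : ℕ, gu Y J δ ω v = m ∧ MP (Icc 0 1) (fun r => Y r ω + v) δ m := by
  refine ⟨_, gu_eq Y J δ ω v, MP_mono_set (Dy_sub J) ?_⟩
  exact cnt_spec (Q := MP (Dy J) (fun r => Y r ω + v) δ) (MP_zero _ _ _) (fun _ _ h h' => MP_mono_m h h') (2^J)

lemma gu_anti (Y : ℝ → Ω → ℝ) (J : ℕ) {δ δ' : ℝ} (h : δ ≤ δ') (ω : Ω) (v : ℝ) : gu Y J δ ω v ≤ gu Y J δ' ω v := by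
  simp only [gu_eq]
  exact_mod_cast cnt_mono fun m hm h' => ⟨MP_mono_delta h h', (Finset.mem_Icc.1 hm).2⟩

lemma FB.inf_gu {Y : ℝ → Ω → ℝ} (hY : FB H a P Y) (ω : Ω) (v : ℝ) : ⨅ k, ⨆ J, gu Y J (dk k) ω v ≤ crossKe 1 (fun r => Y r ω + v) 0 1 := by
  have hcw : Continuous (fun r => Y r ω + v) := (hY.cont ω).add continuous_const
  by_contra! h
  have h0 : crossK 1 (fun r => Y r ω + v) 0 1 ≠ ⊤ := by
    intro h1
    rw [crossKe, h1] at h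
    simp at h
  obtain ⟨n, hn⟩ := ENat.ne_top_iff_exists.1 h0
  have hn' : crossKe 1 (fun r => Y r ω + v) 0 1 = (n:ℝ≥0∞) := by rw [crossKe, ← hn]; simp
  have h1 : ¬ MP (Icc 0 1) (fun r => Y r ω + v) 0 (n+1) := by
    rw [← le_crossKe_iff hcw, hn', not_le]
    exact_mod_cast Nat.lt_succ_self n
  have h2 : ∃ k, ¬ MP (Icc 0 1) (fun r => Y r ω + v) (dk k) (n+1) := by
    by_contra! h3
    exact h1 (MP_compact hcw dk_tendsto dk_lt h3)
  obtain ⟨k, hk⟩ := h2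
  refine absurd h (not_lt.2 (iInf_le_of_le k (iSup_le fun J => ?_)))
  obtain ⟨m, e, hm⟩ := gu_spec Y J (dk k) ω v
  rw [e, hn']
  by_contra! h4
  exact hk (MP_mono_m (by exact_mod_cast h4) hm)

lemma FB.ku_zero {Y : ℝ → Ω → ℝ} (hY : FB H a P Y) (hH : 0 < H) : ku P Y (dk 0) ≠ ⊤ := by
  obtain ⟨q, hq, hqH⟩ := exists_q hH
  set T : Ω → ℝ≥0∞ := fun ω => ∑' j : ℕ, ∑ l ∈ Finset.range (1 * 2 ^ (0 + 1 + j)),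
        ENNReal.ofReal ((|Y (((l:ℝ) + 1) / 2 ^ (0 + 1 + j)) ω - Y ((l:ℝ) / 2 ^ (0 + 1 + j)) ω| / dlf H (dk 0) (0 + 1 + j)) ^ q) with hT
  have h1 : ∀ z : Ω × ℝ, (⨆ J, gu Y J (dk 0) z.1 z.2) ≤ 2 + T z.1 := by
    rintro ⟨ω, v⟩
    refine iSup_le fun J => ?_
    obtain ⟨m, e, hm⟩ := gu_spec Y J (dk 0) ω v
    rw [e]
    have hcw : Continuous (fun r => Y r ω + v) := (hY.cont ω).add continuous_const
    have h4 := MP_upper (w := fun r => Y r ω + v) (N := 1) (J := 0) (m := m) (dl := dlf H (dk 0)) (δ := dk 0) (δ' := dk 0)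
      hcw (dlf_pos hH (dk_pos 0)) (fun a n _ => dlf_sum hH (dk_pos 0) a n) (by norm_num [dk]) q (by simpa using hm)
    refine h4.trans ?_
    refine add_le_add ?_ ?_
    · rw [Finset.sum_range_one, Nat.cast_one, show (2:ℝ≥0∞) = 1 + 1 by norm_num]
      refine add_le_add le_rfl ?_
      have : cnt (MP (Dy 0) (fun r => Y (((0:ℕ):ℝ) + r) ω + v) (dk 0 + dk 0)) (2^0) ≤ 1 := 
        (Finset.card_filter_le _ _).trans (by simp)
      exact_mod_cast this
    · simp only [add_sub_add_right_eq_sub, hT]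
      exact le_rfl
  have hTm : ∀ (j l : ℕ), Measurable fun ω => ENNReal.ofReal ((|Y (((l:ℝ) + 1) / 2 ^ (0 + 1 + j)) ω - Y ((l:ℝ) / 2 ^ (0 + 1 + j)) ω| / dlf H (dk 0) (0 + 1 + j)) ^ q) := by
    intro j l
    have h1 := hY.meas (((l:ℝ) + 1) / 2 ^ (0 + 1 + j))
    have h2 := hY.meas ((l:ℝ) / 2 ^ (0 + 1 + j))
    fun_prop
  set g := gaussianReal 0 (Rf H a (ι := Fin 2) ![1, -1] ![1, 0] 0).toNNReal with hg
  set G := ∫⁻ y, ENNReal.ofReal (y ^ q) ∂g with hG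
  have hGf : G ≠ ⊤ := by
    refine ne_top_of_le_ne_top (lint_pow_gauss_lt_top _ q).ne (lintegral_mono fun y => ?_)
    rw [← enorm_pow]
    exact Real.ofReal_le_enorm _
  have h2 : ∫⁻ ω, T ω ∂P ≤ (G * ENNReal.ofReal (((dk 0 * (1 - xb H)) ^ q)⁻¹)) * ENNReal.ofReal ((1/2)^0) := by
    rw [hT, lintegral_tsum fun j => (Finset.measurable_fun_sum _ fun l _ => hTm j l).aemeasurable, ← geo_tail 0]
    refine ENNReal.tsum_le_tsum fun j => ?_
    rw [lintegral_finsetSum _ fun l _ => hTm j l]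
    set k := 0 + 1 + j
    have hc := cj_nonneg hH (dk_pos 0) q k
    have h3 : ∀ l ∈ Finset.range (1 * 2^k), ∫⁻ ω, ENNReal.ofReal ((|Y (((l:ℝ) + 1) / 2 ^ k) ω - Y ((l:ℝ) / 2 ^ k) ω| / dlf H (dk 0) k) ^ q) ∂P = G * ENNReal.ofReal (cj H (dk 0) q k) := by
      intro l _
      simp only [term_eq hH (dk_pos 0) hq, ENNReal.ofReal_mul' hc]
      rw [lintegral_mul_const' _ _ (by finiteness)]
      congr 1
      have e := (hY.dyad k).law hH (ι := Fin 2) ![1, -1] ![1, 0] (by simp) l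
      rw [hG, hg, ← e, lintegral_map (by fun_prop)]
      · refine lintegral_congr fun ω => ?_
        congr 2
        simp [Fin.sum_univ_two, div_eq_mul_inv]
        ring
      · refine Finset.measurable_fun_sum _ fun j _ => ((hY.dyad k).meas _).const_mul _
    rw [Finset.sum_congr rfl h3, Finset.sum_const, Finset.card_range, one_mul, nsmul_eq_mul, mul_assoc, ← ENNReal.ofReal_mul (by
      have := xb_lt hH
      have : 0 ≤ 1 - xb H := by linarith
      have := dk_pos 0
      positivity), mul_left_comm]
    gcongr
    rw [← ENNReal.ofReal_natCast, ← ENNReal.ofReal_mul (by positivity)]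
    refine ENNReal.ofReal_le_ofReal ?_
    push_cast
    exact cj_le hH (dk_pos 0) hqH k
  have h5 : ku P Y (dk 0) ≤ 2 + ∫⁻ ω, T ω ∂P := by
    have hTm' : Measurable T := Measurable.tsum fun j => (Finset.measurable_fun_sum _ fun l _ => hTm j l)
    refine (lintegral_mono h1).trans ?_
    have hTm2 : Measurable fun z : Ω × ℝ => 2 + T z.1 := measurable_const.add (hTm'.comp measurable_fst)
    rw [lintegral_prod _ hTm2.aemeasurable]
    simp only [lintegral_const, Measure.restrict_apply_univ, Real.volume_Ioc]
    norm_num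
  refine ne_top_of_le_ne_top ?_ (h5.trans (add_le_add_right h2 _))
  finiteness

lemma FB.inf_ku {Y : ℝ → Ω → ℝ} (hY : FB H a P Y) (hH : 0 < H) : ⨅ k, ku P Y (dk k) ≤ kp P Y := by
  have hm : ∀ k, Measurable fun z : Ω × ℝ => ⨆ J, gu Y J (dk k) z.1 z.2 := fun k => Measurable.iSup fun J => hY.gu_meas J _
  have := lintegral_iInf (μ := P.prod (volume.restrict (Ioc (-(1/2):ℝ) (1/2)))) hm
    (fun k k' h z => iSup_mono fun J => gu_anti Y J (dk_anti h) z.1 z.2) (hY.ku_zero hH)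
  simp only [ku]
  rw [← this, lintegral_prod _ (Measurable.iInf hm).aemeasurable]
  exact lintegral_mono fun ω => lintegral_mono fun v => hY.inf_gu ω v

lemma FBSeq.upper {X : ℕ → ℝ → Ω → ℝ} {N : ℕ → ℕ} (hX : FBSeq H a P X N) (hH : H ∈ Ioo (0:ℝ) 1) {Y : ℝ → Ω → ℝ} (hY : FB H a P Y) (x : ℕ → ℝ) :
    ∀ᵐ ω ∂P, ∀ c : ℝ≥0∞, 1 + kp P Y < c → ∀ᶠ n in atTop, crossKe 1 (fun r => X n r ω + x n) 0 (N n) / N n < c := by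
  have h1 : ∀ᵐ ω ∂P, ∀ k : ℕ, ∀ ε : ℝ≥0∞, 0 < ε → ∀ᶠ n in atTop, crossKe 1 (fun r => X n r ω + x n) 0 (N n) / N n ≤ 1 + ku P Y (dk k) + ε :=
    ae_all_iff.2 fun k => hX.upper1 hH hY x (dk_pos k) (dk_lt k)
  filter_upwards [h1] with ω hω c hc
  have h2 : ⨅ k, (1 + ku P Y (dk k)) < c := by
    rw [← ENNReal.add_iInf]
    exact lt_of_le_of_lt (add_le_add_right (hY.inf_ku hH.1) _) hc
  obtain ⟨k, hk⟩ := iInf_lt_iff.1 h2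
  obtain ⟨c', h3, h4⟩ := exists_between hk
  filter_upwards [hω k (c' - (1 + ku P Y (dk k))) (tsub_pos_of_lt h3)] with n hn
  refine lt_of_le_of_lt hn ?_
  rwa [add_tsub_cancel_of_le h3.le]

lemma summ_nat : ∃ r : ℝ, Summable fun n : ℕ => ((n + 1 : ℕ) : ℝ) ^ (-r) :=
  ⟨2, (summable_nat_add_iff (f := fun n : ℕ => (n:ℝ) ^ (-2:ℝ)) 1).2 (Real.summable_nat_rpow.2 (by norm_num))⟩

lemma FB.kp_fin {Y : ℝ → Ω → ℝ} (hY : FB H a P Y) (hH : H ∈ Ioo (0:ℝ) 1) : kp P Y ≠ ⊤ := by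
  have hX : FBSeq H a P (fun _ : ℕ => Y) (fun n => n + 1) := ⟨fun _ => hY, fun n => by omega, summ_nat⟩
  intro h
  obtain ⟨ω, h1, h2⟩ := ((hX.lower hH hY (fun _ => 0)).and (hX.upper1 hH hY (fun _ => 0) (dk_pos 0) (dk_lt 0))).exists
  have h3 : 1 + ku P Y (dk 0) + 1 < ⊤ := by
    have := hY.ku_zero hH.1
    finiteness
  obtain ⟨n, h4, h5⟩ := ((h1 _ (h3.trans_eq h.symm)).and (h2 1 one_pos)).exists
  exact absurd h4 (not_lt.2 h5)

end
end

noncomputable section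
set_option linter.unusedSectionVars false

lemma MP_time {S S' : Set ℝ} {w w' : ℝ → ℝ} {δ : ℝ} {m : ℕ} {φ : ℝ → ℝ} (hφ : StrictMono φ) (hS : ∀ s ∈ S, φ s ∈ S')
    (hw : ∀ s ∈ S, w' (φ s) = w s) (h : MP S w δ m) : MP S' w' δ m := by
  obtain ⟨F, h0, h1, h2⟩ := h
  have hinj : Function.Injective (fun p : ℝ × ℝ => (φ p.1, φ p.2)) := by
    rintro ⟨a, b⟩ ⟨c, d⟩ h
    simp only [Prod.mk.injEq] at h
    simp [hφ.injective h.1, hφ.injective h.2]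
  refine ⟨F.image (fun p => (φ p.1, φ p.2)), ?_, ?_, ?_⟩
  · rw [Finset.card_image_of_injective _ hinj, h0]
  · intro p hp
    obtain ⟨p, hpp, rfl⟩ := Finset.mem_image.1 hp
    obtain ⟨a1, a2, a3, k, hk⟩ := h1 p hpp
    refine ⟨hS _ a1, hS _ a2, hφ a3, k, ?_⟩
    rwa [hw _ a1, hw _ a2]
  · intro p hp p' hp' hne
    obtain ⟨p, hpp, rfl⟩ := Finset.mem_image.1 hp
    obtain ⟨p', hpp', rfl⟩ := Finset.mem_image.1 hp'
    have := h2 p hpp p' hpp' (by rintro rfl; exact hne rfl)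
    exact this.imp (fun h => hφ.monotone h) (fun h => hφ.monotone h)

lemma crossKe_scale {w : ℝ → ℝ} (hw : Continuous w) {ε l : ℝ} (hε : 0 < ε) (hl : 0 < l) (T : ℝ) :
    crossKe ε w 0 (T * l) = crossKe 1 (fun r => w (r * l) / ε) 0 T := by
  have hc : Continuous (fun r => w (r * l) / ε) := (hw.comp (continuous_id.mul continuous_const)).div_const _
  rw [crossKe, crossKe]
  congr 1
  refine ENat.eq_of_forall_natCast_le_iff fun m => ?_
  rw [crossK_iff_MP hε hw, crossK_iff_MP one_pos hc]
  simp only [div_one]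
  constructor
  · refine MP_time (φ := fun r => r / l) (fun x y h => div_lt_div_of_pos_right h hl) ?_ ?_
    · rintro s ⟨h1, h2⟩
      exact ⟨by positivity, (div_le_iff₀ hl).2 h2⟩
    · intro s _
      rw [div_mul_cancel₀ _ hl.ne']
  · refine MP_time (φ := fun r => r * l) (fun x y h => mul_lt_mul_of_pos_right h hl) ?_ ?_
    · rintro s ⟨h1, h2⟩
      exact ⟨by positivity, by gcongr⟩
    · intro s _
      rfl

lemma crossKe_mono {w : ℝ → ℝ} (hw : Continuous w) {ε : ℝ} (hε : 0 < ε) {t t' : ℝ} (h : t ≤ t') :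
    crossKe ε w 0 t ≤ crossKe ε w 0 t' := by
  have h1 : crossK ε w 0 t ≤ crossK ε w 0 t' := by
    refine ENat.forall_natCast_le_iff_le.1 fun m hm => ?_
    rw [crossK_iff_MP hε hw] at hm ⊢
    exact MP_mono_set (Icc_subset_Icc le_rfl h) hm
  rw [crossKe, crossKe]
  exact_mod_cast h1

section
variable {Ω : Type*} [MeasurableSpace Ω] {P : Measure Ω} [IsProbabilityMeasure P] {H a : ℝ} {B : ℝ → Ω → ℝ}

/-- mean averaged count -/
def kapp (P : Measure Ω) (B : ℝ → Ω → ℝ) (L : ℝ) : ℝ≥0∞ := ∫⁻ ω, avgK 1 (fun r => B r ω) 0 L ∂P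

lemma FB.kapp_eq (hB : FB H a P B) {L : ℝ} (hL : 0 < L) : kapp P B L = kp P (fun s ω => 1 * B (s * L) ω) := by
  refine lintegral_congr fun ω => ?_
  simp only [avgK, inv_one, ENNReal.ofReal_one, one_mul]
  rw [Measure.restrict_congr_set Ioo_ae_eq_Ioc]
  refine lintegral_congr fun v => ?_
  have := crossKe_scale (w := fun r => B r ω + v) ((hB.cont ω).add continuous_const) one_pos hL 1
  rw [one_mul] at this
  rw [this]
  simp

lemma FB.rY (hB : FB H a P B) {L : ℝ} (hL : 0 < L) : FB H (a * L ^ (2 * H)) P (fun s ω => 1 * B (s * L) ω) :=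
  hB.scale hL one_ne_zero (by ring)

lemma FB.rX (hB : FB H a P B) (hH : 0 < H) {L ε : ℝ} (hL : 0 < L) (hε : 0 < ε) : FB H (a * L ^ (2 * H)) P (fun s ω => ε⁻¹ * B (s * (L * ε ^ (1/H))) ω) := by
  refine hB.scale (by positivity) (by positivity) ?_
  rw [Real.mul_rpow hL.le (by positivity), ← Real.rpow_mul hε.le, show 1 / H * (2 * H) = (2:ℕ) by push_cast; field_simp, Real.rpow_natCast]
  field_simp

lemma FB.cross_eq (hB : FB H a P B) {L ε : ℝ} (hL : 0 < L) (hε : 0 < ε) (ρ : ℝ) (ω : Ω) (N : ℕ) :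
    crossKe 1 (fun r => ε⁻¹ * B (r * (L * ε ^ (1/H))) ω + ρ / ε) 0 N = crossKe ε (fun r => B r ω + ρ) 0 (N * (L * ε ^ (1/H))) := by
  rw [crossKe_scale (w := fun r => B r ω + ρ) ((hB.cont ω).add continuous_const) hε (by positivity)]
  congr 1
  funext r
  ring

lemma FB.low (hB : FB H a P B) (hH : H ∈ Ioo (0:ℝ) 1) {L : ℝ} (hL : 0 < L) {ε : ℕ → ℝ} (hε : ∀ n, 0 < ε n) {N : ℕ → ℕ} (hN : ∀ n, 0 < N n)
    (hs : ∃ r : ℝ, Summable fun n => (N n : ℝ) ^ (-r)) {t : ℝ} (ht : 0 < t) (ρ : ℝ)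
    (hlim : Tendsto (fun n => (N n : ℝ) * ε n ^ (1/H)) atTop (𝓝 (t / L)))
    (hle : ∀ᶠ n in atTop, (N n : ℝ) * (L * ε n ^ (1/H)) ≤ t) :
    ∀ᵐ ω ∂P, ∀ c : ℝ≥0∞, c < ENNReal.ofReal t * ((ENNReal.ofReal L)⁻¹ * kapp P B L) →
      ∀ᶠ n in atTop, c < ENNReal.ofReal (ε n ^ (1/H)) * crossKe (ε n) (fun r => B r ω + ρ) 0 t := by
  have hX : FBSeq H (a * L ^ (2 * H)) P (fun n s ω => (ε n)⁻¹ * B (s * (L * ε n ^ (1/H))) ω) N := ⟨fun n => hB.rX hH.1 hL (hε n), hN, hs⟩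
  filter_upwards [hX.lower hH (hB.rY hL) (fun n => ρ / ε n)] with ω hω c hc
  simp only [hB.cross_eq hL (hε _), ← hB.kapp_eq hL] at hω
  have hu : ENNReal.ofReal (t / L) = ENNReal.ofReal t * (ENNReal.ofReal L)⁻¹ := by
    rw [ENNReal.ofReal_div_of_pos hL, div_eq_mul_inv]
  rw [← mul_assoc, ← hu, mul_comm] at hc
  have hu0 : ENNReal.ofReal (t / L) ≠ 0 := by simpa using div_pos ht hL
  obtain ⟨c', h1, h2⟩ := exists_between ((ENNReal.div_lt_iff (Or.inl hu0) (Or.inl ENNReal.ofReal_ne_top)).2 hc)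
  have h3 := (ENNReal.div_lt_iff (Or.inl hu0) (Or.inl ENNReal.ofReal_ne_top)).1 h1
  have h4 : Tendsto (fun n => c' * ENNReal.ofReal ((N n : ℝ) * ε n ^ (1/H))) atTop (𝓝 (c' * ENNReal.ofReal (t / L))) :=
    ENNReal.Tendsto.const_mul (ENNReal.tendsto_ofReal hlim) (Or.inl hu0)
  filter_upwards [hω c' h2, h4.eventually_const_lt h3, hle] with n hn h5 h6
  have hcw : Continuous (fun r => B r ω + ρ) := (hB.cont ω).add continuous_const
  have hN0 : (N n : ℝ≥0∞) ≠ 0 := by exact_mod_cast (hN n).ne'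
  rw [ENNReal.ofReal_mul (by positivity), ENNReal.ofReal_natCast] at h5
  calc c < _ := h5
    _ ≤ (crossKe (ε n) (fun r => B r ω + ρ) 0 (N n * (L * ε n ^ (1/H))) / N n) * (N n * ENNReal.ofReal (ε n ^ (1/H))) := by gcongr
    _ = ENNReal.ofReal (ε n ^ (1/H)) * crossKe (ε n) (fun r => B r ω + ρ) 0 (N n * (L * ε n ^ (1/H))) := by
      rw [← mul_assoc, ENNReal.div_mul_cancel hN0 (by finiteness), mul_comm]
    _ ≤ _ := by
      gcongr
      exact crossKe_mono hcw (hε n) h6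

lemma FB.upp (hB : FB H a P B) (hH : H ∈ Ioo (0:ℝ) 1) {L : ℝ} (hL : 0 < L) {ε : ℕ → ℝ} (hε : ∀ n, 0 < ε n) {N : ℕ → ℕ} (hN : ∀ n, 0 < N n)
    (hs : ∃ r : ℝ, Summable fun n => (N n : ℝ) ^ (-r)) {t : ℝ} (ht : 0 < t) (ρ : ℝ)
    (hlim : Tendsto (fun n => (N n : ℝ) * ε n ^ (1/H)) atTop (𝓝 (t / L)))
    (hle : ∀ᶠ n in atTop, t ≤ (N n : ℝ) * (L * ε n ^ (1/H))) :
    ∀ᵐ ω ∂P, ∀ c : ℝ≥0∞, ENNReal.ofReal t * ((ENNReal.ofReal L)⁻¹ * (1 + kapp P B L)) < c →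
      ∀ᶠ n in atTop, ENNReal.ofReal (ε n ^ (1/H)) * crossKe (ε n) (fun r => B r ω + ρ) 0 t < c := by
  have hX : FBSeq H (a * L ^ (2 * H)) P (fun n s ω => (ε n)⁻¹ * B (s * (L * ε n ^ (1/H))) ω) N := ⟨fun n => hB.rX hH.1 hL (hε n), hN, hs⟩
  filter_upwards [hX.upper hH (hB.rY hL) (fun n => ρ / ε n)] with ω hω c hc
  simp only [hB.cross_eq hL (hε _), ← hB.kapp_eq hL] at hω
  have hu : ENNReal.ofReal (t / L) = ENNReal.ofReal t * (ENNReal.ofReal L)⁻¹ := by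
    rw [ENNReal.ofReal_div_of_pos hL, div_eq_mul_inv]
  rw [← mul_assoc, ← hu, mul_comm] at hc
  have hu0 : ENNReal.ofReal (t / L) ≠ 0 := by simpa using div_pos ht hL
  obtain ⟨c', h1, h2⟩ := exists_between ((ENNReal.lt_div_iff_mul_lt (Or.inl hu0) (Or.inl ENNReal.ofReal_ne_top)).2 hc)
  have h3 := (ENNReal.lt_div_iff_mul_lt (Or.inl hu0) (Or.inl ENNReal.ofReal_ne_top)).1 h2
  have h4 : Tendsto (fun n => c' * ENNReal.ofReal ((N n : ℝ) * ε n ^ (1/H))) atTop (𝓝 (c' * ENNReal.ofReal (t / L))) :=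
    ENNReal.Tendsto.const_mul (ENNReal.tendsto_ofReal hlim) (Or.inl hu0)
  filter_upwards [hω c' h1, h4.eventually_lt_const h3, hle] with n hn h5 h6
  have hcw : Continuous (fun r => B r ω + ρ) := (hB.cont ω).add continuous_const
  have hN0 : (N n : ℝ≥0∞) ≠ 0 := by exact_mod_cast (hN n).ne'
  rw [ENNReal.ofReal_mul (by positivity), ENNReal.ofReal_natCast] at h5
  refine lt_of_le_of_lt ?_ h5
  calc _ ≤ ENNReal.ofReal (ε n ^ (1/H)) * crossKe (ε n) (fun r => B r ω + ρ) 0 (N n * (L * ε n ^ (1/H))) := by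
          gcongr
          exact crossKe_mono hcw (hε n) h6
    _ = (crossKe (ε n) (fun r => B r ω + ρ) 0 (N n * (L * ε n ^ (1/H))) / N n) * (N n * ENNReal.ofReal (ε n ^ (1/H))) := by
      generalize crossKe (ε n) (fun r => B r ω + ρ) 0 (N n * (L * ε n ^ (1/H))) = K
      rw [← mul_assoc, ENNReal.div_mul_cancel hN0 (by finiteness), mul_comm]
    _ ≤ _ := by gcongr

end
end

noncomputable section
set_option linter.unusedSectionVars false

lemma eps_summ {H : ℝ} (hH : 0 < H) {L t : ℝ} (hL : 0 < L) (ht : 0 < t) {ε : ℕ → ℝ} (hε : ∀ n, 0 < ε n) {η : ℝ} (hη : 0 < η)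
    (hO : (fun n => ε n) =O[atTop] fun n : ℕ => (n : ℝ) ^ (-η)) {N : ℕ → ℕ} 
    (h : ∀ n, t / (L * ε n ^ (1/H)) / 2 ≤ N n) : ∃ r : ℝ, Summable fun n => (N n : ℝ) ^ (-r) := by
  refine ⟨2 * H / η, ?_⟩
  have h1 : Summable fun n => ε n ^ (2 / η) := by
    refine summable_of_isBigO_nat (g := fun n : ℕ => (n:ℝ) ^ (-2:ℝ)) (Real.summable_nat_rpow.2 (by norm_num)) ?_
    refine (hO.rpow (r := 2/η) (by positivity) (Eventually.of_forall fun n => by positivity)).trans (IsBigO.of_bound 1 (Eventually.of_forall fun n => ?_))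
    rw [← Real.rpow_mul (by positivity), one_mul]
    refine le_of_eq ?_
    congr 2
    field_simp
  refine Summable.of_nonneg_of_le (fun n => by positivity) (fun n => ?_) (h1.mul_left ((2 * L / t) ^ (2 * H / η)))
  have hp := hε n
  have h2 : 0 < t / (L * ε n ^ (1/H)) / 2 := by positivity
  calc (N n : ℝ) ^ (-(2 * H / η)) ≤ (t / (L * ε n ^ (1/H)) / 2) ^ (-(2 * H / η)) :=
        Real.rpow_le_rpow_of_nonpos h2 (h n) (by have : 0 < 2 * H / η := by positivity
                                                 linarith)
    _ = (2 * L / t * ε n ^ (1/H)) ^ (2 * H / η) := by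
      rw [Real.rpow_neg h2.le, ← Real.inv_rpow h2.le]
      congr 1
      field_simp
    _ = _ := by
      rw [Real.mul_rpow (by positivity) (by positivity), ← Real.rpow_mul hp.le]
      congr 2
      field_simp

lemma eps_u {H : ℝ} (hH : 0 < H) {L t : ℝ} (hL : 0 < L) (ht : 0 < t) {ε : ℕ → ℝ} (hε : ∀ n, 0 < ε n) {η : ℝ} (hη : 0 < η)
    (hO : (fun n => ε n) =O[atTop] fun n : ℕ => (n : ℝ) ^ (-η)) : Tendsto (fun n => t / (L * ε n ^ (1/H))) atTop atTop := by
  have h1 : Tendsto ε atTop (𝓝 0) := hO.trans_tendsto ((tendsto_rpow_neg_atTop hη).comp tendsto_natCast_atTop_atTop)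
  have h2 : Tendsto (fun n => ε n ^ (1/H)) atTop (𝓝 0) := by
    have := h1.rpow_const (p := 1/H) (Or.inr (by positivity))
    rwa [Real.zero_rpow (by positivity)] at this
  have h3 : Tendsto (fun n => L * ε n ^ (1/H)) atTop (𝓝[>] 0) := by
    refine tendsto_nhdsWithin_iff.2 ⟨by simpa using h2.const_mul L, Eventually.of_forall fun n => ?_⟩
    have := hε n
    exact mul_pos hL (by positivity)
  simp only [div_eq_mul_inv t]
  exact (tendsto_inv_nhdsGT_zero.comp h3).const_mul_atTop ht

section
variable {Ω : Type*} [MeasurableSpace Ω] {P : Measure Ω} [IsProbabilityMeasure P] {H a : ℝ} {B : ℝ → Ω → ℝ}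

lemma FB.low2 (hB : FB H a P B) (hH : H ∈ Ioo (0:ℝ) 1) {L : ℝ} (hL : 0 < L) {ε : ℕ → ℝ} (hε : ∀ n, 0 < ε n) {t : ℝ} (ht : 0 < t) (ρ : ℝ)
   {η : ℝ} (hη : 0 < η) (hO : (fun n => ε n) =O[atTop] fun n : ℕ => (n : ℝ) ^ (-η)) :
    ∀ᵐ ω ∂P, ∀ c : ℝ≥0∞, c < ENNReal.ofReal t * ((ENNReal.ofReal L)⁻¹ * kapp P B L) →
      ∀ᶠ n in atTop, c < ENNReal.ofReal (ε n ^ (1/H)) * crossKe (ε n) (fun r => B r ω + ρ) 0 t := by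
  have hu := eps_u hH.1 hL ht hε hη hO
  have hu0 : ∀ n, 0 < t / (L * ε n ^ (1/H)) := fun n => by
    have := hε n
    positivity
  have hev : ∀ᶠ n in atTop, max 1 ⌊t / (L * ε n ^ (1/H))⌋₊ = ⌊t / (L * ε n ^ (1/H))⌋₊ := by
    filter_upwards [hu.eventually_ge_atTop 1] with n hn
    exact max_eq_right (Nat.one_le_floor_iff _ |>.2 hn)
  refine hB.low hH hL hε (N := fun n => max 1 ⌊t / (L * ε n ^ (1/H))⌋₊) (fun n => by positivity) (eps_summ hH.1 hL ht hε hη hO fun n => ?_) ht ρ ?_ ?_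
  · push_cast
    have h1 := Nat.lt_floor_add_one (t / (L * ε n ^ (1/H)))
    have h2 := le_max_left (1:ℝ) (⌊t / (L * ε n ^ (1/H))⌋₊ : ℝ)
    have h3 := le_max_right (1:ℝ) (⌊t / (L * ε n ^ (1/H))⌋₊ : ℝ)
    linarith
  · have h1 := ((tendsto_nat_floor_div_atTop (R := ℝ)).comp hu).mul_const (t / L)
    rw [one_mul] at h1
    refine h1.congr' ?_
    filter_upwards [hev] with n hn
    rw [hn]
    have := hε n
    simp only [Function.comp]
    generalize (⌊t / (L * ε n ^ (1/H))⌋₊ : ℝ) = q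
    field_simp
  · filter_upwards [hev] with n hn
    rw [hn]
    have h1 := Nat.floor_le (hu0 n).le
    have := hε n
    rwa [le_div_iff₀ (by positivity)] at h1

lemma FB.upp2 (hB : FB H a P B) (hH : H ∈ Ioo (0:ℝ) 1) {L : ℝ} (hL : 0 < L) {ε : ℕ → ℝ} (hε : ∀ n, 0 < ε n) {t : ℝ} (ht : 0 < t) (ρ : ℝ)
   {η : ℝ} (hη : 0 < η) (hO : (fun n => ε n) =O[atTop] fun n : ℕ => (n : ℝ) ^ (-η)) :
    ∀ᵐ ω ∂P, ∀ c : ℝ≥0∞, ENNReal.ofReal t * ((ENNReal.ofReal L)⁻¹ * (1 + kapp P B L)) < c →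
      ∀ᶠ n in atTop, ENNReal.ofReal (ε n ^ (1/H)) * crossKe (ε n) (fun r => B r ω + ρ) 0 t < c := by
  have hu := eps_u hH.1 hL ht hε hη hO
  have hu0 : ∀ n, 0 < t / (L * ε n ^ (1/H)) := fun n => by
    have := hε n
    positivity
  refine hB.upp hH hL hε (N := fun n => ⌊t / (L * ε n ^ (1/H))⌋₊ + 1) (fun n => by positivity) (eps_summ hH.1 hL ht hε hη hO fun n => ?_) ht ρ ?_ ?_
  · push_cast
    have h1 := Nat.lt_floor_add_one (t / (L * ε n ^ (1/H)))
    have := hu0 n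
    linarith
  · have h1 := (((tendsto_nat_floor_div_atTop (R := ℝ)).comp hu).add hu.inv_tendsto_atTop).mul_const (t / L)
    rw [add_zero, one_mul] at h1
    refine h1.congr fun n => ?_
    have := hε n
    simp only [Function.comp, Pi.inv_apply]
    push_cast
    generalize (⌊t / (L * ε n ^ (1/H))⌋₊ : ℝ) = q
    field_simp
  · refine Eventually.of_forall fun n => ?_
    have h1 := Nat.lt_floor_add_one (t / (L * ε n ^ (1/H)))
    have := hε n
    rw [div_lt_iff₀ (by positivity)] at h1
    push_cast
    exact h1.le

lemma FB.kapp_fin (hB : FB H a P B) (hH : H ∈ Ioo (0:ℝ) 1) {L : ℝ} (hL : 0 < L) : kapp P B L ≠ ⊤ := by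
  rw [hB.kapp_eq hL]
  exact (hB.rY hL).kp_fin hH

lemma FB.cHe_fin (hB : FB H a P B) (hH : H ∈ Ioo (0:ℝ) 1) : cHe P B ≠ ⊤ := by
  have h0 := hB.kapp_fin hH one_pos
  refine ne_top_of_le_ne_top (b := 1 + kapp P B 1) (by finiteness) (iSup_le fun L => iSup_le fun hL => ?_)
  have hε : ∀ n : ℕ, 0 < ((n:ℝ) + 1)⁻¹ := fun n => by positivity
  have hO : (fun n : ℕ => ((n:ℝ) + 1)⁻¹) =O[atTop] fun n : ℕ => (n : ℝ) ^ (-(1:ℝ)) := by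
    refine IsBigO.of_bound 1 ?_
    filter_upwards [eventually_gt_atTop 0] with n hn
    have hn' : (0:ℝ) < n := by exact_mod_cast hn
    rw [Real.rpow_neg_one, one_mul, Real.norm_of_nonneg (by positivity), Real.norm_of_nonneg (by positivity)]
    gcongr
    linarith
  obtain ⟨ω, h1, h2⟩ := ((hB.low2 hH hL hε one_pos 0 one_pos hO).and (hB.upp2 hH one_pos hε one_pos 0 one_pos hO)).exists
  simp only [ENNReal.ofReal_one, inv_one, one_mul] at h1 h2
  by_contra! h3
  obtain ⟨c, h4, h5⟩ := exists_between h3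
  obtain ⟨n, h6, h7⟩ := ((h1 c h5).and (h2 c h4)).exists
  exact absurd h6 (not_lt.2 h7.le)

lemma FB.cHe_pos (hB : FB H a P B) (hH : H ∈ Ioo (0:ℝ) 1) : 0 < cHe P B := by
  have h1 : kapp P B 1 ≤ cHe P B := by
    refine le_iSup_of_le 1 (le_iSup_of_le one_pos ?_)
    simp [kapp]
  refine lt_of_lt_of_le ?_ h1
  obtain ⟨v, hv⟩ := hB.gauss 1 (fun _ => 1) (fun _ => 1)
  simp only [Finset.univ_unique, Finset.sum_const, Finset.card_singleton, one_smul, one_mul] at hv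
  have hv0 : v ≠ 0 := by
    rintro rfl
    have h2 := hB.var 0 1
    simp only [hB.zero, sub_zero, abs_one, Real.one_rpow, mul_one] at h2
    have h3 : ∫ y, y ^ 2 ∂(P.map (B 1)) = a := by
      rw [integral_map (hB.meas 1).aemeasurable (by fun_prop), h2]
    rw [show (B 1) = fun ω => B 1 ω from rfl, hv] at h3
    simp at h3
    exact hB.pos.ne h3
  have hp : 0 < P {ω | 2 ≤ B 1 ω} := by
    have h2 : P {ω | 2 ≤ B 1 ω} = gaussianReal 0 v (Ici 2) := by
      rw [← hv, Measure.map_apply (hB.meas 1) measurableSet_Ici]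
      rfl
    rw [h2, pos_iff_ne_zero]
    intro h3
    have := gaussianReal_absolutelyContinuous' 0 hv0 h3
    simp at this
  have hm : MeasurableSet {ω | 2 ≤ B 1 ω} := measurableSet_le measurable_const (hB.meas 1)
  refine lt_of_lt_of_le hp ?_
  rw [← lintegral_indicator_one hm, kapp]
  refine lintegral_mono fun ω => ?_
  by_cases hω : ω ∈ {ω | 2 ≤ B 1 ω}
  · rw [indicator_of_mem hω, avgK, inv_one, ENNReal.ofReal_one, one_mul]
    have h3 : ∀ v ∈ Ioo (-(1/2):ℝ) (1/2), (1:ℝ≥0∞) ≤ crossKe 1 (fun r => B r ω + v) 0 1 := by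
      intro v hv
      have hcw : Continuous (fun r => B r ω + v) := (hB.cont ω).add continuous_const
      have := (le_crossKe_iff hcw (t := 1) 1).2 ⟨{(0, 1)}, by simp, ?_, ?_⟩
      · simpa using this
      · intro p hp
        rw [Finset.mem_singleton] at hp
        subst hp
        have hω' : 2 ≤ B 1 ω := hω
        refine ⟨by simp, by simp, by simp, ⌈v⌉, Or.inl ⟨?_, ?_⟩⟩
        · simp [hB.zero, Int.le_ceil]
        · have := Int.ceil_lt_add_one v
          simp only
          linarith
      · intro p hp p' hp' hne
        rw [Finset.mem_singleton] at hp hp'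
        exact absurd (hp.trans hp'.symm) hne
    calc (1:ℝ≥0∞) = ∫⁻ v in Ioo (-(1/2):ℝ) (1/2), 1 := by simp; norm_num
      _ ≤ _ := setLIntegral_mono' measurableSet_Ioo h3
  · rw [indicator_of_notMem hω]
    exact zero_le

lemma FB.main (hB : FB H a P B) (hH : H ∈ Ioo (0:ℝ) 1) {ε : ℕ → ℝ} (hε : ∀ n, 0 < ε n) {t : ℝ} (ht : 0 < t) (ρ : ℝ)
   {η : ℝ} (hη : 0 < η) (hO : (fun n => ε n) =O[atTop] fun n : ℕ => (n : ℝ) ^ (-η)) :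
    ∀ᵐ ω ∂P, Tendsto (fun n => ENNReal.ofReal (ε n ^ (1/H)) * crossKe (ε n) (fun r => B r ω + ρ) 0 t) atTop (𝓝 (ENNReal.ofReal t * cHe P B)) := by
  have ht0 : ENNReal.ofReal t ≠ 0 := by simpa using ht
  have hu : ∀ᵐ ω ∂P, ∀ k : ℕ, ∀ c : ℝ≥0∞, ENNReal.ofReal t * ((ENNReal.ofReal ((k:ℝ) + 1))⁻¹ * (1 + kapp P B ((k:ℝ)+1))) < c →
      ∀ᶠ n in atTop, ENNReal.ofReal (ε n ^ (1/H)) * crossKe (ε n) (fun r => B r ω + ρ) 0 t < c :=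
    ae_all_iff.2 fun k => hB.upp2 hH (by positivity) hε ht ρ hη hO
  have hl0 : ∀ q : {p : ℝ≥0∞ × ℝ // 0 < p.2 ∧ p.1 < ENNReal.ofReal t * ((ENNReal.ofReal p.2)⁻¹ * kapp P B p.2)}, ∀ᵐ ω ∂P,
      ∀ᶠ n in atTop, q.1.1 < ENNReal.ofReal (ε n ^ (1/H)) * crossKe (ε n) (fun r => B r ω + ρ) 0 t := fun q => by
    filter_upwards [hB.low2 hH q.2.1 hε ht ρ hη hO] with ω hω
    exact hω _ q.2.2
  have hex : ∀ c < ENNReal.ofReal t * cHe P B, ∃ L : ℝ, 0 < L ∧ c < ENNReal.ofReal t * ((ENNReal.ofReal L)⁻¹ * kapp P B L) := by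
    intro c hc
    rw [cHe, ENNReal.mul_iSup] at hc
    obtain ⟨L, hL⟩ := lt_iSup_iff.1 hc
    rw [ENNReal.mul_iSup] at hL
    obtain ⟨hL0, hL⟩ := lt_iSup_iff.1 hL
    exact ⟨L, hL0, hL⟩
  have hl : ∀ᵐ ω ∂P, ∀ q : ℚ, ENNReal.ofReal q < ENNReal.ofReal t * cHe P B → 
      ∀ᶠ n in atTop, ENNReal.ofReal q < ENNReal.ofReal (ε n ^ (1/H)) * crossKe (ε n) (fun r => B r ω + ρ) 0 t := by
    refine ae_all_iff.2 fun q => ?_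
    by_cases hq : ENNReal.ofReal q < ENNReal.ofReal t * cHe P B
    · obtain ⟨L, hL, h⟩ := hex _ hq
      filter_upwards [hl0 ⟨(_, L), hL, h⟩] with ω hω _
      exact hω
    · filter_upwards with ω h
      exact absurd h hq
  have hfin := hB.cHe_fin hH
  filter_upwards [hu, hl] with ω h1 h2
  refine tendsto_order.2 ⟨fun c hc => ?_, fun c hc => ?_⟩
  · obtain ⟨q, hq0, h3, h4⟩ := ENNReal.lt_iff_exists_rat_btwn.1 hc
    filter_upwards [h2 q h4] with n hn
    exact h3.trans hn
  · have h3 : Tendsto (fun k : ℕ => ENNReal.ofReal t * ((ENNReal.ofReal ((k:ℝ) + 1))⁻¹ + cHe P B)) atTop (𝓝 (ENNReal.ofReal t * (0 + cHe P B))) := by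
      refine ENNReal.Tendsto.const_mul (Tendsto.add ?_ tendsto_const_nhds) (Or.inr ENNReal.ofReal_ne_top)
      have h5 : Tendsto (fun k : ℕ => ENNReal.ofReal ((k:ℝ) + 1)) atTop (𝓝 ⊤) :=
        ENNReal.tendsto_ofReal_atTop.comp (tendsto_atTop_add_const_right _ _ tendsto_natCast_atTop_atTop)
      have h6 := tendsto_inv_iff.2 h5
      rwa [ENNReal.inv_top] at h6
    rw [zero_add] at h3
    obtain ⟨k, hk⟩ := (h3.eventually_lt_const hc).exists
    refine h1 k c (lt_of_le_of_lt ?_ hk)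
    gcongr
    rw [mul_add, mul_one]
    gcongr
    exact le_iSup_of_le ((k:ℝ)+1) (le_iSup_of_le (by positivity) le_rfl)

end

end

/-- **Convergence of (1/H)-th variation along uniform Lebesgue partitions.**
For all `H ∈ (0,1)` the constant `c_H` is positive and finite, and for every `ρ ∈ ℝ`,
`t ∈ (0,∞)` and every sequence `(ε_n)` of positive reals with `ε_n = O(n^{-η})` for some
`η > 0`, almost surely `ε_n^{1/H} K_{0,t}(ε_n, B^H + ρ) → c_H t`. -/
theorem variation_along_uniform_lebesgue_partitions
    {Ω : Type*} [MeasurableSpace Ω] (P : Measure Ω) [IsProbabilityMeasure P]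
    (H : ℝ) (hH : H ∈ Set.Ioo (0 : ℝ) 1) (B : ℝ → Ω → ℝ) (hB : IsFBM H P B) :
    (0 < cHe P B ∧ cHe P B ≠ ⊤) ∧
    ∀ (ρ t : ℝ), 0 < t → ∀ ε : ℕ → ℝ, (∀ n, 0 < ε n) →
      (∃ η : ℝ, 0 < η ∧ (fun n => ε n) =O[atTop] fun n : ℕ => (n : ℝ) ^ (-η)) →
      ∀ᵐ ω ∂P, Tendsto (fun n => ε n ^ (1 / H) * crossKR (ε n) (fun r => B r ω + ρ) 0 t)
        atTop (𝓝 (cH P B * t)) := by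
  obtain ⟨h1, h2, h3, h4, aH, ha, h5⟩ := hB
  have hF : FB H aH P B := ⟨h1, h2, h3, h4, ha, h5⟩
  refine ⟨⟨hF.cHe_pos hH, hF.cHe_fin hH⟩, ?_⟩
  rintro ρ t ht ε hε ⟨η, hη, hO⟩
  have hfin := hF.cHe_fin hH
  filter_upwards [hF.main hH hε ht ρ hη hO] with ω hω
  have h6 := (ENNReal.tendsto_toReal (by finiteness)).comp hω
  rw [ENNReal.toReal_mul, ENNReal.toReal_ofReal ht.le, mul_comm] at h6
  refine h6.congr fun n => ?_
  have := hε n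
  simp only [Function.comp, ENNReal.toReal_mul]
  rw [ENNReal.toReal_ofReal (by positivity), crossKR]

end
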